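/- arXiv:1803.02658 — 2 statements merged into one kernel-verified Lean document; each statement's English description precedes it below -/
import Mathlib

section
/- Let N ≥ 2 and let Ω ⊂ ℝ^N be an open ball. Let c₊, c₋, h : cl(Ω) → ℝ be continuous with c₊ ≥ 0, c₋ ≥ 0 and c₊·c₋ ≡ 0 on Ω, let μ : Ω → ℝ be continuous and bounded, and set Ω₊ := closure of {x ∈ Ω : c₊(x) ≠ 0}. Assume Ω₊ ≠ ∅ and that there exist ε > 0 and μ₁ > 0 such that μ(x) ≥ μ₁ and c₋(x) = 0 for every x ∈ Ω with dist(x, Ω₊) < ε. Then for all real numbers Λ₂ > Λ₁ > 0 there exists M > 0 such that for every λ ∈ [Λ₁, Λ₂], every classical solution u of (P_λ) satisfies sup_Ω u ≤ M. -/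
open MeasureTheory Metric Set

/-- The Laplacian of a real-valued function on `ℝ^N`, as the sum of second
partial derivatives in the coordinate directions. -/
noncomputable def lap {N : ℕ} (u : EuclideanSpace ℝ (Fin N) → ℝ)
    (x : EuclideanSpace ℝ (Fin N)) : ℝ :=
  ∑ i : Fin N, fderiv ℝ (fun y => fderiv ℝ u y (EuclideanSpace.single i 1)) x
    (EuclideanSpace.single i 1)

/-- `u` is a classical solution of `(P_lam)` on `Ω`:
`u ∈ C²(Ω) ∩ C(cl Ω)`, bounded, `u = 0` on `∂Ω`, and
`-Δu = (lam c₊ - c₋) u + μ |∇u|² + h` pointwise in `Ω`. -/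
def IsClassicalSolution {N : ℕ} (Ω : Set (EuclideanSpace ℝ (Fin N)))
    (cp cm h μ : EuclideanSpace ℝ (Fin N) → ℝ) (lam : ℝ)
    (u : EuclideanSpace ℝ (Fin N) → ℝ) : Prop :=
  ContDiffOn ℝ 2 u Ω ∧ ContinuousOn u (closure Ω) ∧
    (∃ C : ℝ, ∀ x ∈ closure Ω, |u x| ≤ C) ∧
    (∀ x ∈ frontier Ω, u x = 0) ∧
    ∀ x ∈ Ω, -lap u x = (lam * cp x - cm x) * u x + μ x * ‖gradient u x‖ ^ 2 + h x

section

variable {N : ℕ}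

local notation "𝔼" => EuclideanSpace ℝ (Fin N)

section Calculus

/-- The `i`-th partial derivative. -/
noncomputable def pd (i : Fin N) (f : 𝔼 → ℝ) (x : 𝔼) : ℝ :=
  fderiv ℝ f x (EuclideanSpace.single i 1)

theorem lap_eq_sum_pd (f : 𝔼 → ℝ) (x : 𝔼) : lap f x = ∑ i, pd i (pd i f) x := rfl

theorem contDiffAt_pd {u : 𝔼 → ℝ} {x : 𝔼} (hu : ContDiffAt ℝ 2 u x) (i : Fin N) :
    ContDiffAt ℝ 1 (pd i u) x :=
  (hu.fderiv_right (m := 1) (by norm_num)).clm_apply contDiffAt_const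

theorem contDiff_pd {n m : ℕ∞} {u : 𝔼 → ℝ} (hu : ContDiff ℝ n u) (hmn : m + 1 ≤ n)
    (i : Fin N) : ContDiff ℝ m (pd i u) :=
  (hu.fderiv_right (m := m) (by exact_mod_cast hmn)).clm_apply contDiff_const

theorem eventually_differentiableAt {u : 𝔼 → ℝ} {x : 𝔼} (hu : ContDiffAt ℝ 2 u x) :
    ∀ᶠ y in nhds x, DifferentiableAt ℝ u y :=
  (hu.eventually (by simp)).mono fun _ hy => hy.differentiableAt (by simp)

theorem pd_congr {f g : 𝔼 → ℝ} {x : 𝔼} (h : f =ᶠ[nhds x] g) (i : Fin N) :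
    pd i f =ᶠ[nhds x] pd i g :=
  h.eventuallyEq_nhds.mono fun y hy => by simp only [pd, hy.fderiv_eq]

theorem lap_congr {f g : 𝔼 → ℝ} {x : 𝔼} (h : f =ᶠ[nhds x] g) : lap f x = lap g x := by
  simp only [lap_eq_sum_pd]
  exact Finset.sum_congr rfl fun i _ => (pd_congr (pd_congr h i) i).eq_of_nhds

theorem pd_comp {u : 𝔼 → ℝ} {g : ℝ → ℝ} {g' : ℝ} {x : 𝔼} (hg : HasDerivAt g g' (u x))
    (hu : DifferentiableAt ℝ u x) (i : Fin N) :
    pd i (fun y => g (u y)) x = g' * pd i u x := by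
  have := hg.comp_hasFDerivAt x hu.hasFDerivAt
  simp only [pd, Function.comp_def] at *
  rw [this.fderiv]; simp

theorem lap_comp {u : 𝔼 → ℝ} {g g' : ℝ → ℝ} {g'' : ℝ} {x : 𝔼} (hg : ∀ t, HasDerivAt g (g' t) t)
    (hg' : HasDerivAt g' g'' (u x)) (hu : ContDiffAt ℝ 2 u x) :
    lap (fun y => g (u y)) x = g'' * ∑ i, pd i u x ^ 2 + g' (u x) * lap u x := by
  simp only [lap_eq_sum_pd, Finset.mul_sum, ← Finset.sum_add_distrib]
  refine Finset.sum_congr rfl fun i _ => ?_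
  have h1 : pd i (fun y => g (u y)) =ᶠ[nhds x] fun y => g' (u y) * pd i u y :=
    (eventually_differentiableAt hu).mono fun y hy => pd_comp (hg _) hy i
  have hd := hu.differentiableAt (by simp)
  have h2 : HasFDerivAt (fun y => g' (u y)) (g'' • fderiv ℝ u x) x :=
    hg'.comp_hasFDerivAt x hd.hasFDerivAt
  have h3 := ((contDiffAt_pd hu i).differentiableAt (by simp)).hasFDerivAt
  rw [(pd_congr h1 i).eq_of_nhds]
  have h4 := (h2.mul h3).fderiv
  simp only [Pi.mul_def] at h4
  rw [pd, h4]
  simp only [pd, add_apply, smul_apply, smul_eq_mul]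
  ring

theorem lap_add {f g : 𝔼 → ℝ} {x : 𝔼} (hf : ContDiffAt ℝ 2 f x) (hg : ContDiffAt ℝ 2 g x) :
    lap (fun y => f y + g y) x = lap f x + lap g x := by
  simp only [lap_eq_sum_pd, ← Finset.sum_add_distrib]
  refine Finset.sum_congr rfl fun i _ => ?_
  have h1 : pd i (fun y => f y + g y) =ᶠ[nhds x] fun y => pd i f y + pd i g y := by
    filter_upwards [eventually_differentiableAt hf, eventually_differentiableAt hg] with y h1 h2
    simp only [pd, fderiv_fun_add h1 h2, add_apply]
  rw [(pd_congr h1 i).eq_of_nhds]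
  simp only [pd]
  erw [fderiv_fun_add ((contDiffAt_pd hf i).differentiableAt (by simp))
    ((contDiffAt_pd hg i).differentiableAt (by simp))]
  rfl

theorem lap_const_mul {f : 𝔼 → ℝ} {x : 𝔼} (hf : ContDiffAt ℝ 2 f x) (c : ℝ) :
    lap (fun y => c * f y) x = c * lap f x := by
  have h := lap_comp (g := fun t => c * t) (g' := fun _ => c) (g'' := 0)
    (fun t => by simpa using (hasDerivAt_id t).const_mul c) (hasDerivAt_const _ _) hf
  simpa using h

theorem lap_sub {f g : 𝔼 → ℝ} {x : 𝔼} (hf : ContDiffAt ℝ 2 f x) (hg : ContDiffAt ℝ 2 g x) :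
    lap (fun y => f y - g y) x = lap f x - lap g x := by
  have h := lap_add hf (g := fun y => (-1) * g y) (contDiffAt_const.mul hg)
  rw [lap_const_mul hg] at h
  simpa [sub_eq_add_neg] using h

theorem lap_const (c : ℝ) (x : 𝔼) : lap (fun _ => c) x = 0 := by
  simp [lap]

theorem lap_const_sub {f : 𝔼 → ℝ} {x : 𝔼} (hf : ContDiffAt ℝ 2 f x) (c : ℝ) :
    lap (fun y => c - f y) x = - lap f x := by
  rw [lap_sub contDiffAt_const hf, lap_const, zero_sub]

theorem lap_exp_mul {u : 𝔼 → ℝ} {x : 𝔼} (hu : ContDiffAt ℝ 2 u x) (a : ℝ) :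
    lap (fun y => Real.exp (a * u y)) x =
      Real.exp (a * u x) * (a * lap u x + a ^ 2 * ∑ i, pd i u x ^ 2) := by
  have hg : ∀ t, HasDerivAt (fun t => Real.exp (a * t)) (a * Real.exp (a * t)) t := fun t => by
    simpa [mul_comm] using ((hasDerivAt_id t).const_mul a).exp
  rw [lap_comp hg ((hg _).const_mul a) hu]
  ring

theorem pd_coord (i j : Fin N) (x : 𝔼) : pd i (fun y : 𝔼 => y j) x = if j = i then 1 else 0 := by
  have h : HasFDerivAt (fun y : 𝔼 => y j) (EuclideanSpace.proj j : 𝔼 →L[ℝ] ℝ) x :=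
    (EuclideanSpace.proj j : 𝔼 →L[ℝ] ℝ).hasFDerivAt
  rw [pd, h.fderiv]
  simp

theorem lap_coord (j : Fin N) (x : 𝔼) : lap (fun y : 𝔼 => y j) x = 0 := by
  rw [lap_eq_sum_pd]
  refine Finset.sum_eq_zero fun i _ => ?_
  have : pd i (fun y : 𝔼 => y j) = fun _ => if j = i then 1 else 0 := funext (pd_coord i j)
  rw [this]; simp [pd]

theorem pd_normSq (p : 𝔼) (i : Fin N) (x : 𝔼) :
    pd i (fun y => ‖y - p‖ ^ 2) x = 2 * (x i - p i) := by
  have h : HasFDerivAt (fun y : 𝔼 => ‖y - p‖ ^ 2) (2 • innerSL ℝ (x - p)) x := by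
    simpa using ((hasFDerivAt_id x).sub_const p).norm_sq
  rw [pd, h.fderiv]
  simp [EuclideanSpace.inner_single_right]

theorem lap_normSq (p x : 𝔼) : lap (fun y => ‖y - p‖ ^ 2) x = 2 * N := by
  rw [lap_eq_sum_pd]
  have : ∀ i, pd i (pd i (fun y => ‖y - p‖ ^ 2)) x = 2 := fun i => by
    have h : pd i (fun y => ‖y - p‖ ^ 2) = fun y => 2 * (y i - p i) := funext (pd_normSq p i)
    rw [h]
    have := pd_comp (u := fun y : 𝔼 => y i) (g := fun t => 2 * (t - p i)) (g' := 2) (x := x)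
      (by simpa using ((hasDerivAt_id (x i)).sub_const (p i)).const_mul 2)
      (EuclideanSpace.proj i : 𝔼 →L[ℝ] ℝ).differentiableAt i
    rw [this, pd_coord]; simp
  simp [this, mul_comm]

theorem contDiff_normSq (p : 𝔼) {n : WithTop ℕ∞} : ContDiff ℝ n (fun y : 𝔼 => ‖y - p‖ ^ 2) :=
  (contDiff_id.sub contDiff_const).norm_sq ℝ

theorem sum_pd_normSq (p x : 𝔼) : ∑ i, pd i (fun y => ‖y - p‖ ^ 2) x ^ 2 = 4 * ‖x - p‖ ^ 2 := by
  simp only [pd_normSq]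
  rw [EuclideanSpace.norm_sq_eq, Finset.mul_sum]
  refine Finset.sum_congr rfl fun i _ => ?_
  simp; ring

theorem norm_gradient_sq (u : 𝔼 → ℝ) (x : 𝔼) : ‖gradient u x‖ ^ 2 = ∑ i, pd i u x ^ 2 := by
  rw [EuclideanSpace.norm_sq_eq]
  refine Finset.sum_congr rfl fun i _ => ?_
  have h : inner ℝ (gradient u x) (EuclideanSpace.single i (1 : ℝ)) = pd i u x := by
    simp [gradient, pd, InnerProductSpace.toDual_symm_apply]
  rw [← h, EuclideanSpace.inner_single_right]
  simp

theorem lap_nonpos_of_isLocalMax {f : 𝔼 → ℝ} {x : 𝔼} (hf : ContDiffAt ℝ 2 f x)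
    (hm : IsLocalMax f x) : lap f x ≤ 0 := by
  rw [lap_eq_sum_pd]
  refine Finset.sum_nonpos fun i _ => ?_
  by_contra! hpos
  set e : 𝔼 := EuclideanSpace.single i 1
  let l : ℝ → 𝔼 := fun t => x + t • e
  have hl : ∀ t, HasDerivAt l e t := fun t => by
    simpa [l] using ((hasDerivAt_id t).smul_const e).const_add x
  have hl0 : l 0 = x := by simp [l]
  have hlc : Filter.Tendsto l (nhds 0) (nhds x) := by
    simpa [hl0] using (hl 0).continuousAt.tendsto
  have hd1 : deriv (fun t => f (l t)) =ᶠ[nhds 0] fun t => pd i f (l t) := by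
    filter_upwards [hlc.eventually (eventually_differentiableAt hf)] with t ht
    exact (ht.hasFDerivAt.comp_hasDerivAt t (hl t)).deriv
  have hd2 : deriv (deriv (fun t => f (l t))) 0 = pd i (pd i f) x := by
    rw [hd1.deriv_eq]
    have h := ((contDiffAt_pd hf i).differentiableAt (by simp)).hasFDerivAt
    rw [← hl0] at h
    have := (h.comp_hasDerivAt 0 (hl 0)).deriv
    rw [hl0] at this
    exact this
  have hmax : IsLocalMax (fun t => f (l t)) 0 := by
    have := hlc.eventually hm
    simpa [IsLocalMax, IsMaxFilter, hl0] using this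
  have hmin : IsLocalMin (fun t => f (l t)) 0 :=
    isLocalMin_of_deriv_deriv_pos (by rw [hd2]; exact hpos) hmax.deriv_eq_zero
      (by
        have := hf.continuousAt
        rw [← hl0] at this
        exact this.comp (f := l) (hl 0).continuousAt)
  have hconst : (fun t => f (l t)) =ᶠ[nhds 0] fun _ => f (l 0) := by
    filter_upwards [hmax, hmin] with t h1 h2
    exact le_antisymm h1 h2
  have : deriv (deriv (fun t => f (l t))) 0 = 0 := by
    rw [hconst.deriv.deriv_eq]; simp
  linarith [hd2 ▸ this]

end Calculus

section TestFunctions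

theorem hasDerivAt_max_zero_pow (k : ℕ) (t : ℝ) :
    HasDerivAt (fun s : ℝ => max s 0 ^ (k + 2)) ((k + 2) * max t 0 ^ (k + 1)) t := by
  rcases lt_trichotomy t 0 with ht | rfl | ht
  · have : (fun s : ℝ => max s 0 ^ (k + 2)) =ᶠ[nhds t] fun _ => 0 := by
      filter_upwards [gt_mem_nhds ht] with s hs
      simp [max_eq_right hs.le]
    rw [max_eq_right ht.le]
    simpa using (hasDerivAt_const t (0 : ℝ)).congr_of_eventuallyEq this
  · have h : (fun s : ℝ => max s 0 ^ (k + 2)) =O[nhds 0] fun s => s ^ 2 := by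
      refine Asymptotics.IsBigO.of_bound 1 ?_
      filter_upwards [Metric.ball_mem_nhds (0 : ℝ) one_pos] with s hs
      have hs1 : |s| ≤ 1 := by simpa using (mem_ball_zero_iff.mp hs).le
      have h0 : 0 ≤ max s 0 := le_max_right _ _
      have h1 : max s 0 ≤ |s| := max_le (le_abs_self s) (abs_nonneg s)
      rw [one_mul, Real.norm_of_nonneg (by positivity), Real.norm_of_nonneg (by positivity),
        pow_add, ← sq_abs s]
      calc max s 0 ^ k * max s 0 ^ 2 ≤ 1 * |s| ^ 2 := by
            gcongr
            exact pow_le_one₀ h0 (h1.trans hs1)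
        _ = |s| ^ 2 := one_mul _
    have h2 : (fun s : ℝ => max s 0 ^ (k + 2)) =o[nhds 0] fun s => s :=
      h.trans_isLittleO (by simpa using Asymptotics.isLittleO_pow_pow (𝕜 := ℝ) one_lt_two)
    rw [hasDerivAt_iff_isLittleO]
    simpa using h2
  · have : (fun s : ℝ => max s 0 ^ (k + 2)) =ᶠ[nhds t] fun s => s ^ (k + 2) := by
      filter_upwards [lt_mem_nhds ht] with s hs
      simp [max_eq_left hs.le]
    rw [max_eq_left ht.le]
    simpa using (hasDerivAt_pow (k + 2) t).congr_of_eventuallyEq this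

theorem contDiff_max_zero_pow (n k : ℕ) :
    ContDiff ℝ n (fun s : ℝ => max s 0 ^ (k + n + 1)) := by
  induction n with
  | zero => exact contDiff_zero.2 (by fun_prop)
  | succ n ih =>
    have hd : ∀ t, HasDerivAt (fun s : ℝ => max s 0 ^ (k + (n + 1) + 1)) _ t := fun t =>
      hasDerivAt_max_zero_pow (k + n) t
    rw [Nat.cast_add, Nat.cast_one, contDiff_succ_iff_deriv]
    refine ⟨fun t => (hd t).differentiableAt, by simp, ?_⟩
    rw [funext fun t => (hd t).deriv]
    exact contDiff_const.mul ih

/-- The radial bump `((R² - ‖x - p‖²)₊)ᵏ`. -/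
noncomputable def bump (p : 𝔼) (R : ℝ) (k : ℕ) (x : 𝔼) : ℝ := max (R ^ 2 - ‖x - p‖ ^ 2) 0 ^ k

theorem bump_nonneg (p : 𝔼) (R : ℝ) (k : ℕ) (x : 𝔼) : 0 ≤ bump p R k x :=
  pow_nonneg (le_max_right _ _) _

theorem bump_le (p : 𝔼) (R : ℝ) (k : ℕ) (x : 𝔼) : bump p R k x ≤ (R ^ 2) ^ k := by
  refine pow_le_pow_left₀ (le_max_right _ _) (max_le ?_ (sq_nonneg R)) k
  nlinarith [sq_nonneg ‖x - p‖]

theorem continuous_bump (p : 𝔼) (R : ℝ) (k : ℕ) : Continuous (bump p R k) := by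
  unfold bump; fun_prop

theorem bump_eq_zero {p x : 𝔼} {R : ℝ} {k : ℕ} (hk : k ≠ 0) (hR : 0 ≤ R)
    (hx : x ∉ Metric.closedBall p R) : bump p R k x = 0 := by
  have : R < ‖x - p‖ := by simpa [dist_eq_norm] using hx
  rw [bump, max_eq_right (by nlinarith), zero_pow hk]

theorem hasCompactSupport_bump (p : 𝔼) {R : ℝ} {k : ℕ} (hk : k ≠ 0) (hR : 0 ≤ R) :
    HasCompactSupport (bump p R k) :=
  HasCompactSupport.intro (isCompact_closedBall p R) fun _ hx => bump_eq_zero hk hR hx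

theorem contDiff_bump (p : 𝔼) (R : ℝ) (k : ℕ) : ContDiff ℝ 2 (bump p R (k + 3)) :=
  (contDiff_max_zero_pow 2 k).comp (contDiff_const.sub (contDiff_normSq p))

theorem pd_const_sub_normSq (p : 𝔼) (c : ℝ) (i : Fin N) (x : 𝔼) :
    pd i (fun y => c - ‖y - p‖ ^ 2) x = -(2 * (x i - p i)) := by
  have := pd_comp (u := fun y : 𝔼 => ‖y - p‖ ^ 2) (g := fun t => c - t) (g' := -1) (x := x)
    (by simpa using (hasDerivAt_id _).const_sub c)
    ((contDiff_normSq p (n := 2)).differentiable (by simp) x) i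
  rw [this, pd_normSq]; ring

theorem pd_bump (p : 𝔼) (R : ℝ) (k : ℕ) (i : Fin N) (x : 𝔼) :
    pd i (bump p R (k + 2)) x = -(2 * (k + 2)) * (x i - p i) * bump p R (k + 1) x := by
  have h := pd_comp (u := fun y : 𝔼 => R ^ 2 - ‖y - p‖ ^ 2) (x := x)
    (hasDerivAt_max_zero_pow k _)
    ((contDiff_const.sub (contDiff_normSq p (n := 2))).differentiable (by simp) x) i
  rw [pd_const_sub_normSq] at h
  unfold bump
  rw [h]; ring

theorem lap_bump (p : 𝔼) (R : ℝ) (k : ℕ) (x : 𝔼) :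
    lap (bump p R (k + 3)) x = (k + 3) * (k + 2) * 4 * ‖x - p‖ ^ 2 * bump p R (k + 1) x
      - 2 * N * (k + 3) * bump p R (k + 2) x := by
  have hu : ContDiffAt ℝ 2 (fun y : 𝔼 => R ^ 2 - ‖y - p‖ ^ 2) x :=
    (contDiff_const.sub (contDiff_normSq p)).contDiffAt
  have hsum : ∑ i, pd i (fun y => R ^ 2 - ‖y - p‖ ^ 2) x ^ 2 = 4 * ‖x - p‖ ^ 2 := by
    rw [← sum_pd_normSq]
    simp only [pd_const_sub_normSq, pd_normSq, neg_sq]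
  have h := lap_comp (u := fun y : 𝔼 => R ^ 2 - ‖y - p‖ ^ 2) (x := x)
    (hasDerivAt_max_zero_pow (k + 1))
    ((hasDerivAt_max_zero_pow k (R ^ 2 - ‖x - p‖ ^ 2)).const_mul (((k + 1 : ℕ) : ℝ) + 2)) hu
  rw [hsum, lap_const_sub (contDiff_normSq p).contDiffAt, lap_normSq] at h
  unfold bump
  rw [h]; push_cast; ring

/-- A power of the radial bump is a strict subsolution away from the centre. -/
theorem exists_bump_subsolution (R : ℝ) {δ K : ℝ} (hδ : 0 < δ) (hK : 0 ≤ K) :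
    ∃ (k : ℕ) (C : ℝ), 0 ≤ C ∧ ∀ p x : 𝔼, bump p R (k + 1) x ≤
      lap (bump p R (k + 3)) x - K * bump p R (k + 3) x
        + (Metric.closedBall p δ).indicator (fun _ => C) x := by
  obtain ⟨k, hk⟩ := exists_nat_ge ((2 * N * R ^ 2 + K * (R ^ 2) ^ 2 + 1) / (4 * δ ^ 2))
  rw [div_le_iff₀ (by positivity)] at hk
  refine ⟨k, (R ^ 2) ^ (k + 1) * (1 + 2 * N * (k + 3) * R ^ 2 + K * (R ^ 2) ^ 2),
    by positivity, fun p x => ?_⟩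
  rw [lap_bump]
  have hb : bump p R (k + 1) x ≤ (R ^ 2) ^ (k + 1) := bump_le ..
  have hb0 := bump_nonneg p R (k + 1) x
  set D := max (R ^ 2 - ‖x - p‖ ^ 2) 0 with hD
  have hD0 : 0 ≤ D := le_max_right _ _
  have hDR : D ≤ R ^ 2 := max_le (by nlinarith [sq_nonneg ‖x - p‖]) (sq_nonneg R)
  have hD2 : D ^ 2 ≤ (R ^ 2) ^ 2 := pow_le_pow_left₀ hD0 hDR 2
  have e2 : bump p R (k + 2) x = bump p R (k + 1) x * D := pow_succ _ _
  have e3 : bump p R (k + 3) x = bump p R (k + 1) x * D ^ 2 := pow_add _ (k + 1) 2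
  rw [e2, e3]
  have hKD : K * D ^ 2 ≤ K * (R ^ 2) ^ 2 := by gcongr
  have hND : (N : ℝ) * D ≤ N * R ^ 2 := by gcongr
  have hk0 : (0 : ℝ) ≤ k := k.cast_nonneg
  by_cases hx : x ∈ Metric.closedBall p δ
  · rw [Set.indicator_of_mem hx]
    have h1 : 1 - (k + 3) * (k + 2) * 4 * ‖x - p‖ ^ 2 + 2 * N * (k + 3) * D + K * D ^ 2 ≤
        1 + 2 * N * (k + 3) * R ^ 2 + K * (R ^ 2) ^ 2 := by
      have : (0 : ℝ) ≤ (k + 3) * (k + 2) * 4 * ‖x - p‖ ^ 2 := by positivity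
      nlinarith
    have h2 : bump p R (k + 1) x *
        (1 - (k + 3) * (k + 2) * 4 * ‖x - p‖ ^ 2 + 2 * N * (k + 3) * D + K * D ^ 2) ≤
        (R ^ 2) ^ (k + 1) * (1 + 2 * N * (k + 3) * R ^ 2 + K * (R ^ 2) ^ 2) :=
      (mul_le_mul_of_nonneg_left h1 hb0).trans (mul_le_mul_of_nonneg_right hb (by positivity))
    linarith
  · rw [Set.indicator_of_notMem hx, add_zero]
    have hδx : δ < ‖x - p‖ := by simpa [dist_eq_norm] using hx
    have hs : δ ^ 2 ≤ ‖x - p‖ ^ 2 := by gcongr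
    have h1 : K * (R ^ 2) ^ 2 + 1 ≤ (k + 2) * 4 * ‖x - p‖ ^ 2 - 2 * N * D := by
      have : (k + 2) * 4 * δ ^ 2 ≤ (k + 2) * 4 * ‖x - p‖ ^ 2 := by gcongr
      nlinarith
    have h2 : 1 ≤ (k + 3) * ((k + 2) * 4 * ‖x - p‖ ^ 2 - 2 * N * D) - K * D ^ 2 := by
      have : (0 : ℝ) ≤ K * (R ^ 2) ^ 2 := by positivity
      nlinarith
    nlinarith [mul_le_mul_of_nonneg_left h2 hb0]

theorem continuous_pd {f : 𝔼 → ℝ} (hf : ContDiff ℝ 1 f) (i : Fin N) : Continuous (pd i f) :=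
  (hf.continuous_fderiv (by simp)).clm_apply continuous_const

theorem continuous_lap {f : 𝔼 → ℝ} (hf : ContDiff ℝ 2 f) : Continuous (lap f) :=
  continuous_finsetSum _ fun i _ =>
    continuous_pd (contDiff_pd (n := 2) (m := 1) hf (by norm_num) i) i

theorem hasCompactSupport_pd {f : 𝔼 → ℝ} (hf : HasCompactSupport f) (i : Fin N) :
    HasCompactSupport (pd i f) :=
  hf.fderiv_apply ℝ _

theorem integral_mul_pd {f g : 𝔼 → ℝ} (hf : ContDiff ℝ 1 f) (hg : ContDiff ℝ 1 g)
    (hc : HasCompactSupport f) (i : Fin N) : ∫ x, f x * pd i g x = -∫ x, pd i f x * g x := by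
  refine integral_mul_fderiv_eq_neg_fderiv_mul_of_integrable ?_ ?_ ?_
    (fun x _ => hf.differentiable (by simp) x) (fun x _ => hg.differentiable (by simp) x)
  · exact ((continuous_pd hf i).mul hg.continuous).integrable_of_hasCompactSupport
      (hasCompactSupport_pd hc i).mul_right
  · exact (hf.continuous.mul (continuous_pd hg i)).integrable_of_hasCompactSupport hc.mul_right
  · exact (hf.continuous.mul hg.continuous).integrable_of_hasCompactSupport hc.mul_right

theorem integral_mul_lap {f g : 𝔼 → ℝ} (hf : ContDiff ℝ 2 f) (hg : ContDiff ℝ 2 g)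
    (hc : HasCompactSupport f) : ∫ x, f x * lap g x = ∫ x, lap f x * g x := by
  have hf1 : ContDiff ℝ 1 f := hf.of_le (by norm_num)
  have hg1 : ContDiff ℝ 1 g := hg.of_le (by norm_num)
  have hpf := fun i => contDiff_pd (n := 2) (m := 1) hf (by norm_num) i
  have hpg := fun i => contDiff_pd (n := 2) (m := 1) hg (by norm_num) i
  simp only [lap_eq_sum_pd, Finset.mul_sum, Finset.sum_mul]
  rw [integral_finsetSum, integral_finsetSum]
  · refine Finset.sum_congr rfl fun i _ => ?_
    have h1 := integral_mul_pd hf1 (hpg i) hc i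
    have h2 := integral_mul_pd (hpf i) hg1 (hasCompactSupport_pd hc i) i
    rw [h1, h2, neg_neg]
  · intro i _
    exact ((continuous_pd (hpf i) i).mul hg.continuous).integrable_of_hasCompactSupport
      (hasCompactSupport_pd (hasCompactSupport_pd hc i) i).mul_right
  · intro i _
    exact (hf.continuous.mul (continuous_pd (hpg i) i)).integrable_of_hasCompactSupport
      hc.mul_right

theorem exists_contDiff_extension {u : 𝔼 → ℝ} {Ω : Set 𝔼} (hΩ : IsOpen Ω)
    (hu : ContDiffOn ℝ 2 u Ω) {p : 𝔼} {R : ℝ} (hR : 0 < R) (hsub : Metric.closedBall p R ⊆ Ω) :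
    ∃ v : 𝔼 → ℝ, ContDiff ℝ 2 v ∧ ∀ x ∈ Metric.closedBall p R, v =ᶠ[nhds x] u := by
  obtain ⟨d, hd, hdΩ⟩ := (isCompact_closedBall p R).exists_cthickening_subset_open hΩ hsub
  rw [cthickening_closedBall hd.le hR.le] at hdΩ
  let χ : ContDiffBump p := ⟨R + d / 2, R + d, by positivity, by linarith⟩
  refine ⟨fun x => χ x * u x, ?_, fun x hx => ?_⟩
  · rw [contDiff_iff_contDiffAt]
    intro x
    by_cases hx : x ∈ Ω
    · exact χ.contDiff.contDiffAt.mul (hu.contDiffAt (hΩ.mem_nhds hx))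
    · have hx' : x ∉ tsupport χ := by
        rw [χ.tsupport_eq]; exact fun h => hx (hdΩ (by simpa [χ, add_comm] using h))
      refine contDiffAt_const (c := (0 : ℝ)) |>.congr_of_eventuallyEq ?_
      filter_upwards [notMem_tsupport_iff_eventuallyEq.mp hx'] with y hy
      simp [hy]
  · have hx' : x ∈ Metric.ball p χ.rIn :=
      Metric.closedBall_subset_ball (by simp [χ]; linarith) hx
    filter_upwards [χ.eventuallyEq_one_of_mem_ball hx'] with y hy
    simp [hy]

end TestFunctions

section MeanValue

theorem fderiv_apply_eq_sum (f : 𝔼 → ℝ) (x y : 𝔼) :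
    fderiv ℝ f x y = ∑ i, y i * pd i f x := by
  conv_lhs => rw [← (EuclideanSpace.basisFun (Fin N) ℝ).sum_repr y]
  simp [pd]

theorem pd_comp_add_smul {f : 𝔼 → ℝ} (hf : Differentiable ℝ f) (x y : 𝔼) (t : ℝ) (i : Fin N) :
    pd i (fun z => f (x + t • z)) y = t * pd i f (x + t • y) := by
  have h : HasFDerivAt (fun z : 𝔼 => x + t • z) (t • ContinuousLinearMap.id ℝ 𝔼) y :=
    ((hasFDerivAt_id y).const_smul t).const_add x
  have := ((hf (x + t • y)).hasFDerivAt.comp y h).fderiv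
  simp only [pd, Function.comp_def] at *
  rw [this]; simp

theorem hasDerivAt_integral_bump_mul {f : 𝔼 → ℝ} (hf : ContDiff ℝ 2 f) (x : 𝔼) (t : ℝ) :
    HasDerivAt (fun s : ℝ => ∫ y, bump 0 1 1 y * f (x + s • y))
      (∫ y, bump 0 1 1 y * fderiv ℝ f (x + t • y) y) t := by
  have hfd : Continuous fun q : ℝ × 𝔼 => fderiv ℝ f (x + q.1 • q.2) q.2 :=
    ((hf.continuous_fderiv (by simp)).comp (by fun_prop)).clm_apply continuous_snd
  obtain ⟨C, hC⟩ := ((isCompact_closedBall t 1).prod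
    (isCompact_closedBall (0 : 𝔼) 1)).exists_bound_of_continuousOn hfd.continuousOn
  have hb := continuous_bump (0 : 𝔼) 1 1
  have hcs := hasCompactSupport_bump (0 : 𝔼) (R := 1) (k := 1) one_ne_zero zero_le_one
  have hfc := hf.continuous
  have hIb : ∀ {g : 𝔼 → ℝ}, Continuous g → Integrable (fun y => bump 0 1 1 y * g y) :=
    fun hg => (hb.mul hg).integrable_of_hasCompactSupport hcs.mul_right
  refine (hasDerivAt_integral_of_dominated_loc_of_deriv_le
    (F' := fun s y => bump 0 1 1 y * fderiv ℝ f (x + s • y) y)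
    (bound := fun y => bump 0 1 1 y * C) (ball_mem_nhds t one_pos) ?_ ?_ ?_ ?_ ?_ ?_).2
  · exact .of_forall fun s => (hIb (by fun_prop)).aestronglyMeasurable
  · exact hIb (by fun_prop)
  · exact (hIb (hfd.comp (by fun_prop : Continuous fun y : 𝔼 => (t, y)))).aestronglyMeasurable
  · refine .of_forall fun y s hs => ?_
    rw [norm_mul, Real.norm_of_nonneg (bump_nonneg ..)]
    by_cases hy : y ∈ closedBall (0 : 𝔼) 1
    · exact mul_le_mul_of_nonneg_left (hC (s, y) ⟨ball_subset_closedBall hs, hy⟩)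
        (bump_nonneg ..)
    · simp [bump_eq_zero one_ne_zero zero_le_one hy]
  · exact hIb continuous_const
  · refine .of_forall fun y s _ => ?_
    have h : HasDerivAt (fun s : ℝ => x + s • y) y s := by
      simpa using ((hasDerivAt_id s).smul_const y).const_add x
    exact ((hf.differentiable (by simp) _).hasFDerivAt.comp_hasDerivAt s h).const_mul _

theorem integral_bump_mul_fderiv {f : 𝔼 → ℝ} (hf : ContDiff ℝ 2 f) (x : 𝔼) (t : ℝ) :
    ∫ y, bump 0 1 1 y * fderiv ℝ f (x + t • y) y =
      t / 4 * ∫ y, bump 0 1 2 y * lap f (x + t • y) := by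
  have hb2 : ContDiff ℝ 1 (bump (0 : 𝔼) 1 2) :=
    (contDiff_max_zero_pow 1 0).comp (contDiff_const.sub (contDiff_normSq 0))
  have hpf := fun i => contDiff_pd (n := 2) (m := 1) hf (by norm_num) i
  have hcs := hasCompactSupport_bump (0 : 𝔼) (R := 1) (k := 1) one_ne_zero zero_le_one
  have hcs2 := hasCompactSupport_bump (0 : 𝔼) (R := 1) (k := 2) two_ne_zero zero_le_one
  simp only [fderiv_apply_eq_sum, lap_eq_sum_pd, Finset.mul_sum]
  rw [integral_finsetSum, integral_finsetSum, Finset.mul_sum]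
  · refine Finset.sum_congr rfl fun i _ => ?_
    have h := integral_mul_pd hb2 (g := fun y => pd i f (x + t • y))
      ((hpf i).comp (by fun_prop)) hcs2 i
    simp only [pd_comp_add_smul ((hpf i).differentiable (by simp)), pd_bump _ _ 0] at h
    have e1 : ∫ y, bump 0 1 2 y * (t * pd i (pd i f) (x + t • y)) =
        t * ∫ y, bump 0 1 2 y * pd i (pd i f) (x + t • y) := by
      rw [← integral_const_mul]; congr with y; ring
    have e2 : ∫ y : 𝔼, -(2 * ((0 : ℕ) + 2)) * (y i - (0 : 𝔼) i) * bump 0 1 (0 + 1) y *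
        pd i f (x + t • y) = -4 * ∫ y, bump 0 1 1 y * (y i * pd i f (x + t • y)) := by
      rw [← integral_const_mul]; congr with y; simp; ring
    rw [e1, e2] at h
    linarith
  · intro i _
    exact ((continuous_bump 0 1 2).mul ((continuous_pd (hpf i) i).comp (by fun_prop)))
      |>.integrable_of_hasCompactSupport hcs2.mul_right
  · intro i _
    refine Continuous.integrable_of_hasCompactSupport ?_ hcs.mul_right
    have := (hpf i).continuous
    exact (continuous_bump 0 1 1).mul (by fun_prop)

theorem integral_bump_mul_ge {f : 𝔼 → ℝ} (hf : ContDiff ℝ 2 f) (x : 𝔼) {ρ : ℝ} (hρ : 0 ≤ ρ)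
    (h : ∀ p ∈ closedBall x ρ, 0 ≤ lap f p) :
    f x * ∫ y, bump (0 : 𝔼) 1 1 y ≤ ∫ y, bump 0 1 1 y * f (x + ρ • y) := by
  have hmono : MonotoneOn (fun s : ℝ => ∫ y, bump 0 1 1 y * f (x + s • y)) (Set.Icc 0 ρ) := by
    refine monotoneOn_of_deriv_nonneg (convex_Icc 0 ρ)
      (fun t _ => (hasDerivAt_integral_bump_mul hf x t).continuousAt.continuousWithinAt)
      (fun t _ => (hasDerivAt_integral_bump_mul hf x t).differentiableAt.differentiableWithinAt) ?_
    intro t ht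
    rw [interior_Icc] at ht
    rw [(hasDerivAt_integral_bump_mul hf x t).deriv, integral_bump_mul_fderiv hf]
    refine mul_nonneg (by linarith [ht.1]) (integral_nonneg fun y => ?_)
    by_cases hy : y ∈ closedBall (0 : 𝔼) 1
    · refine mul_nonneg (bump_nonneg ..) (h _ ?_)
      have hy' : ‖y‖ ≤ 1 := by simpa using hy
      rw [mem_closedBall, dist_eq_norm, add_sub_cancel_left, norm_smul,
        Real.norm_of_nonneg ht.1.le]
      nlinarith [ht.1, ht.2, norm_nonneg y]
    · simp [bump_eq_zero two_ne_zero zero_le_one hy]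
  have := hmono ⟨le_rfl, hρ⟩ ⟨hρ, le_rfl⟩ hρ
  simp only [zero_smul, add_zero, integral_mul_const] at this
  linarith

/-- A local maximum principle for almost subharmonic functions. -/
theorem exists_mean_value_bound (hN : 0 < N) :
    ∃ A : ℝ, 0 < A ∧ ∀ f : 𝔼 → ℝ, ContDiff ℝ 2 f → ∀ (x : 𝔼) (ρ B : ℝ), 0 < ρ → 0 ≤ B →
      (∀ p ∈ closedBall x ρ, 0 ≤ f p) → (∀ p ∈ closedBall x ρ, -B ≤ lap f p) →
      f x ≤ A * ((ρ ^ N)⁻¹ * (∫ p in closedBall x ρ, f p) + B * ρ ^ 2) := by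
  have hcs := hasCompactSupport_bump (0 : 𝔼) (R := 1) (k := 1) one_ne_zero zero_le_one
  have hb := continuous_bump (0 : 𝔼) 1 1
  have hbi : Integrable (bump (0 : 𝔼) 1 1) := hb.integrable_of_hasCompactSupport hcs
  set I := ∫ y, bump (0 : 𝔼) 1 1 y with hI
  have hIpos : 0 < I :=
    hb.integral_pos_of_hasCompactSupport_nonneg_nonzero hcs (bump_nonneg _ _ _)
      (x := 0) (by simp [bump])
  have hN1 : (1 : ℝ) ≤ N := by exact_mod_cast hN
  refine ⟨I⁻¹ + 1, by positivity, fun f hf x ρ B hρ hB hf0 hlap => ?_⟩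
  have hfc := hf.continuous
  set J := ∫ p in closedBall x ρ, f p with hJ
  have hJ0 : 0 ≤ J := setIntegral_nonneg measurableSet_closedBall hf0
  have hq : ContDiff ℝ 2 (fun p => B / (2 * N) * ‖p - x‖ ^ 2) :=
    contDiff_const.mul (contDiff_normSq x)
  have key := integral_bump_mul_ge (f := fun p => f p + B / (2 * N) * ‖p - x‖ ^ 2)
    (hf.add hq) x hρ.le (fun p hp => by
      rw [lap_add hf.contDiffAt hq.contDiffAt,
        lap_const_mul (contDiff_normSq x).contDiffAt, lap_normSq]
      have : B / (2 * N) * (2 * N) = B := by field_simp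
      linarith [hlap p hp])
  simp only [sub_self, norm_zero] at key
  have hmem : ∀ y : 𝔼, y ∈ closedBall (0 : 𝔼) 1 → x + ρ • y ∈ closedBall x ρ := fun y hy => by
    have hy' : ‖y‖ ≤ 1 := by simpa using hy
    rw [mem_closedBall, dist_eq_norm, add_sub_cancel_left, norm_smul, Real.norm_of_nonneg hρ.le]
    nlinarith [norm_nonneg y]
  have hchange : ∫ y, (closedBall x ρ).indicator f (x + ρ • y) = (ρ ^ N)⁻¹ * J := by
    have h1 := Measure.integral_comp_smul (volume : Measure 𝔼)
      (fun w => (closedBall x ρ).indicator f (x + w)) ρ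
    rw [h1, integral_add_left_eq_self, integral_indicator measurableSet_closedBall]
    simp [abs_of_pos hρ, hJ]
  have hind : Integrable fun y : 𝔼 => (closedBall x ρ).indicator f (x + ρ • y) := by
    have h0 : Integrable ((closedBall x ρ).indicator f) :=
      (hfc.continuousOn.integrableOn_compact (isCompact_closedBall x ρ)).integrable_indicator
        measurableSet_closedBall
    exact (h0.comp_add_left x).comp_smul hρ.ne'
  have hle : ∫ y, bump 0 1 1 y * (f (x + ρ • y) + B / (2 * N) * ‖x + ρ • y - x‖ ^ 2) ≤
      ∫ y, ((closedBall x ρ).indicator f (x + ρ • y) + B * ρ ^ 2 * bump 0 1 1 y) := by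
    refine integral_mono ?_ (hind.add (hbi.const_mul _)) fun y => ?_
    · exact Continuous.integrable_of_hasCompactSupport (hb.mul (by fun_prop)) hcs.mul_right
    · by_cases hy : y ∈ closedBall (0 : 𝔼) 1
      · have hb1 : bump 0 1 1 y ≤ 1 := by simpa using bump_le (0 : 𝔼) 1 1 y
        have hb0 := bump_nonneg (0 : 𝔼) 1 1 y
        have hfy := hf0 _ (hmem y hy)
        have hy' : ‖y‖ ≤ 1 := by simpa using hy
        have hBN : B / (2 * N) ≤ B := div_le_self hB (by linarith)
        simp only [Set.indicator_of_mem (hmem y hy), add_sub_cancel_left, norm_smul,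
          Real.norm_of_nonneg hρ.le, mul_pow]
        have h2 : B / (2 * N) * (ρ ^ 2 * ‖y‖ ^ 2) ≤ B * (ρ ^ 2 * 1) := by
          gcongr
          exact pow_le_one₀ (norm_nonneg y) hy'
        nlinarith [mul_le_mul_of_nonneg_right hb1 hfy, mul_le_mul_of_nonneg_left h2 hb0]
      · rw [bump_eq_zero one_ne_zero zero_le_one hy]
        simp only [zero_mul, mul_zero, add_zero]
        exact Set.indicator_nonneg hf0 _
  rw [integral_add hind (hbi.const_mul _), integral_const_mul, hchange, ← hI] at hle
  have hmain : f x * I ≤ (ρ ^ N)⁻¹ * J + B * ρ ^ 2 * I := by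
    refine le_trans ?_ hle
    simpa using key
  have h3 : f x ≤ I⁻¹ * ((ρ ^ N)⁻¹ * J) + B * ρ ^ 2 := by
    have := mul_le_mul_of_nonneg_right hmain (inv_pos.2 hIpos).le
    rw [mul_assoc, mul_inv_cancel₀ hIpos.ne', mul_one] at this
    refine this.trans_eq ?_
    field_simp
  have h4 : 0 ≤ (ρ ^ N)⁻¹ * J := by positivity
  have h5 : 0 ≤ I⁻¹ * (B * ρ ^ 2) := by positivity
  nlinarith

end MeanValue

section IntegralBounds

theorem integral_bump_eq (p : 𝔼) (R : ℝ) (k : ℕ) :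
    ∫ x, bump p R k x = ∫ x, bump (0 : 𝔼) R k x := by
  rw [← integral_sub_right_eq_self (bump (0 : 𝔼) R k) p]
  simp [bump]

theorem setIntegral_bump_mul_le {G : Set 𝔼} (hG : IsOpen G) {v : 𝔼 → ℝ}
    (hv : ContDiffOn ℝ 2 v G) {p : 𝔼} {R δ α β C : ℝ} {k : ℕ} (hR : 0 < R) (hδR : δ ≤ R)
    (hsub : closedBall p R ⊆ G)
    (htest : ∀ x, bump p R (k + 1) x ≤ lap (bump p R (k + 3)) x - α * bump p R (k + 3) x
      + (closedBall p δ).indicator (fun _ => C) x)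
    (hv0 : ∀ x ∈ closedBall p R, 0 ≤ v x)
    (hlap : ∀ x ∈ closedBall p R, lap v x ≤ α * v x + β) :
    ∫ x in closedBall p R, bump p R (k + 1) x * v x ≤
      β * (∫ x, bump (0 : 𝔼) R (k + 3) x) + C * ∫ x in closedBall p δ, v x := by
  obtain ⟨V, hV, hVv⟩ := exists_contDiff_extension hG hv hR hsub
  have hVeq : ∀ x ∈ closedBall p R, V x = v x := fun x hx => (hVv x hx).eq_of_nhds
  have hbz : ∀ j, j ≠ 0 → ∀ x, x ∉ closedBall p R → bump p R j x = 0 := fun j hj x hx =>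
    bump_eq_zero hj hR.le hx
  have hsup : ∀ j, j ≠ 0 → HasCompactSupport (bump p R j) := fun j hj =>
    hasCompactSupport_bump p hj hR.le
  have e1 : ∫ x in closedBall p R, bump p R (k + 1) x * v x = ∫ x, bump p R (k + 1) x * V x := by
    refine (setIntegral_congr_fun measurableSet_closedBall fun x hx => ?_).trans
      (setIntegral_eq_integral_of_forall_compl_eq_zero (s := closedBall p R) fun x hx => ?_)
    · simp only [hVeq x hx]
    · rw [hbz _ (by simp) x hx, zero_mul]
  have e2 : ∫ x in closedBall p δ, v x = ∫ x, (closedBall p δ).indicator V x := by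
    rw [integral_indicator measurableSet_closedBall]
    exact setIntegral_congr_fun measurableSet_closedBall fun x hx =>
      (hVeq x (closedBall_subset_closedBall hδR hx)).symm
  have i1 : ∀ j, j ≠ 0 → Integrable fun x => bump p R j x * V x := fun j hj =>
    ((continuous_bump p R j).mul hV.continuous).integrable_of_hasCompactSupport
      (hsup j hj).mul_right
  have i2 : Integrable ((closedBall p δ).indicator V) :=
    (hV.continuous.continuousOn.integrableOn_compact
      (isCompact_closedBall p δ)).integrable_indicator measurableSet_closedBall
  have i3 : Integrable fun x => bump p R (k + 3) x * lap V x :=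
    ((continuous_bump p R _).mul (continuous_lap hV)).integrable_of_hasCompactSupport
      (hsup _ (by simp)).mul_right
  have hφ := contDiff_bump p R k
  have i4 : Integrable fun x => lap (bump p R (k + 3)) x * V x := by
    refine ((continuous_lap hφ).mul hV.continuous).integrable_of_hasCompactSupport
      (HasCompactSupport.intro (isCompact_closedBall p R) fun x hx => ?_)
    rw [Pi.mul_apply, lap_bump, hbz _ (by simp) x hx, hbz _ (by simp) x hx]
    simp
  have i5 : Integrable (bump p R (k + 3)) :=
    (continuous_bump p R _).integrable_of_hasCompactSupport (hsup _ (by simp))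
  have i6 : Integrable fun x => lap (bump p R (k + 3)) x * V x - α * (bump p R (k + 3) x * V x) :=
    i4.sub ((i1 (k + 3) (by simp)).const_mul α)
  have hmono1 : ∫ x, bump p R (k + 1) x * V x ≤
      ∫ x, (lap (bump p R (k + 3)) x * V x - α * (bump p R (k + 3) x * V x)
        + C * (closedBall p δ).indicator V x) := by
    refine integral_mono (i1 _ (by simp))
      (i6.add (i2.const_mul C)) fun x => ?_
    by_cases hx : x ∈ closedBall p R
    · have hVx : 0 ≤ V x := by rw [hVeq x hx]; exact hv0 x hx
      have h := mul_le_mul_of_nonneg_right (htest x) hVx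
      refine h.trans_eq ?_
      by_cases hxδ : x ∈ closedBall p δ
      · simp only [Set.indicator_of_mem hxδ]; ring
      · simp only [Set.indicator_of_notMem hxδ]; ring
    · have hxδ : x ∉ closedBall p δ := fun h => hx (closedBall_subset_closedBall hδR h)
      simp [Set.indicator_of_notMem hxδ, lap_bump, hbz _ _ x hx]
  have hmono2 : ∫ x, bump p R (k + 3) x * lap V x ≤
      ∫ x, (α * (bump p R (k + 3) x * V x) + β * bump p R (k + 3) x) := by
    refine integral_mono i3 (((i1 _ (by simp)).const_mul α).add (i5.const_mul β)) fun x => ?_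
    by_cases hx : x ∈ closedBall p R
    · have h := mul_le_mul_of_nonneg_left (hlap x hx) (bump_nonneg p R (k + 3) x)
      simp only
      rw [lap_congr (hVv x hx), hVeq x hx]
      linarith
    · simp [hbz _ _ x hx]
  rw [integral_add i6 (i2.const_mul C),
    integral_sub i4 ((i1 _ (by simp)).const_mul α), ← integral_mul_lap hφ hV (hsup _ (by simp)),
    integral_const_mul, integral_const_mul] at hmono1
  rw [integral_add ((i1 _ (by simp)).const_mul α) (i5.const_mul β), integral_const_mul,
    integral_const_mul, integral_bump_eq] at hmono2
  rw [e1, e2]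
  linarith

theorem setIntegral_le_of_bump_ge {v : 𝔼 → ℝ} {p x : 𝔼} {R ρ c : ℝ} {k : ℕ}
    (hv : ContinuousOn v (closedBall p R)) (hv0 : ∀ x ∈ closedBall p R, 0 ≤ v x) (hc : 0 < c)
    (hsub : closedBall x ρ ⊆ closedBall p R) (hb : ∀ z ∈ closedBall x ρ, c ≤ bump p R k z) :
    ∫ z in closedBall x ρ, v z ≤ c⁻¹ * ∫ z in closedBall p R, bump p R k z * v z := by
  have hi : IntegrableOn (fun z => bump p R k z * v z) (closedBall p R) :=
    ((continuous_bump p R k).continuousOn.mul hv).integrableOn_compact (isCompact_closedBall p R)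
  have hiv : IntegrableOn v (closedBall x ρ) :=
    (hv.mono hsub).integrableOn_compact (isCompact_closedBall x ρ)
  have h1 : ∫ z in closedBall x ρ, c * v z ≤ ∫ z in closedBall x ρ, bump p R k z * v z :=
    setIntegral_mono_on (hiv.const_mul c) (hi.mono_set hsub) measurableSet_closedBall
      fun z hz => mul_le_mul_of_nonneg_right (hb z hz) (hv0 z (hsub hz))
  have h2 : ∫ z in closedBall x ρ, bump p R k z * v z ≤
      ∫ z in closedBall p R, bump p R k z * v z := by
    refine setIntegral_mono_set hi ?_ hsub.eventuallyLE
    filter_upwards [ae_restrict_mem measurableSet_closedBall] with z hz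
    exact mul_nonneg (bump_nonneg ..) (hv0 z hz)
  rw [integral_const_mul] at h1
  rw [inv_mul_eq_div, le_div_iff₀ hc]
  linarith

/-- Near `p`, the family `𝓥` is bounded in `L¹`. -/
def LocallyBounded (𝓥 : Set (𝔼 → ℝ)) (G : Set 𝔼) (p : 𝔼) : Prop :=
  ∃ δ > 0, closedBall p δ ⊆ G ∧ ∃ C : ℝ, 0 ≤ C ∧ ∀ v ∈ 𝓥, ∫ x in closedBall p δ, v x ≤ C

/-- Uniform weighted `L¹` bound on a ball from an `L¹` bound on a small concentric ball. -/
theorem exists_weighted_bound {R δ K : ℝ} (hδ : 0 < δ) (hδR : δ ≤ R) (hK : 0 ≤ K) :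
    ∃ (k : ℕ) (C : ℝ), 0 ≤ C ∧ ∀ (G : Set 𝔼) (v : 𝔼 → ℝ) (p : 𝔼), IsOpen G →
      ContDiffOn ℝ 2 v G → closedBall p R ⊆ G → (∀ x ∈ G, 0 ≤ v x) →
      (∀ x ∈ G, lap v x ≤ K * v x + K) →
      ∫ x in closedBall p R, bump p R (k + 1) x * v x ≤
        C * (1 + ∫ x in closedBall p δ, v x) := by
  obtain ⟨k, C, hC, h⟩ := exists_bump_subsolution (N := N) R hδ hK
  have hI : 0 ≤ ∫ x, bump (0 : 𝔼) R (k + 3) x := integral_nonneg (bump_nonneg _ _ _)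
  refine ⟨k, K * (∫ x, bump (0 : 𝔼) R (k + 3) x) + C, by positivity,
    fun G v p hG hv hsub hv0 hlap => ?_⟩
  have := setIntegral_bump_mul_le hG hv (hδ.trans_le hδR) hδR hsub (h p)
    (fun x hx => hv0 x (hsub hx)) fun x hx => hlap x (hsub hx)
  have hJ : 0 ≤ ∫ x in closedBall p δ, v x := setIntegral_nonneg measurableSet_closedBall
    fun x hx => hv0 x (hsub (closedBall_subset_closedBall hδR hx))
  nlinarith [mul_nonneg (mul_nonneg hK hI) hJ]

theorem LocallyBounded.of_mem_ball {𝓥 : Set (𝔼 → ℝ)} {G : Set 𝔼} {K : ℝ} (hG : IsOpen G)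
    (hK : 0 ≤ K) (hreg : ∀ v ∈ 𝓥, ContDiffOn ℝ 2 v G) (hv0 : ∀ v ∈ 𝓥, ∀ x ∈ G, 0 ≤ v x)
    (hlap : ∀ v ∈ 𝓥, ∀ x ∈ G, lap v x ≤ K * v x + K) {p x : 𝔼} {R : ℝ}
    (hp : LocallyBounded 𝓥 G p) (hR : closedBall p R ⊆ G) (hx : x ∈ ball p R) :
    LocallyBounded 𝓥 G x := by
  obtain ⟨δ, hδ, hδG, C, hC0, hC⟩ := hp
  have hxR : dist x p < R := hx
  have hRpos : 0 < R := dist_nonneg.trans_lt hxR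
  obtain ⟨k, C', hC', hw⟩ :=
    exists_weighted_bound (N := N) (R := R) (lt_min hδ hRpos) (min_le_right δ R) hK
  set ρ := (R - dist x p) / 2 with hρ
  have hρ0 : 0 < ρ := by rw [hρ]; linarith
  have hsub : closedBall x ρ ⊆ closedBall p R :=
    closedBall_subset_closedBall' (by rw [hρ]; linarith)
  set c := (R ^ 2 - (R - ρ) ^ 2) ^ (k + 1) with hc
  have hc1 : 0 < R ^ 2 - (R - ρ) ^ 2 := by nlinarith [dist_nonneg (x := x) (y := p)]
  have hcpos : 0 < c := by positivity
  refine ⟨ρ, hρ0, hsub.trans hR, c⁻¹ * (C' * (1 + C)), by positivity, fun v hv => ?_⟩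
  have h1 := setIntegral_le_of_bump_ge (k := k + 1) ((hreg v hv).continuousOn.mono hR)
    (fun z hz => hv0 v hv z (hR hz)) hcpos hsub fun z hz => by
      have hzp : ‖z - p‖ ≤ R - ρ := by
        rw [← dist_eq_norm]
        have := dist_triangle z x p
        have hz' : dist z x ≤ ρ := hz
        rw [hρ] at hz' ⊢; linarith
      refine pow_le_pow_left₀ hc1.le (le_max_of_le_left ?_) _
      gcongr
  refine h1.trans (mul_le_mul_of_nonneg_left ?_ (by positivity))
  refine (hw G v p hG (hreg v hv) hR (hv0 v hv) (hlap v hv)).trans ?_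
  have h2 : ∫ x in closedBall p (min δ R), v x ≤ ∫ x in closedBall p δ, v x := by
    refine setIntegral_mono_set (((hreg v hv).continuousOn.mono hδG).integrableOn_compact
      (isCompact_closedBall p δ)) ?_
      (closedBall_subset_closedBall (min_le_left δ R)).eventuallyLE
    filter_upwards [ae_restrict_mem measurableSet_closedBall] with z hz
    exact hv0 v hv z (hδG hz)
  have h3 := hC v hv
  gcongr
  exact h2.trans h3

theorem LocallyBounded.of_superlinear {𝓥 : Set (𝔼 → ℝ)} {G : Set 𝔼} (hG : IsOpen G)
    (hreg : ∀ v ∈ 𝓥, ContDiffOn ℝ 2 v G) (hv0 : ∀ v ∈ 𝓥, ∀ x ∈ G, 0 ≤ v x) {b : 𝔼} {β : ℝ}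
    (hβ : 0 < β) (hb : closedBall b β ⊆ G)
    (hsuper : ∀ T : ℝ, 0 ≤ T → ∃ C, 0 ≤ C ∧ ∀ v ∈ 𝓥, ∀ x ∈ closedBall b β,
      lap v x ≤ -T * v x + C) :
    LocallyBounded 𝓥 G b := by
  obtain ⟨k, C, hC, htest⟩ :=
    exists_bump_subsolution (N := N) β (half_pos hβ) le_rfl
  have hpos : 0 < β ^ 2 - (β / 2) ^ 2 := by nlinarith
  have hbump : ∀ j : ℕ, ∀ z ∈ closedBall b (β / 2),
      (β ^ 2 - (β / 2) ^ 2) ^ j ≤ bump b β j z := fun j z hz => by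
    have hz' : ‖z - b‖ ≤ β / 2 := by rw [← dist_eq_norm]; exact hz
    refine pow_le_pow_left₀ hpos.le (le_max_of_le_left ?_) _
    gcongr
  set T := C / (β ^ 2 - (β / 2) ^ 2) ^ (k + 3) with hT
  have hT0 : 0 ≤ T := by positivity
  obtain ⟨C', hC', hsup⟩ := hsuper T hT0
  have hI : 0 ≤ ∫ x, bump (0 : 𝔼) β (k + 3) x := integral_nonneg (bump_nonneg _ _ _)
  have hsub : closedBall b (β / 2) ⊆ closedBall b β :=
    closedBall_subset_closedBall (by linarith)
  refine ⟨β / 2, half_pos hβ, hsub.trans hb,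
    ((β ^ 2 - (β / 2) ^ 2) ^ (k + 1))⁻¹ * (C' * ∫ x, bump (0 : 𝔼) β (k + 3) x),
    by positivity, fun v hv => ?_⟩
  refine (setIntegral_le_of_bump_ge (k := k + 1) ((hreg v hv).continuousOn.mono hb)
    (fun z hz => hv0 v hv z (hb hz)) (by positivity) hsub (hbump _)).trans
    (mul_le_mul_of_nonneg_left ?_ (by positivity))
  have := setIntegral_bump_mul_le (k := k) (δ := β / 2) (C := 0) (α := -T) hG (hreg v hv) hβ
    (by linarith) hb (fun x => ?_) (fun x hx => hv0 v hv x (hb hx)) (hsup v hv)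
  · simpa using this
  · have h1 := htest b x
    by_cases hx : x ∈ closedBall b (β / 2)
    · simp only [Set.indicator_of_mem hx] at h1 ⊢
      have h2 : C ≤ T * bump b β (k + 3) x := by
        have := mul_le_mul_of_nonneg_left (hbump (k + 3) x hx) hT0
        rwa [hT, div_mul_cancel₀ _ (by positivity)] at this
      linarith
    · simp only [Set.indicator_of_notMem hx] at h1 ⊢
      have := mul_nonneg hT0 (bump_nonneg b β (k + 3) x)
      linarith

theorem locallyBounded_of_isPreconnected {𝓥 : Set (𝔼 → ℝ)} {G : Set 𝔼} {K : ℝ} (hG : IsOpen G)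
    (hconn : IsPreconnected G)
    (hK : 0 ≤ K) (hreg : ∀ v ∈ 𝓥, ContDiffOn ℝ 2 v G) (hv0 : ∀ v ∈ 𝓥, ∀ x ∈ G, 0 ≤ v x)
    (hlap : ∀ v ∈ 𝓥, ∀ x ∈ G, lap v x ≤ K * v x + K) {b : 𝔼}
    (hb : LocallyBounded 𝓥 G b) : ∀ p ∈ G, LocallyBounded 𝓥 G p := by
  have hstep : ∀ {p x : 𝔼} {R : ℝ}, LocallyBounded 𝓥 G p → closedBall p R ⊆ G →
      x ∈ ball p R → LocallyBounded 𝓥 G x := fun hp hR hx =>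
    hp.of_mem_ball hG hK hreg hv0 hlap hR hx
  refine hconn.subset_of_closure_inter_subset (u := {p | LocallyBounded 𝓥 G p}) ?_ ?_ ?_
  · rw [isOpen_iff]
    rintro p hp
    obtain ⟨δ, hδ, hδG, -⟩ := id hp
    exact ⟨δ, hδ, fun x hx => hstep hp hδG hx⟩
  · obtain ⟨δ, hδ, hδG, -⟩ := id hb
    exact ⟨b, hδG (mem_closedBall_self hδ.le), hb⟩
  · rintro p ⟨hpc, hpG⟩
    obtain ⟨ρ, hρ, hρG⟩ := nhds_basis_closedBall.mem_iff.1 (hG.mem_nhds hpG)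
    obtain ⟨q, hq, hqp⟩ := mem_closure_iff.1 hpc (ρ / 2) (by positivity)
    refine hstep hq (R := ρ / 2) ((closedBall_subset_closedBall' ?_).trans hρG) hqp
    rw [dist_comm]; linarith

end IntegralBounds

section NearBoundary

/-- `L¹` bounds that blow up polynomially at the boundary sphere, from local bounds inside. -/
theorem exists_integral_bound_near_sphere {𝓥 : Set (𝔼 → ℝ)} {x₀ y : 𝔼} {r R₀ K : ℝ} (hr : 0 < r)
    (hR₀ : 0 < R₀) (hK : 0 ≤ K) (hy : y ∈ closedBall x₀ r)
    (hreg : ∀ v ∈ 𝓥, ContDiffOn ℝ 2 v (ball y R₀ ∩ ball x₀ r))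
    (hv0 : ∀ v ∈ 𝓥, ∀ x ∈ ball y R₀ ∩ ball x₀ r, 0 ≤ v x)
    (hlap : ∀ v ∈ 𝓥, ∀ x ∈ ball y R₀ ∩ ball x₀ r, lap v x ≤ K * v x + K)
    (hloc : ∀ p ∈ ball y R₀ ∩ ball x₀ r, LocallyBounded 𝓥 (ball y R₀ ∩ ball x₀ r) p) :
    ∃ (τ c C : ℝ) (m : ℕ), 0 < τ ∧ τ ≤ 1 ∧ τ < R₀ ∧ 0 < c ∧ c ≤ 1 / 4 ∧ 0 ≤ C ∧
      ∀ v ∈ 𝓥, ∀ x ∈ ball y τ ∩ ball x₀ r, ∀ ρ, ρ ≤ c * (r ^ 2 - ‖x - x₀‖ ^ 2) →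
        closedBall x ρ ⊆ ball y R₀ ∩ ball x₀ r ∧
        ∫ z in closedBall x ρ, v z ≤ C * ((r ^ 2 - ‖x - x₀‖ ^ 2) ^ m)⁻¹ := by
  set G := ball y R₀ ∩ ball x₀ r with hGdef
  have hG : IsOpen G := isOpen_ball.inter isOpen_ball
  obtain ⟨s, hs0, hs2, hsR⟩ : ∃ s : ℝ, 0 < s ∧ s ≤ 1 / 2 ∧ s * r ≤ R₀ / 8 := by
    refine ⟨min (1 / 2) (R₀ / (8 * r)), by positivity, min_le_left _ _, ?_⟩
    refine (mul_le_mul_of_nonneg_right (min_le_right _ _) hr.le).trans_eq ?_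
    field_simp
  have hsr : 0 < s * r := mul_pos hs0 hr
  have hy' : ‖y - x₀‖ ≤ r := by rw [← dist_eq_norm]; exact hy
  have hmem : x₀ + (1 - s) • (y - x₀) ∈ G := by
    refine ⟨?_, ?_⟩
    · have : x₀ + (1 - s) • (y - x₀) - y = -(s • (y - x₀)) := by module
      rw [mem_ball, dist_eq_norm, this, norm_neg, norm_smul, Real.norm_of_nonneg hs0.le]
      nlinarith
    · rw [mem_ball, dist_eq_norm, add_sub_cancel_left, norm_smul,
        Real.norm_of_nonneg (by linarith)]
      nlinarith
  obtain ⟨δ, hδ, hδG, C₀, hC₀, hbd⟩ := hloc _ hmem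
  obtain ⟨k, C₁, hC₁, hw⟩ := exists_weighted_bound (N := N)
    (lt_min (half_pos hδ) hsr) (min_le_right (δ / 2) (s * r)) hK
  refine ⟨min 1 (min (R₀ / 4) (δ / 2)),
    min (s ^ 2 / (2 * (2 * (s * r) + 1))) (min (1 / r ^ 2) (1 / 4)),
    ((s ^ 2 / 2) ^ (k + 1))⁻¹ * (C₁ * (1 + C₀)), k + 1, by positivity, min_le_left _ _,
    ((min_le_right _ _).trans (min_le_left _ _)).trans_lt (by linarith), by positivity,
    (min_le_right _ _).trans (min_le_right _ _), by positivity, ?_⟩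
  rintro v hv x ⟨hxy, hxr⟩ ρ hρ
  have hxR : dist x y < R₀ / 4 :=
    (mem_ball.1 hxy).trans_le ((min_le_right _ _).trans (min_le_left _ _))
  have hxδ : dist x y < δ / 2 :=
    (mem_ball.1 hxy).trans_le ((min_le_right _ _).trans (min_le_right _ _))
  have hd : ‖x - x₀‖ < r := by rw [← dist_eq_norm]; exact hxr
  have hd0 := norm_nonneg (x - x₀)
  set d := ‖x - x₀‖ with hddef
  set q := r ^ 2 - d ^ 2 with hq
  have hq0 : 0 < q := by rw [hq]; nlinarith
  have hqr : q ≤ r ^ 2 := by rw [hq]; nlinarith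
  have hρ1 : ρ * (2 * (s * r) + 1) ≤ s ^ 2 * q / 2 := by
    have : ρ ≤ s ^ 2 / (2 * (2 * (s * r) + 1)) * q :=
      hρ.trans (mul_le_mul_of_nonneg_right (min_le_left _ _) hq0.le)
    have h2 := mul_le_mul_of_nonneg_right this (by positivity : 0 ≤ 2 * (s * r) + 1)
    refine h2.trans_eq ?_
    field_simp
  have hρ2 : ρ ≤ 1 := by
    have : ρ ≤ 1 / r ^ 2 * q :=
      hρ.trans (mul_le_mul_of_nonneg_right ((min_le_right _ _).trans (min_le_left _ _)) hq0.le)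
    refine this.trans ?_
    rw [one_div_mul_eq_div, div_le_one (by positivity)]
    exact hqr
  set x' := x₀ + (1 - s) • (x - x₀) with hx'
  have hxx' : dist x x' = s * d := by
    have : x - x' = s • (x - x₀) := by rw [hx']; module
    rw [dist_eq_norm, this, norm_smul, Real.norm_of_nonneg hs0.le]
  have hx'x₀ : dist x' x₀ = (1 - s) * d := by
    rw [dist_eq_norm, hx', add_sub_cancel_left, norm_smul, Real.norm_of_nonneg (by linarith)]
  have hx'y' : dist x' (x₀ + (1 - s) • (y - x₀)) ≤ δ / 2 := by
    have : x' - (x₀ + (1 - s) • (y - x₀)) = (1 - s) • (x - y) := by rw [hx']; module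
    rw [dist_eq_norm, this, norm_smul, Real.norm_of_nonneg (by linarith), ← dist_eq_norm]
    nlinarith [dist_nonneg (x := x) (y := y)]
  have hsubG : closedBall x' (s * r) ⊆ G := fun z hz => by
    have hz' : dist z x' ≤ s * r := hz
    refine ⟨?_, ?_⟩
    · have h1 := dist_triangle4 z x' x y
      rw [dist_comm x' x, hxx'] at h1
      rw [mem_ball]
      nlinarith
    · have h1 := dist_triangle z x' x₀
      rw [hx'x₀] at h1
      rw [mem_ball]
      nlinarith
  have hgap : ∀ z ∈ closedBall x ρ, s ^ 2 * q / 2 ≤ (s * r) ^ 2 - ‖z - x'‖ ^ 2 := fun z hz => by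
    have hz' : dist z x ≤ ρ := hz
    have h1 := dist_triangle z x x'
    rw [hxx', dist_eq_norm z x'] at h1
    have h2 : ‖z - x'‖ ≤ ρ + s * d := by linarith
    have h3 : ‖z - x'‖ ^ 2 ≤ (ρ + s * d) ^ 2 := by gcongr
    have hρ0 : 0 ≤ ρ := dist_nonneg.trans hz'
    have h4 : ρ * (ρ + 2 * (s * d)) ≤ ρ * (2 * (s * r) + 1) :=
      mul_le_mul_of_nonneg_left (by nlinarith) hρ0
    rw [hq] at hρ1 ⊢
    nlinarith
  have hsub : closedBall x ρ ⊆ closedBall x' (s * r) := fun z hz => by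
    have := hgap z hz
    rw [mem_closedBall, dist_eq_norm]
    refine abs_le_of_sq_le_sq' ?_ hsr.le |>.2
    have : 0 < s ^ 2 * q / 2 := by positivity
    linarith
  refine ⟨hsub.trans hsubG, ?_⟩
  have hreg' := (hreg v hv).continuousOn
  have h1 := setIntegral_le_of_bump_ge (k := k + 1) (hreg'.mono hsubG)
    (fun z hz => hv0 v hv z (hsubG hz)) (c := (s ^ 2 * q / 2) ^ (k + 1)) (by positivity) hsub
    fun z hz => pow_le_pow_left₀ (by positivity) (le_max_of_le_left (hgap z hz)) _
  have h2 : ∫ z in closedBall x' (min (δ / 2) (s * r)), v z ≤ C₀ := by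
    refine (setIntegral_mono_set ((hreg'.mono hδG).integrableOn_compact
      (isCompact_closedBall _ δ)) ?_ (closedBall_subset_closedBall' ?_).eventuallyLE).trans
      (hbd v hv)
    · filter_upwards [ae_restrict_mem measurableSet_closedBall] with z hz
      exact hv0 v hv z (hδG hz)
    · linarith [min_le_left (δ / 2) (s * r)]
  have h3 := hw G v x' hG (hreg v hv) hsubG (hv0 v hv) (hlap v hv)
  calc _ ≤ ((s ^ 2 * q / 2) ^ (k + 1))⁻¹ * (C₁ * (1 + C₀)) := by
        refine h1.trans (mul_le_mul_of_nonneg_left (h3.trans ?_) (by positivity))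
        gcongr
    _ = _ := by
        rw [show s ^ 2 * q / 2 = s ^ 2 / 2 * q by ring, mul_pow, mul_inv]
        ring

end NearBoundary

section BlowUp

theorem one_add_add_le_div {S θ : ℝ} {κ : ℕ} (hS : 0 ≤ S) (hκ : 0 < κ)
    (hθ : θ = Real.exp (-(S / κ))) : 1 + S + κ ≤ (1 + 2 * κ) / θ := by
  have hκ' : (0 : ℝ) < κ := by exact_mod_cast hκ
  have h1 : 1 / θ = Real.exp (S / κ) := by rw [hθ, Real.exp_neg, one_div, inv_inv]
  have h2 : S / κ + 1 ≤ 1 / θ := h1 ▸ Real.add_one_le_exp (S / κ)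
  have h3 : S / κ * κ = S := by field_simp
  have h4 : 0 ≤ S / κ := by positivity
  rw [div_eq_mul_one_div]
  nlinarith

/-- Mean value estimate for `exp (b u)` at scale `θ ^ 4`, where `θ ^ κ = exp (-S)` and `S + κ`
bounds `u` from above. -/
theorem exists_exp_le_of_integral_exp_le (hN : 0 < N) {a b K c C : ℝ} {m κ : ℕ}
    (hab : a ≤ b) (hb : 0 ≤ b) (hK : 0 ≤ K) (hc0 : 0 < c) (hc1 : c ≤ 1) (hC : 0 ≤ C) (hκ : 0 < κ)
    (ha : 0 ≤ a) (haκ : 4 * (m + N) + 1 ≤ a * κ) :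
    ∃ C₁ : ℝ, 0 ≤ C₁ ∧ ∀ (Ω : Set 𝔼) (u : 𝔼 → ℝ) (x : 𝔼) (S θ : ℝ), IsOpen Ω →
      ContDiffOn ℝ 2 u Ω → 0 ≤ S → θ = Real.exp (-(S / κ)) → closedBall x (c * θ ^ 4) ⊆ Ω →
      (∀ p ∈ closedBall x (c * θ ^ 4), u p ≤ S + κ ∧
        -(K * Real.exp (b * u p) * (1 + max (u p) 0)) ≤ lap (fun p => Real.exp (b * u p)) p) →
      ∫ p in closedBall x (c * θ ^ 4), Real.exp (a * u p) ≤ C * ((θ ^ 4) ^ m)⁻¹ →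
      Real.exp (b * u x) ≤ C₁ * θ * Real.exp (b * S) := by
  obtain ⟨A, hA, hmv⟩ := exists_mean_value_bound hN
  refine ⟨A * Real.exp (b * κ) * (C * (c ^ N)⁻¹ + K * (1 + 2 * κ)), by positivity,
    fun Ω u x S θ hΩ hu hS hθ hsub hp hIb => ?_⟩
  have hκ' : (0 : ℝ) < κ := by exact_mod_cast hκ
  have hθ0 : 0 < θ := hθ ▸ Real.exp_pos _
  have hθ1 : θ ≤ 1 := by
    rw [hθ]; exact Real.exp_le_one_iff.2 (neg_nonpos.2 (by positivity))
  set ρ := c * θ ^ 4 with hρ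
  have hρ0 : 0 < ρ := by positivity
  obtain ⟨f, hf, hfu⟩ := exists_contDiff_extension hΩ
    (Real.contDiff_exp.comp_contDiffOn (contDiffOn_const.mul hu) :
      ContDiffOn ℝ 2 (fun p => Real.exp (b * u p)) Ω) hρ0 hsub
  have hfeq : ∀ p ∈ closedBall x ρ, f p = Real.exp (b * u p) := fun p hp => (hfu p hp).eq_of_nhds
  set W := Real.exp (b * (S + κ)) with hW
  have hWeq : W = Real.exp (b * S) * Real.exp (b * κ) := by rw [hW, mul_add, Real.exp_add]
  have hmv' := hmv f hf x ρ (K * W * (1 + S + κ)) hρ0 (by positivity)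
    (fun p hp => (hfeq p hp).symm ▸ (Real.exp_pos _).le) fun p hpx => by
      obtain ⟨h1, h2⟩ := hp p hpx
      rw [lap_congr (hfu p hpx)]
      refine le_trans (neg_le_neg ?_) h2
      have : max (u p) 0 ≤ S + κ := max_le h1 (by positivity)
      have h3 : Real.exp (b * u p) ≤ W := Real.exp_le_exp.2 (by gcongr)
      have h4 : 1 + max (u p) 0 ≤ 1 + S + κ := by linarith
      gcongr
  rw [hfeq x (mem_closedBall_self hρ0.le)] at hmv'
  have hcont : ContinuousOn u (closedBall x ρ) := hu.continuousOn.mono hsub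
  have hI : ∫ p in closedBall x ρ, f p ≤
      Real.exp ((b - a) * (S + κ)) * (C * ((θ ^ 4) ^ m)⁻¹) := by
    refine le_trans ?_ (mul_le_mul_of_nonneg_left hIb (Real.exp_pos _).le)
    rw [← integral_const_mul]
    refine setIntegral_mono_on (hf.continuous.continuousOn.integrableOn_compact
      (isCompact_closedBall _ _)) (ContinuousOn.integrableOn_compact (isCompact_closedBall _ _)
      (by fun_prop)) measurableSet_closedBall fun p hpx => ?_
    rw [hfeq p hpx, ← Real.exp_add]
    refine Real.exp_le_exp.2 ?_
    nlinarith [mul_le_mul_of_nonneg_left (hp p hpx).1 (sub_nonneg.2 hab)]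
  have hexp : Real.exp ((b - a) * (S + κ)) ≤
      Real.exp (b * S) * Real.exp (b * κ) * (θ ^ (4 * (m + N)) * θ) := by
    have h1 : θ ^ (4 * (m + N)) * θ = Real.exp (-(S / κ) * (4 * (m + N) + 1)) := by
      rw [← pow_succ, hθ, ← Real.exp_nat_mul]
      congr 1; push_cast; ring
    rw [h1, ← Real.exp_add, ← Real.exp_add]
    refine Real.exp_le_exp.2 ?_
    have h2 : S / κ * (4 * (m + N) + 1) ≤ S / κ * (a * κ) :=
      mul_le_mul_of_nonneg_left haκ (by positivity)
    have h3 : S / κ * (a * κ) = a * S := by field_simp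
    have h4 : 0 ≤ a * κ := by positivity
    linarith
  have hfirst : (ρ ^ N)⁻¹ * ∫ p in closedBall x ρ, f p ≤
      Real.exp (b * S) * Real.exp (b * κ) * (C * (c ^ N)⁻¹) * θ := by
    calc _ ≤ (ρ ^ N)⁻¹ * (Real.exp (b * S) * Real.exp (b * κ) * (θ ^ (4 * (m + N)) * θ)
          * (C * ((θ ^ 4) ^ m)⁻¹)) := by
          refine mul_le_mul_of_nonneg_left (hI.trans ?_) (by positivity)
          gcongr
      _ = _ := by
          rw [hρ, mul_pow, mul_add, pow_add, pow_mul, pow_mul]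
          field_simp
  have hsecond : K * W * (1 + S + κ) * ρ ^ 2 ≤
      Real.exp (b * S) * Real.exp (b * κ) * (K * (1 + 2 * κ)) * θ := by
    have h1 := one_add_add_le_div hS hκ hθ
    have h2 : ρ ^ 2 ≤ θ ^ 2 := by
      have : ρ ≤ 1 * θ ^ 1 :=
        mul_le_mul hc1 (pow_le_pow_of_le_one hθ0.le hθ1 (by norm_num)) (by positivity) zero_le_one
      rw [one_mul, pow_one] at this
      gcongr
    calc _ ≤ K * W * ((1 + 2 * κ) / θ) * θ ^ 2 := by gcongr
      _ = _ := by rw [hWeq]; field_simp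
  calc _ ≤ A * (Real.exp (b * S) * Real.exp (b * κ) * (C * (c ^ N)⁻¹) * θ
        + Real.exp (b * S) * Real.exp (b * κ) * (K * (1 + 2 * κ)) * θ) :=
        hmv'.trans (by gcongr)
    _ = _ := by ring

end BlowUp

section Doubling

theorem contDiff_barrier (x₀ p₀ : 𝔼) (e B s : ℝ) :
    ContDiff ℝ 2 fun z : 𝔼 => e + B * (‖z - p₀‖ ^ 2 + 2 * (s - ‖z - x₀‖ ^ 2)) :=
  contDiff_const.add (contDiff_const.mul ((contDiff_normSq p₀).add
    (contDiff_const.mul (contDiff_const.sub (contDiff_normSq x₀)))))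

theorem lap_barrier (x₀ p₀ : 𝔼) (e B s : ℝ) (p : 𝔼) :
    lap (fun z : 𝔼 => e + B * (‖z - p₀‖ ^ 2 + 2 * (s - ‖z - x₀‖ ^ 2))) p = -(2 * N * B) := by
  have h0 : ContDiffAt ℝ 2 (fun z : 𝔼 => s - ‖z - x₀‖ ^ 2) p :=
    contDiffAt_const.sub (contDiff_normSq x₀).contDiffAt
  have h1 : ContDiffAt ℝ 2 (fun z : 𝔼 => 2 * (s - ‖z - x₀‖ ^ 2)) p := contDiffAt_const.mul h0
  have h2 : ContDiffAt ℝ 2 (fun z : 𝔼 => ‖z - p₀‖ ^ 2 + 2 * (s - ‖z - x₀‖ ^ 2)) p :=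
    (contDiff_normSq p₀).contDiffAt.add h1
  rw [lap_add contDiffAt_const (contDiffAt_const.mul h2), lap_const, lap_const_mul h2,
    lap_add (contDiff_normSq p₀).contDiffAt h1, lap_const_mul h0,
    lap_const_sub (contDiff_normSq x₀).contDiffAt, lap_normSq, lap_normSq]
  ring

/-- An upper bound for `u p₀` at points where `u` exceeds `u p₀` by at most `κ` at scale
`exp (-u p₀ / κ)`. -/
theorem exists_bound_of_doubling (hN : 0 < N) (x₀ : 𝔼) {r a b K c C : ℝ} {m κ : ℕ}
    (hr : 0 < r) (hab : a ≤ b) (hb : 0 < b) (hK : 0 ≤ K) (hc0 : 0 < c) (hc1 : c ≤ 1 / 4)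
    (hC : 0 ≤ C) (hκ : 0 < κ) (ha : 0 ≤ a) (haκ : 4 * (m + N) + 1 ≤ a * κ) :
    ∃ S₀ : ℝ, 0 ≤ S₀ ∧ ∀ (u : 𝔼 → ℝ) (p₀ : 𝔼) (θ : ℝ), θ = Real.exp (-(u p₀ / κ)) →
      p₀ ∈ closedBall x₀ r →
      ContDiffOn ℝ 2 u (ball x₀ r) → ContinuousOn u (closedBall x₀ r) →
      (∀ x ∈ sphere x₀ r, u x = 0) →
      (∀ p ∈ ball x₀ r, p ∈ closedBall p₀ (θ / 2) →
        -(K * Real.exp (b * u p) * (1 + max (u p) 0)) ≤ lap (fun p => Real.exp (b * u p)) p) →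
      (∀ x ∈ ball x₀ r, x ∈ closedBall p₀ (θ / 2) → ∀ ρ, ρ ≤ c * (r ^ 2 - ‖x - x₀‖ ^ 2) →
        closedBall x ρ ⊆ ball x₀ r ∧
        ∫ z in closedBall x ρ, Real.exp (a * u z) ≤ C * ((r ^ 2 - ‖x - x₀‖ ^ 2) ^ m)⁻¹) →
      (∀ p ∈ closedBall x₀ r, p ∈ closedBall p₀ (θ / 2) → u p ≤ u p₀ + κ) → u p₀ ≤ S₀ := by
  obtain ⟨C₁, hC₁, hmv⟩ := exists_exp_le_of_integral_exp_le (N := N) (m := m) (C := C) hN hab hb.le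
    hK hc0 (by linarith) hC hκ ha haκ
  have hκ' : (0 : ℝ) < κ := by exact_mod_cast hκ
  have hN' : (0 : ℝ) < N := by exact_mod_cast hN
  set D := 4 * C₁ + K * (1 + 2 * κ) / N + 128 * Real.exp (b * κ) with hD
  have hDpos : 0 < D := by positivity
  refine ⟨max (3 / b) (κ * D), by positivity, fun u p₀ θ hθ hp₀ hu huc hu0 hlap hIb hdoub => ?_⟩
  by_contra! hS
  set S := u p₀ with hSdef
  have hS3 : 3 < b * S := by
    have := (le_max_left _ _).trans_lt hS
    rwa [div_lt_iff₀' hb] at this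
  have hS0 : 0 < S := by
    by_contra! h
    nlinarith
  have hθ0 : 0 < θ := hθ ▸ Real.exp_pos _
  have hθ1 : θ ≤ 1 := by
    rw [hθ]; exact Real.exp_le_one_iff.2 (neg_nonpos.2 (by positivity))
  have hDθ : D * θ ≤ 1 := by
    have h1 : D < S / κ := by
      rw [lt_div_iff₀' hκ']
      exact (le_max_right _ _).trans_lt hS
    have h2 : D ≤ Real.exp (S / κ) := by linarith [Real.add_one_le_exp (S / κ)]
    rw [hθ, Real.exp_neg, ← div_eq_mul_inv]
    exact div_le_one_of_le₀ h2 (Real.exp_pos _).le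
  have hpos1 : 0 ≤ K * (1 + 2 * κ) / N := by positivity
  have hsmall1 : C₁ * θ ≤ 1 / 4 := by
    have : 4 * C₁ ≤ D := by rw [hD]; linarith [Real.exp_pos (b * κ)]
    nlinarith
  have hsmall2 : K * (1 + 2 * κ) * θ ≤ N := by
    have h1 : K * (1 + 2 * κ) / N ≤ D := by rw [hD]; linarith [Real.exp_pos (b * κ)]
    have h2 := mul_le_mul_of_nonneg_right h1 hθ0.le
    rw [div_mul_eq_mul_div, div_le_iff₀ hN'] at h2
    nlinarith
  have hsmall3 : 128 * Real.exp (b * κ) * θ ≤ 1 := by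
    have : 128 * Real.exp (b * κ) ≤ D := by rw [hD]; linarith
    nlinarith
  set E := Real.exp (b * S) with hE
  have hE0 : 0 < E := Real.exp_pos _
  have hE4 : 4 ≤ E := by linarith [Real.add_one_le_exp (b * S)]
  set W := E * Real.exp (b * κ) with hW
  have hW0 : 0 < W := by positivity
  have hwW : ∀ p ∈ closedBall x₀ r, p ∈ closedBall p₀ (θ / 2) → Real.exp (b * u p) ≤ W :=
    fun p hp hpx => by
      rw [hW, hE, ← Real.exp_add, ← mul_add]
      exact Real.exp_le_exp.2 (mul_le_mul_of_nonneg_left (hdoub p hp hpx) hb.le)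
  have hinterior : ∀ x ∈ ball x₀ r, x ∈ closedBall p₀ (θ / 4) → θ ^ 4 ≤ r ^ 2 - ‖x - x₀‖ ^ 2 →
      Real.exp (b * u x) ≤ E / 4 := fun x hx hxx hxq => by
    have hxx' : dist x p₀ ≤ θ / 4 := hxx
    have hρ : c * θ ^ 4 ≤ θ / 4 := by
      have : c * θ ^ 4 ≤ 1 / 4 * θ ^ 1 :=
        mul_le_mul hc1 (pow_le_pow_of_le_one hθ0.le hθ1 (by norm_num)) (by positivity)
          (by norm_num)
      linarith
    obtain ⟨hsub, hI⟩ := hIb x hx (closedBall_subset_closedBall (by linarith) hxx) (c * θ ^ 4)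
      (by gcongr)
    have hclose : closedBall x (c * θ ^ 4) ⊆ closedBall p₀ (θ / 2) :=
      closedBall_subset_closedBall' (by linarith)
    have := hmv (ball x₀ r) u x S θ isOpen_ball hu hS0.le hθ hsub
      (fun p hp => ⟨hdoub p (ball_subset_closedBall (hsub hp)) (hclose hp),
        hlap p (hsub hp) (hclose hp)⟩)
      (hI.trans (by gcongr))
    nlinarith
  set D' := closedBall x₀ r ∩ (closedBall p₀ (θ / 4) ∩ {p | r ^ 2 - ‖p - x₀‖ ^ 2 ≤ θ ^ 4})
    with hD'
  have hsubD : ∀ p ∈ D', p ∈ closedBall p₀ (θ / 2) := fun p hp =>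
    closedBall_subset_closedBall (by linarith) hp.2.1
  by_cases hq : r ^ 2 - ‖p₀ - x₀‖ ^ 2 ≤ θ ^ 4
  swap
  · have hxb : p₀ ∈ ball x₀ r := by
      rw [mem_ball, dist_eq_norm]
      have : 0 < θ ^ 4 := by positivity
      exact lt_of_pow_lt_pow_left₀ 2 hr.le (by linarith)
    have := hinterior p₀ hxb (mem_closedBall_self (by positivity)) (le_of_not_ge hq)
    linarith
  have hcompact : IsCompact D' := (isCompact_closedBall x₀ r).inter_right
    (isClosed_closedBall.inter (isClosed_le (by fun_prop) continuous_const))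
  have hp₀D : p₀ ∈ D' := ⟨hp₀, mem_closedBall_self (by positivity), hq⟩
  set B := W / (θ / 4) ^ 2 with hB
  have hB0 : 0 < B := by positivity
  let Φ : 𝔼 → ℝ := fun p => Real.exp (b * u p) -
    (E / 4 + B * (‖p - p₀‖ ^ 2 + 2 * (r ^ 2 - ‖p - x₀‖ ^ 2)))
  have hΦc : ContinuousOn Φ D' := by
    have : ContinuousOn u D' := huc.mono Set.inter_subset_left
    fun_prop
  obtain ⟨p, hpD, hpmax⟩ := hcompact.exists_isMaxOn ⟨p₀, hp₀D⟩ hΦc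
  have hqnn : ∀ z ∈ closedBall x₀ r, 0 ≤ r ^ 2 - ‖z - x₀‖ ^ 2 := fun z hz => by
    have : ‖z - x₀‖ ≤ r := by rw [← dist_eq_norm]; exact hz
    have := pow_le_pow_left₀ (norm_nonneg _) this 2
    linarith
  have hΦp : Φ p ≤ 0 := by
    have hqp := hqnn p hpD.1
    have hterm : 0 ≤ B * (‖p - p₀‖ ^ 2 + 2 * (r ^ 2 - ‖p - x₀‖ ^ 2)) := by positivity
    suffices h : Real.exp (b * u p) ≤
        E / 4 + B * (‖p - p₀‖ ^ 2 + 2 * (r ^ 2 - ‖p - x₀‖ ^ 2)) from sub_nonpos.2 h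
    by_cases hps : p ∈ sphere x₀ r
    · rw [hu0 p hps, mul_zero, Real.exp_zero]
      linarith
    have hpb : p ∈ ball x₀ r := lt_of_le_of_ne hpD.1 hps
    by_cases hp4 : θ ^ 4 ≤ r ^ 2 - ‖p - x₀‖ ^ 2
    · have := hinterior p hpb hpD.2.1 hp4
      linarith
    by_cases hpr : θ / 4 ≤ ‖p - p₀‖
    · have h1 : W ≤ B * ‖p - p₀‖ ^ 2 := by
        have : W = B * (θ / 4) ^ 2 := by rw [hB]; field_simp
        rw [this]; gcongr
      have h2 := hwW p hpD.1 (hsubD p hpD)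
      have h3 := mul_nonneg hB0.le hqp
      linarith only [h1, h2, h3, hE0]
    exfalso
    push Not at hp4 hpr
    have hnhds : D' ∈ nhds p := by
      have h1 : IsOpen {z : 𝔼 | r ^ 2 - ‖z - x₀‖ ^ 2 < θ ^ 4} :=
        isOpen_lt (by fun_prop) continuous_const
      have h2 : p ∈ ball p₀ (θ / 4) := by rwa [mem_ball, dist_eq_norm]
      filter_upwards [isOpen_ball.mem_nhds hpb, isOpen_ball.mem_nhds h2, h1.mem_nhds hp4]
        with z hz1 hz2 hz3
      exact ⟨ball_subset_closedBall hz1, ball_subset_closedBall hz2, le_of_lt hz3⟩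
    have hcu : ContDiffAt ℝ 2 u p := hu.contDiffAt (isOpen_ball.mem_nhds hpb)
    have hcw : ContDiffAt ℝ 2 (fun z => Real.exp (b * u z)) p :=
      (contDiffAt_const.mul hcu).exp
    have hc2 : ContDiffAt ℝ 2
        (fun z : 𝔼 => E / 4 + B * (‖z - p₀‖ ^ 2 + 2 * (r ^ 2 - ‖z - x₀‖ ^ 2))) p :=
      (contDiff_barrier _ _ _ _ _).contDiffAt
    have hlapΦ : lap Φ p ≤ 0 :=
      lap_nonpos_of_isLocalMax (hcw.sub hc2) (hpmax.isLocalMax hnhds)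
    rw [lap_sub hcw hc2, lap_barrier] at hlapΦ
    have hl := hlap p hpb (hsubD p hpD)
    have hup : 1 + max (u p) 0 ≤ 1 + S + κ := by
      have : max (u p) 0 ≤ S + κ := max_le (hdoub p hpD.1 (hsubD p hpD)) (by positivity)
      linarith
    have h1 : K * Real.exp (b * u p) * (1 + max (u p) 0) ≤ K * W * ((1 + 2 * κ) / θ) := by
      have h2 := hup.trans (one_add_add_le_div hS0.le hκ hθ)
      have h3 := hwW p hpD.1 (hsubD p hpD)
      gcongr
    have h2 : K * W * ((1 + 2 * κ) / θ) ≤ N * B := by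
      have h3 : K * W * ((1 + 2 * κ) / θ) = K * (1 + 2 * κ) * θ * (W / θ ^ 2) := by field_simp
      have h4 : N * B = 16 * (N * (W / θ ^ 2)) := by rw [hB]; field_simp; norm_num
      have h5 : 0 < W / θ ^ 2 := by positivity
      rw [h3, h4]
      linarith only [mul_le_mul_of_nonneg_right hsmall2 h5.le, mul_pos hN' h5]
    have h3 : 0 < N * B := by positivity
    linarith only [hl, h1, h2, h3, hlapΦ]
  have hΦx : Φ p₀ ≤ 0 := (hpmax hp₀D).trans hΦp
  have h1 : B * (2 * (r ^ 2 - ‖p₀ - x₀‖ ^ 2)) ≤ E / 4 := by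
    calc _ ≤ B * (2 * θ ^ 4) := by gcongr
      _ = E * (128 * Real.exp (b * κ) * θ) * θ / 4 := by rw [hB, hW]; field_simp; norm_num
      _ ≤ E * 1 * 1 / 4 := by gcongr
      _ = _ := by ring
  have h2 : E - (E / 4 + B * (‖p₀ - p₀‖ ^ 2 + 2 * (r ^ 2 - ‖p₀ - x₀‖ ^ 2))) ≤ 0 := hΦx
  rw [sub_self, norm_zero] at h2
  norm_num at h2
  linarith

end Doubling

section LocalUpperBound

theorem exists_local_upper_bound (hN : 0 < N) {x₀ y : 𝔼} {r τ a b K c C : ℝ} {m : ℕ}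
    (hr : 0 < r) (hτ0 : 0 < τ) (hτ1 : τ ≤ 1) (hy : y ∈ closedBall x₀ r) (ha : 0 < a) (hab : a ≤ b)
    (hK : 0 ≤ K) (hc0 : 0 < c) (hc1 : c ≤ 1 / 4) (hC : 0 ≤ C) :
    ∃ M : ℝ, ∀ u : 𝔼 → ℝ,
      ContDiffOn ℝ 2 u (ball x₀ r) → ContinuousOn u (closedBall x₀ r) →
      (∀ x ∈ sphere x₀ r, u x = 0) →
      (∀ p ∈ ball y τ ∩ ball x₀ r,
        -(K * Real.exp (b * u p) * (1 + max (u p) 0)) ≤ lap (fun p => Real.exp (b * u p)) p) →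
      (∀ x ∈ ball y τ ∩ ball x₀ r, ∀ ρ, ρ ≤ c * (r ^ 2 - ‖x - x₀‖ ^ 2) →
        closedBall x ρ ⊆ ball x₀ r ∧
        ∫ z in closedBall x ρ, Real.exp (a * u z) ≤ C * ((r ^ 2 - ‖x - x₀‖ ^ 2) ^ m)⁻¹) →
      ∀ x ∈ ball y (τ / 2) ∩ closedBall x₀ r, u x ≤ M := by
  obtain ⟨κ, hκ⟩ := exists_nat_ge ((4 * (m + N) + 1) / a)
  have hκ' : (0 : ℝ) < κ := lt_of_lt_of_le (by positivity) hκ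
  have hκ0 : 0 < κ := by exact_mod_cast hκ'
  rw [div_le_iff₀' ha] at hκ
  obtain ⟨S₀, hS₀, hdbl⟩ := exists_bound_of_doubling hN x₀ hr hab (ha.trans_le hab) hK hc0 hc1 hC
    hκ0 ha.le hκ
  refine ⟨S₀ - κ * Real.log (τ / 2), fun u hu huc hu0 hlap hIb => ?_⟩
  let f : 𝔼 → ℝ := fun x => (τ - ‖x - y‖) ^ κ * Real.exp (u x)
  set D := closedBall x₀ r ∩ closedBall y τ with hD
  have hfc : ContinuousOn f D := by
    have : ContinuousOn u D := huc.mono Set.inter_subset_left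
    fun_prop
  have hyD : y ∈ D := ⟨hy, mem_closedBall_self hτ0.le⟩
  obtain ⟨z, hzD, hzmax⟩ := ((isCompact_closedBall x₀ r).inter_right
    isClosed_closedBall).exists_isMaxOn ⟨y, hyD⟩ hfc
  have hzτ : ‖z - y‖ ≤ τ := by rw [← dist_eq_norm]; exact hzD.2
  set t := τ - ‖z - y‖ with ht
  have ht0 : 0 < t := by
    refine lt_of_le_of_ne (sub_nonneg.2 hzτ) fun h => ?_
    have h1 : f y ≤ f z := hzmax hyD
    have h2 : f z = 0 := by
      change t ^ κ * _ = 0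
      rw [← h, zero_pow hκ0.ne', zero_mul]
    have h3 : 0 < f y := by
      change 0 < (τ - ‖y - y‖) ^ κ * _
      rw [sub_self, norm_zero, sub_zero]
      positivity
    linarith
  have ht1 : t ≤ 1 := by linarith [norm_nonneg (z - y)]
  have hfz : t ^ κ * Real.exp (u z) ≤ Real.exp S₀ := by
    set θ := Real.exp (-(u z / κ)) with hθ
    rcases le_or_gt θ t with hθt | hθt
    · have hclose : ∀ p ∈ closedBall z (θ / 2), t / 2 ≤ τ - ‖p - y‖ := fun p hp => by
        have h1 : ‖p - z‖ ≤ θ / 2 := by rw [← dist_eq_norm]; exact hp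
        have h2 := norm_sub_le_norm_sub_add_norm_sub p z y
        linarith
      have hball : ∀ p ∈ closedBall z (θ / 2), p ∈ ball y τ := fun p hp => by
        rw [mem_ball, dist_eq_norm]
        linarith [hclose p hp]
      have huz : u z ≤ S₀ := by
        refine hdbl u z θ hθ hzD.1 hu huc hu0 (fun p hp hpz => hlap p ⟨hball p hpz, hp⟩)
          (fun x hx hxz => hIb x ⟨hball x hxz, hx⟩) fun p hp hpz => ?_
        have h1 : f p ≤ f z := hzmax ⟨hp, ball_subset_closedBall (hball p hpz)⟩
        have h2 : (t / 2) ^ κ * Real.exp (u p) ≤ t ^ κ * Real.exp (u z) := by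
          refine le_trans ?_ h1
          have := hclose p hpz
          change _ ≤ (τ - ‖p - y‖) ^ κ * Real.exp (u p)
          gcongr
        have h3 : t ^ κ = (t / 2) ^ κ * 2 ^ κ := by rw [← mul_pow, div_mul_cancel₀ _ two_ne_zero]
        rw [h3, mul_assoc] at h2
        have h4 := le_of_mul_le_mul_left h2 (by positivity)
        have h5 : (2 : ℝ) ^ κ ≤ Real.exp κ := by
          rw [← mul_one (κ : ℝ), Real.exp_nat_mul]
          have := Real.add_one_le_exp (1 : ℝ)
          gcongr
          linarith
        rw [← Real.exp_le_exp, Real.exp_add, mul_comm (Real.exp (u z))]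
        exact h4.trans (by gcongr)
      calc _ ≤ 1 ^ κ * Real.exp S₀ := by gcongr
        _ = _ := by simp
    · calc t ^ κ * Real.exp (u z) ≤ θ ^ κ * Real.exp (u z) := by gcongr
        _ = Real.exp 0 := by
          rw [hθ, ← Real.exp_nat_mul, ← Real.exp_add]
          congr 1; field_simp; ring
        _ ≤ _ := Real.exp_le_exp.2 hS₀
  rintro x ⟨hxy, hxr⟩
  have hxy' : ‖x - y‖ < τ / 2 := by rw [← dist_eq_norm]; exact hxy
  have h1 : f x ≤ f z := hzmax ⟨hxr, by rw [mem_closedBall, dist_eq_norm]; linarith⟩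
  have h2 : (τ / 2) ^ κ * Real.exp (u x) ≤ Real.exp S₀ := by
    refine le_trans ?_ (h1.trans hfz)
    change _ ≤ (τ - ‖x - y‖) ^ κ * Real.exp (u x)
    gcongr
    linarith
  have h3 : (τ / 2) ^ κ = Real.exp (κ * Real.log (τ / 2)) := by
    rw [Real.exp_nat_mul, Real.exp_log (by positivity)]
  rw [h3, ← Real.exp_add, Real.exp_le_exp] at h2
  linarith

end LocalUpperBound

section Comparison

theorem pd_add {f g : 𝔼 → ℝ} {x : 𝔼} (hf : DifferentiableAt ℝ f x) (hg : DifferentiableAt ℝ g x)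
    (i : Fin N) : pd i (fun y => f y + g y) x = pd i f x + pd i g x := by
  simp only [pd, fderiv_fun_add hf hg, add_apply]

theorem pd_sub {f g : 𝔼 → ℝ} {x : 𝔼} (hf : DifferentiableAt ℝ f x) (hg : DifferentiableAt ℝ g x)
    (i : Fin N) : pd i (fun y => f y - g y) x = pd i f x - pd i g x := by
  simp only [pd, fderiv_fun_sub hf hg, sub_apply]

theorem contDiff_coord (j : Fin N) {n : WithTop ℕ∞} : ContDiff ℝ n fun y : 𝔼 => y j :=
  (EuclideanSpace.proj j : 𝔼 →L[ℝ] ℝ).contDiff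

theorem pd_mul_exp_coord (i j : Fin N) (e γ : ℝ) (x : 𝔼) :
    pd i (fun y : 𝔼 => e * Real.exp (γ * y j)) x =
      if j = i then e * γ * Real.exp (γ * x j) else 0 := by
  have hg : HasDerivAt (fun t => e * Real.exp (γ * t)) (e * (Real.exp (γ * x j) * γ)) (x j) := by
    simpa using (((hasDerivAt_id (x j)).const_mul γ).exp).const_mul e
  rw [pd_comp (u := fun y : 𝔼 => y j) hg ((contDiff_coord j (n := 1)).differentiable (by simp) x),
    pd_coord]
  split_ifs <;> ring

theorem lap_mul_exp_coord (j : Fin N) (e γ : ℝ) (x : 𝔼) :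
    lap (fun y : 𝔼 => e * Real.exp (γ * y j)) x = e * γ ^ 2 * Real.exp (γ * x j) := by
  have hc : ContDiffAt ℝ 2 (fun y : 𝔼 => y j) x := (contDiff_coord j).contDiffAt
  rw [lap_const_mul (contDiffAt_const.mul hc).exp, lap_exp_mul hc, lap_coord]
  simp [pd_coord]
  ring

/-- Maximum principle for a Laplacian with a locally bounded drift. -/
theorem le_of_drift_le_lap (j : Fin N) {x₀ : 𝔼} {r m₀ : ℝ} {d g : 𝔼 → ℝ} (hm₀ : 0 ≤ m₀)
    (hd : ContDiffOn ℝ 2 d (ball x₀ r)) (hdc : ContinuousOn d (closedBall x₀ r))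
    (hd0 : ∀ x ∈ sphere x₀ r, d x = 0) (hg : ContinuousOn g (ball x₀ r))
    (hlap : ∀ x ∈ ball x₀ r, m₀ < d x → (∀ i, i ≠ j → pd i d x = 0) →
      -(|g x| * |pd j d x|) ≤ lap d x) :
    ∀ x ∈ closedBall x₀ r, d x ≤ m₀ := by
  by_contra! hcon
  obtain ⟨x₁, hx₁, hx₁d⟩ := hcon
  set m₁ := (d x₁ + m₀) / 2 with hm₁
  have hcpt := isCompact_closedBall x₀ r
  have hDc : IsCompact (closedBall x₀ r ∩ d ⁻¹' Set.Ici m₁) :=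
    hcpt.of_isClosed_subset (hdc.preimage_isClosed_of_isClosed isClosed_closedBall isClosed_Ici)
      Set.inter_subset_left
  have hball : ∀ x ∈ closedBall x₀ r, m₀ < d x → x ∈ ball x₀ r := fun x hx hxd =>
    lt_of_le_of_ne hx fun h => by linarith [hd0 x h]
  obtain ⟨B, hB⟩ := hDc.exists_bound_of_continuousOn (f := g)
    (hg.mono fun x hx => hball x hx.1 (lt_of_lt_of_le (by linarith) hx.2))
  set γ := |B| + 1 with hγ
  have hγ0 : 0 < γ := by positivity
  obtain ⟨E, hE⟩ := hcpt.exists_bound_of_continuousOn (f := fun y : 𝔼 => Real.exp (γ * y j))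
    (by fun_prop)
  have hE' : ∀ x ∈ closedBall x₀ r, Real.exp (γ * x j) ≤ E := fun x hx =>
    (le_abs_self _).trans (hE x hx)
  have hE0 : 0 < E := (Real.exp_pos _).trans_le (hE' x₁ hx₁)
  set e := (d x₁ - m₁) / (2 * E) with he
  have he0 : 0 < e := div_pos (by linarith) (by positivity)
  let ψ : 𝔼 → ℝ := fun y => d y + e * Real.exp (γ * y j)
  obtain ⟨p, hp, hpmax⟩ := hcpt.exists_isMaxOn ⟨x₁, hx₁⟩
    (show ContinuousOn ψ (closedBall x₀ r) by fun_prop)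
  have hdp : m₁ < d p := by
    have h1 : d x₁ + e * Real.exp (γ * x₁ j) ≤ d p + e * Real.exp (γ * p j) := hpmax hx₁
    have h2 : e * Real.exp (γ * p j) ≤ e * E := mul_le_mul_of_nonneg_left (hE' p hp) he0.le
    have h3 : e * E = (d x₁ - m₁) / 2 := by rw [he]; field_simp
    have h4 : 0 < e * Real.exp (γ * x₁ j) := by positivity
    linarith
  have hpb : p ∈ ball x₀ r := hball p hp (by linarith)
  have hloc : IsLocalMax ψ p :=
    (hpmax.on_subset ball_subset_closedBall).isLocalMax (isOpen_ball.mem_nhds hpb)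
  have hdC : ContDiffAt ℝ 2 d p := hd.contDiffAt (isOpen_ball.mem_nhds hpb)
  have heC : ContDiffAt ℝ 2 (fun y : 𝔼 => e * Real.exp (γ * y j)) p :=
    contDiffAt_const.mul (contDiffAt_const.mul (contDiff_coord j).contDiffAt).exp
  have hlapψ : lap d p + e * γ ^ 2 * Real.exp (γ * p j) ≤ 0 := by
    rw [← lap_mul_exp_coord, ← lap_add hdC heC]
    exact lap_nonpos_of_isLocalMax (hdC.add heC) hloc
  have hpd : ∀ i, pd i d p + (if j = i then e * γ * Real.exp (γ * p j) else 0) = 0 := fun i => by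
    rw [← pd_mul_exp_coord, ← pd_add (hdC.differentiableAt (by simp))
      (heC.differentiableAt (by simp))]
    change fderiv ℝ ψ p _ = 0
    rw [hloc.fderiv_eq_zero]
    rfl
  have hpos : 0 < e * γ * Real.exp (γ * p j) := by positivity
  have hpdj : |pd j d p| = e * γ * Real.exp (γ * p j) := by
    have := hpd j
    rw [if_pos rfl] at this
    rw [eq_neg_of_add_eq_zero_left this, abs_neg, abs_of_pos hpos]
  have h1 := hlap p hpb (by linarith) fun i hi => by
    have := hpd i
    rwa [if_neg (Ne.symm hi), add_zero] at this
  have h2 : |g p| ≤ |B| := (hB p ⟨hp, hdp.le⟩).trans (le_abs_self B)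
  rw [hpdj] at h1
  have h3 := mul_le_mul_of_nonneg_right h2 hpos.le
  have h4 : e * γ ^ 2 * Real.exp (γ * p j) =
      |B| * (e * γ * Real.exp (γ * p j)) + e * γ * Real.exp (γ * p j) := by
    rw [hγ]; ring
  linarith

theorem continuousOn_pd {u : 𝔼 → ℝ} {Ω : Set 𝔼} (hΩ : IsOpen Ω) (hu : ContDiffOn ℝ 2 u Ω)
    (i : Fin N) : ContinuousOn (pd i u) Ω := fun _ hx =>
  (contDiffAt_pd (hu.contDiffAt (hΩ.mem_nhds hx)) i).continuousAt.continuousWithinAt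

theorem IsClassicalSolution.on_ball {x₀ : 𝔼} {r : ℝ} (hr : 0 < r) {cp cm h μ u : 𝔼 → ℝ}
    {lam : ℝ} (hu : IsClassicalSolution (ball x₀ r) cp cm h μ lam u) :
    ContDiffOn ℝ 2 u (ball x₀ r) ∧ ContinuousOn u (closedBall x₀ r) ∧
      (∀ x ∈ sphere x₀ r, u x = 0) ∧ ∀ x ∈ ball x₀ r,
        lap u x = -((lam * cp x - cm x) * u x + μ x * ∑ i, pd i u x ^ 2 + h x) := by
  obtain ⟨h1, h2, -, h3, h4⟩ := hu
  rw [closure_ball x₀ hr.ne'] at h2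
  rw [frontier_ball x₀ hr.ne'] at h3
  refine ⟨h1, h2, h3, fun x hx => ?_⟩
  rw [← norm_gradient_sq, ← h4 x hx, neg_neg]

/-- A bound for the difference of two solutions on the support of `cp` is a global one. -/
theorem sub_le_of_sub_le_on_support (j : Fin N) {x₀ : 𝔼} {r : ℝ} (hr : 0 < r)
    {cp cm h μ u w : 𝔼 → ℝ} {lam lam' m₀ C : ℝ} (hm₀ : 0 ≤ m₀)
    (hu : IsClassicalSolution (ball x₀ r) cp cm h μ lam u)
    (hw : IsClassicalSolution (ball x₀ r) cp cm h μ lam' w)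
    (hcm : ∀ x ∈ ball x₀ r, 0 ≤ cm x) (hμ : ∀ x ∈ ball x₀ r, |μ x| ≤ C)
    (hsup : ∀ x ∈ ball x₀ r, cp x ≠ 0 → u x - w x ≤ m₀) :
    ∀ x ∈ closedBall x₀ r, u x - w x ≤ m₀ := by
  obtain ⟨hu1, hu2, hu3, hu4⟩ := hu.on_ball hr
  obtain ⟨hw1, hw2, hw3, hw4⟩ := hw.on_ball hr
  refine le_of_drift_le_lap j (d := fun x => u x - w x)
    (g := fun x => C * (pd j u x + pd j w x)) hm₀ (hu1.sub hw1) (hu2.sub hw2)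
    (fun x hx => by rw [hu3 x hx, hw3 x hx, sub_zero])
    (continuousOn_const.mul ((continuousOn_pd isOpen_ball hu1 j).add
      (continuousOn_pd isOpen_ball hw1 j))) fun x hx hxd hpd => ?_
  have huC : ContDiffAt ℝ 2 u x := hu1.contDiffAt (isOpen_ball.mem_nhds hx)
  have hwC : ContDiffAt ℝ 2 w x := hw1.contDiffAt (isOpen_ball.mem_nhds hx)
  have hcp : cp x = 0 := by
    by_contra hne
    exact absurd (hsup x hx hne) (not_le.2 hxd)
  have hpds := fun i => pd_sub (huC.differentiableAt (by simp)) (hwC.differentiableAt (by simp)) i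
  have hsum : ∑ i, pd i u x ^ 2 - ∑ i, pd i w x ^ 2 =
      (pd j u x + pd j w x) * (pd j u x - pd j w x) := by
    rw [← Finset.sum_sub_distrib, Finset.sum_eq_single j]
    · ring
    · intro i _ hi
      have := hpd i hi
      rw [hpds, sub_eq_zero] at this
      rw [this, sub_self]
    · simp
  rw [lap_sub huC hwC, hu4 x hx, hw4 x hx, hcp, hpds]
  have h1 : μ x * (∑ i, pd i u x ^ 2 - ∑ i, pd i w x ^ 2) ≤
      |C * (pd j u x + pd j w x)| * |pd j u x - pd j w x| := by
    rw [hsum, ← abs_mul]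
    refine (le_abs_self _).trans ?_
    rw [mul_assoc, abs_mul, abs_mul C]
    exact mul_le_mul_of_nonneg_right ((hμ x hx).trans (le_abs_self C)) (abs_nonneg _)
  have h2 := mul_nonneg (hcm x hx) (hm₀.trans hxd.le)
  linarith

end Comparison

section APriori

theorem neg_one_le_mul_exp (s : ℝ) : -1 ≤ s * Real.exp s := by
  rcases le_or_gt 0 s with hs | hs
  · linarith [mul_nonneg hs (Real.exp_pos s).le]
  · have h1 := mul_le_mul_of_nonneg_right (Real.add_one_le_exp (-s)) (Real.exp_pos s).le
    rw [← Real.exp_add, neg_add_cancel, Real.exp_zero] at h1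
    linarith [Real.exp_pos s]

theorem lap_exp_mul_le {u : 𝔼 → ℝ} {x : 𝔼} {l μ h a H : ℝ} (hu : ContDiffAt ℝ 2 u x)
    (hlap : lap u x = -(l * u x + μ * ∑ i, pd i u x ^ 2 + h)) (ha : 0 ≤ a) (haμ : a ≤ μ)
    (hh : |h| ≤ H) :
    lap (fun y => Real.exp (a * u y)) x ≤
      -(l * (a * u x * Real.exp (a * u x))) + a * H * Real.exp (a * u x) := by
  rw [lap_exp_mul hu, hlap]
  have hq : 0 ≤ ∑ i, pd i u x ^ 2 := Finset.sum_nonneg fun i _ => sq_nonneg _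
  have h1 : a * (-(l * u x + μ * ∑ i, pd i u x ^ 2 + h)) + a ^ 2 * ∑ i, pd i u x ^ 2 ≤
      -(l * (a * u x)) + a * H := by
    have h2 := mul_nonneg (mul_nonneg ha hq) (sub_nonneg.2 haμ)
    have h3 := mul_le_mul_of_nonneg_left (neg_le.1 (abs_le.1 hh).1) ha
    nlinarith
  have := mul_le_mul_of_nonneg_left h1 (Real.exp_pos (a * u x)).le
  linarith

theorem le_lap_exp_mul {u : 𝔼 → ℝ} {x : 𝔼} {l L μ h b H : ℝ} (hu : ContDiffAt ℝ 2 u x)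
    (hlap : lap u x = -(l * u x + μ * ∑ i, pd i u x ^ 2 + h)) (hb : 0 ≤ b) (hbμ : μ ≤ b)
    (hh : |h| ≤ H) (hl0 : 0 ≤ l) (hl : l ≤ L) :
    -(b * (L + H) * Real.exp (b * u x) * (1 + max (u x) 0)) ≤
      lap (fun y => Real.exp (b * u y)) x := by
  rw [lap_exp_mul hu, hlap]
  have hq : 0 ≤ ∑ i, pd i u x ^ 2 := Finset.sum_nonneg fun i _ => sq_nonneg _
  have hm0 : 0 ≤ max (u x) 0 := le_max_right _ _
  have hH : 0 ≤ H := (abs_nonneg h).trans hh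
  have h1 : -(b * (L + H) * (1 + max (u x) 0)) ≤
      b * (-(l * u x + μ * ∑ i, pd i u x ^ 2 + h)) + b ^ 2 * ∑ i, pd i u x ^ 2 := by
    have h2 := mul_nonneg (mul_nonneg hb hq) (sub_nonneg.2 hbμ)
    have h3 : l * u x ≤ L * max (u x) 0 :=
      (mul_le_mul_of_nonneg_left (le_max_left _ _) hl0).trans (mul_le_mul_of_nonneg_right hl hm0)
    have h4 := mul_le_mul_of_nonneg_left (add_le_add h3 ((le_abs_self h).trans hh)) hb
    have h5 := mul_nonneg hb (add_nonneg (hl0.trans hl) (mul_nonneg hH hm0))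
    nlinarith
  have := mul_le_mul_of_nonneg_left h1 (Real.exp_pos (b * u x)).le
  linarith

theorem neg_mul_exp_add_le {l L l₀ s T A : ℝ} (hl₀ : 0 < l₀) (hl : l₀ ≤ l) (hL : l ≤ L)
    (hA : 0 ≤ A) (hT : 0 ≤ T) :
    -(l * (s * Real.exp s)) + A * Real.exp s ≤
      -T * Real.exp s + (L + (A + T) * Real.exp ((A + T) / l₀)) := by
  have hes := Real.exp_pos s
  have hL0 : 0 ≤ L := by linarith
  rcases le_or_gt ((A + T) / l₀) s with hs | hs
  · have hs0 : 0 ≤ s := le_trans (by positivity) hs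
    rw [div_le_iff₀ hl₀] at hs
    have h1 : A + T ≤ l * s := by nlinarith
    have h2 := mul_le_mul_of_nonneg_right h1 hes.le
    have h3 : 0 ≤ (A + T) * Real.exp ((A + T) / l₀) := by positivity
    linarith
  · have h1 : (A + T) * Real.exp s ≤ (A + T) * Real.exp ((A + T) / l₀) := by gcongr
    have h2 := mul_le_mul_of_nonneg_left (neg_one_le_mul_exp s) (hl₀.le.trans hl)
    linarith

/-- Uniform upper bound near a point of the support of `cp`. -/
theorem exists_upper_bound_near_support (hN : 0 < N) {x₀ : 𝔼} {r : ℝ} (hr : 0 < r)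
    {cp cm h μ : 𝔼 → ℝ} {P H m₂ ε μ₁ Λ₁ Λ₂ : ℝ} (hcpc : ContinuousOn cp (ball x₀ r))
    (hcp0 : ∀ x ∈ ball x₀ r, 0 ≤ cp x) (hcp : ∀ x ∈ ball x₀ r, cp x ≤ P)
    (hh : ∀ x ∈ ball x₀ r, |h x| ≤ H) (hμ : ∀ x ∈ ball x₀ r, μ x ≤ m₂) (hε : 0 < ε)
    (hμ₁ : 0 < μ₁) (hΛ₁ : 0 < Λ₁) {y : 𝔼} (hy : y ∈ closure {x ∈ ball x₀ r | cp x ≠ 0})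
    (hnear : ∀ x ∈ ball y ε ∩ ball x₀ r, μ₁ ≤ μ x ∧ cm x = 0) :
    ∃ τ > 0, ∃ M : ℝ, ∀ lam ∈ Set.Icc Λ₁ Λ₂, ∀ u : 𝔼 → ℝ,
      IsClassicalSolution (ball x₀ r) cp cm h μ lam u →
        ∀ x ∈ ball y τ ∩ closedBall x₀ r, u x ≤ M := by
  obtain ⟨z, ⟨hzΩ, hzcp⟩, hyz⟩ := mem_closure_iff.1 hy ε hε
  have hyr : y ∈ closedBall x₀ r := by
    rw [← closure_ball x₀ hr.ne']
    exact closure_mono (Set.sep_subset _ _) hy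
  set G := ball y ε ∩ ball x₀ r with hGdef
  have hG : IsOpen G := isOpen_ball.inter isOpen_ball
  have hzG : z ∈ G := ⟨by rwa [mem_ball, dist_comm], hzΩ⟩
  have hcpz : 0 < cp z := lt_of_le_of_ne (hcp0 z hzΩ) (Ne.symm hzcp)
  obtain ⟨β, hβ, hβG, hβη⟩ : ∃ β > 0, closedBall z β ⊆ G ∧
      ∀ x ∈ closedBall z β, cp z / 2 ≤ cp x := by
    have h1 : ∀ᶠ x in nhds z, cp z / 2 < cp x :=
      (hcpc.continuousAt (isOpen_ball.mem_nhds hzΩ)).eventually_const_lt (by linarith)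
    obtain ⟨β, hβ, hβs⟩ := nhds_basis_closedBall.mem_iff.1 (Filter.inter_mem (hG.mem_nhds hzG) h1)
    exact ⟨β, hβ, fun x hx => (hβs hx).1, fun x hx => le_of_lt (hβs hx).2⟩
  have hP : 0 ≤ P := (hcp0 z hzΩ).trans (hcp z hzΩ)
  have hH : 0 ≤ H := (abs_nonneg _).trans (hh z hzΩ)
  by_cases hΛ : Λ₁ ≤ Λ₂
  swap
  · exact ⟨1, one_pos, 0, fun lam hlam => absurd (hlam.1.trans hlam.2) hΛ⟩
  have hΛ₂ : 0 < Λ₂ := hΛ₁.trans_le hΛ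
  have heq : ∀ lam u, IsClassicalSolution (ball x₀ r) cp cm h μ lam u → ∀ x ∈ G,
      lap u x = -(lam * cp x * u x + μ x * ∑ i, pd i u x ^ 2 + h x) := fun lam u hu x hx => by
    rw [(hu.on_ball hr).2.2.2 x hx.2, (hnear x hx).2, sub_zero]
  have hcd : ∀ lam u, IsClassicalSolution (ball x₀ r) cp cm h μ lam u → ∀ x ∈ G,
      ContDiffAt ℝ 2 u x := fun lam u hu x hx => hu.1.contDiffAt (isOpen_ball.mem_nhds hx.2)
  let 𝓥 : Set (𝔼 → ℝ) := {v | ∃ lam ∈ Set.Icc Λ₁ Λ₂, ∃ u,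
    IsClassicalSolution (ball x₀ r) cp cm h μ lam u ∧ v = fun x => Real.exp (μ₁ * u x)}
  have hreg : ∀ v ∈ 𝓥, ContDiffOn ℝ 2 v G := by
    rintro _ ⟨lam, -, u, hu, rfl⟩ x hx
    exact (contDiffAt_const.mul (hcd lam u hu x hx)).exp.contDiffWithinAt
  have hv0 : ∀ v ∈ 𝓥, ∀ x ∈ G, 0 ≤ v x := by
    rintro _ ⟨lam, -, u, hu, rfl⟩ x hx
    exact (Real.exp_pos _).le
  have hlam : ∀ lam ∈ Set.Icc Λ₁ Λ₂, ∀ x ∈ ball x₀ r, 0 ≤ lam * cp x ∧ lam * cp x ≤ Λ₂ * P :=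
    fun lam hlam x hx => ⟨mul_nonneg (hΛ₁.le.trans hlam.1) (hcp0 x hx),
      mul_le_mul hlam.2 (hcp x hx) (hcp0 x hx) hΛ₂.le⟩
  have hlap : ∀ v ∈ 𝓥, ∀ x ∈ G, lap v x ≤ (Λ₂ * P + μ₁ * H) * v x + (Λ₂ * P + μ₁ * H) := by
    rintro _ ⟨lam, hl, u, hu, rfl⟩ x hx
    refine (lap_exp_mul_le (hcd lam u hu x hx) (heq lam u hu x hx) hμ₁.le (hnear x hx).1
      (hh x hx.2)).trans ?_
    obtain ⟨h1, h2⟩ := hlam lam hl x hx.2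
    have h3 := mul_le_mul_of_nonneg_left (neg_one_le_mul_exp (μ₁ * u x)) h1
    have h4 : 0 ≤ Λ₂ * P * Real.exp (μ₁ * u x) := by positivity
    have h5 : 0 ≤ μ₁ * H := by positivity
    linarith
  have hzloc : LocallyBounded 𝓥 G z := by
    refine LocallyBounded.of_superlinear hG hreg hv0 hβ hβG fun T hT => ⟨Λ₂ * P +
      (μ₁ * H + T) * Real.exp ((μ₁ * H + T) / (Λ₁ * (cp z / 2))), by positivity, ?_⟩
    rintro _ ⟨lam, hl, u, hu, rfl⟩ x hxβ
    have hx := hβG hxβ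
    refine (lap_exp_mul_le (hcd lam u hu x hx) (heq lam u hu x hx) hμ₁.le (hnear x hx).1
      (hh x hx.2)).trans ?_
    exact neg_mul_exp_add_le (by positivity)
      (mul_le_mul hl.1 (hβη x hxβ) (by positivity) (hΛ₁.le.trans hl.1)) (hlam lam hl x hx.2).2
      (by positivity) hT
  have hconn : IsPreconnected G := ((convex_ball y ε).inter (convex_ball x₀ r)).isPreconnected
  have hK : 0 ≤ Λ₂ * P + μ₁ * H := by positivity
  obtain ⟨τ, c, C, m, hτ0, hτ1, hτε, hc0, hc1, hC, hIb⟩ :=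
    exists_integral_bound_near_sphere hr hε hK hyr hreg hv0 hlap
      (locallyBounded_of_isPreconnected hG hconn hK hreg hv0 hlap hzloc)
  have hb0 : 0 ≤ max m₂ μ₁ := hμ₁.le.trans (le_max_right _ _)
  obtain ⟨M, hM⟩ := exists_local_upper_bound (K := max m₂ μ₁ * (Λ₂ * P + H)) (m := m) hN hr hτ0 hτ1
    hyr hμ₁ (le_max_right m₂ μ₁) (by positivity) hc0 hc1 hC
  refine ⟨τ / 2, half_pos hτ0, M, fun lam hl u hu => ?_⟩
  obtain ⟨hu1, hu2, hu3, -⟩ := hu.on_ball hr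
  refine hM u hu1 hu2 hu3 (fun p hp => ?_) fun x hx ρ hρ => ?_
  · have hpG : p ∈ G := ⟨ball_subset_ball hτε.le hp.1, hp.2⟩
    exact le_lap_exp_mul (hcd lam u hu p hpG) (heq lam u hu p hpG) hb0
      ((hμ p hp.2).trans (le_max_left _ _)) (hh p hp.2) (hlam lam hl p hp.2).1
      (hlam lam hl p hp.2).2
  · obtain ⟨h1, h2⟩ := hIb _ ⟨lam, hl, u, hu, rfl⟩ x hx ρ hρ
    exact ⟨h1.trans Set.inter_subset_right, h2⟩

end APriori

end

/-- A priori upper bound for solutions of `(P_λ)`, `λ ∈ [Λ₁, Λ₂]`, on a ball. -/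
theorem stmt_0 {N : ℕ} (hN : 2 ≤ N) (x₀ : EuclideanSpace ℝ (Fin N)) (r : ℝ) (hr : 0 < r)
    (Ω : Set (EuclideanSpace ℝ (Fin N))) (hΩ : Ω = ball x₀ r)
    (cp cm h μ : EuclideanSpace ℝ (Fin N) → ℝ)
    (hcpc : ContinuousOn cp (closure Ω)) (hcmc : ContinuousOn cm (closure Ω))
    (hhc : ContinuousOn h (closure Ω)) (hμc : ContinuousOn μ Ω)
    (hμb : ∃ C : ℝ, ∀ x ∈ Ω, |μ x| ≤ C)
    (hcp0 : ∀ x ∈ Ω, 0 ≤ cp x) (hcm0 : ∀ x ∈ Ω, 0 ≤ cm x)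
    (hprod : ∀ x ∈ Ω, cp x * cm x = 0)
    (Ωp : Set (EuclideanSpace ℝ (Fin N))) (hΩp : Ωp = closure {x ∈ Ω | cp x ≠ 0})
    (hne : Ωp.Nonempty)
    (ε μ₁ : ℝ) (hε : 0 < ε) (hμ₁ : 0 < μ₁)
    (hnear : ∀ x ∈ Ω, infDist x Ωp < ε → μ₁ ≤ μ x ∧ cm x = 0) :
    ∀ Λ₁ Λ₂ : ℝ, 0 < Λ₁ → Λ₁ < Λ₂ →
      ∃ M : ℝ, 0 < M ∧ ∀ lam ∈ Icc Λ₁ Λ₂,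
        ∀ u : EuclideanSpace ℝ (Fin N) → ℝ,
          IsClassicalSolution Ω cp cm h μ lam u → ∀ x ∈ Ω, u x ≤ M := by
  subst hΩ hΩp
  intro Λ₁ Λ₂ hΛ₁ _
  have hcl : closure (ball x₀ r) = closedBall x₀ r := closure_ball x₀ hr.ne'
  rw [hcl] at hcpc hhc
  have hcpt := isCompact_closedBall x₀ r
  obtain ⟨P, hP⟩ := hcpt.exists_bound_of_continuousOn hcpc
  obtain ⟨H, hH⟩ := hcpt.exists_bound_of_continuousOn hhc
  obtain ⟨m₂, hm₂⟩ := hμb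
  set Ωp := closure {x ∈ ball x₀ r | cp x ≠ 0} with hΩp
  have hΩpc : IsCompact Ωp := hcpt.of_isClosed_subset isClosed_closure
    (hcl ▸ closure_mono (sep_subset _ _))
  obtain ⟨M₁, hM₁⟩ : ∃ M : ℝ, ∀ lam ∈ Icc Λ₁ Λ₂, ∀ u : EuclideanSpace ℝ (Fin N) → ℝ,
      IsClassicalSolution (ball x₀ r) cp cm h μ lam u →
        ∀ x ∈ Ωp ∩ closedBall x₀ r, u x ≤ M := by
    refine hΩpc.induction_on (p := fun s => ∃ M : ℝ, ∀ lam ∈ Icc Λ₁ Λ₂,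
      ∀ u : EuclideanSpace ℝ (Fin N) → ℝ, IsClassicalSolution (ball x₀ r) cp cm h μ lam u →
        ∀ x ∈ s ∩ closedBall x₀ r, u x ≤ M) ⟨0, by simp⟩ ?_ ?_ fun y hy => ?_
    · rintro s t hst ⟨M, hM⟩
      exact ⟨M, fun lam hl u hu x hx => hM lam hl u hu x ⟨hst hx.1, hx.2⟩⟩
    · rintro s t ⟨M, hM⟩ ⟨M', hM'⟩
      refine ⟨max M M', fun lam hl u hu x hx => ?_⟩
      rcases hx.1 with hxs | hxt
      · exact (hM lam hl u hu x ⟨hxs, hx.2⟩).trans (le_max_left _ _)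
      · exact (hM' lam hl u hu x ⟨hxt, hx.2⟩).trans (le_max_right _ _)
    · obtain ⟨τ, hτ, M, hM⟩ := exists_upper_bound_near_support (by omega) hr
        (hcpc.mono ball_subset_closedBall) hcp0
        (fun x hx => (le_abs_self _).trans (hP x (ball_subset_closedBall hx)))
        (fun x hx => hH x (ball_subset_closedBall hx))
        (fun x hx => (le_abs_self _).trans (hm₂ x hx)) hε hμ₁ hΛ₁ hy
        (fun x hx => hnear x hx.2 ((infDist_le_dist_of_mem hy).trans_lt hx.1))
      exact ⟨ball y τ, mem_nhdsWithin_of_mem_nhds (ball_mem_nhds y hτ), M, hM⟩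
  by_cases hex : ∃ lam ∈ Icc Λ₁ Λ₂, ∃ w, IsClassicalSolution (ball x₀ r) cp cm h μ lam w
  · obtain ⟨lam', -, w, hw⟩ := hex
    obtain ⟨C, hC⟩ := hw.2.2.1
    refine ⟨max M₁ 0 + 2 * |C| + 1, by positivity, fun lam hl u hu x hx => ?_⟩
    have hwC : ∀ x ∈ ball x₀ r, |w x| ≤ |C| := fun x hx =>
      (hC x (subset_closure hx)).trans (le_abs_self C)
    have := sub_le_of_sub_le_on_support ⟨0, by omega⟩ hr (m₀ := max M₁ 0 + |C|) (by positivity)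
      hu hw hcm0 hm₂ (fun x hx hxcp => by
        have h1 := hM₁ lam hl u hu x ⟨subset_closure ⟨hx, hxcp⟩, ball_subset_closedBall hx⟩
        linarith [le_max_left M₁ 0, (abs_le.1 (hwC x hx)).1]) x (ball_subset_closedBall hx)
    linarith [(abs_le.1 (hwC x hx)).2]
  · push Not at hex
    exact ⟨1, one_pos, fun lam hl u hu => absurd hu (hex lam hl u)⟩
end

section
/- Let N ≥ 2, x̄ ∈ ℝ^N and R > 0. Let c₊, h, μ be continuous on the closed ball cl(B_{4R}(x̄)), with c₊ ≥ 0 on B_{4R}(x̄), c₊ not identically zero on B_R(x̄), and μ(x) ≥ μ₁ on B_{4R}(x̄) for some μ₁ > 0. Then for all real numbers Λ₂ > Λ₁ > 0 there exists M > 0 such that for every λ ∈ [Λ₁, Λ₂] and every bounded C² function u : B_{4R}(x̄) → ℝ satisfying −Δu(x) = λ c₊(x) u(x) + μ(x)|∇u(x)|² + h(x) for all x ∈ B_{4R}(x̄), one has sup_{B_R(x̄)} u ≤ M. -/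
open MeasureTheory Metric Set

namespace LocalBound

open Filter Topology

variable {N : ℕ}

theorem hasDerivAt_max_zero_pow_three (s : ℝ) :
    HasDerivAt (fun s : ℝ => max 0 s ^ 3) (3 * max 0 s ^ 2) s := by
  rcases lt_trichotomy s 0 with hs | hs | hs
  · rw [max_eq_left hs.le]
    have : HasDerivAt (fun _ : ℝ => (0 : ℝ)) (3 * 0 ^ 2) s := by
      simpa using hasDerivAt_const s (0 : ℝ)
    refine this.congr_of_eventuallyEq ?_
    filter_upwards [Iio_mem_nhds hs] with y hy
    rw [max_eq_left (le_of_lt hy)]; norm_num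
  · subst hs
    rw [hasDerivAt_iff_isLittleO]
    refine Asymptotics.IsBigO.trans_isLittleO (g := fun y : ℝ => (y - 0) ^ 2) ?_ ?_
    · refine Asymptotics.IsBigO.of_bound 1 ?_
      filter_upwards [Metric.ball_mem_nhds (0 : ℝ) one_pos] with y hy
      have hy' : |y| < 1 := by simpa using hy
      have h0 : 0 ≤ max 0 y := le_max_left _ _
      have h1 : max 0 y ≤ |y| := max_le (abs_nonneg _) (le_abs_self _)
      have : max 0 y ^ 3 ≤ |y| ^ 2 := by
        calc max 0 y ^ 3 ≤ |y| ^ 3 := by gcongr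
          _ = |y| ^ 2 * |y| := by ring
          _ ≤ |y| ^ 2 * 1 := by gcongr
          _ = |y| ^ 2 := by ring
      simpa [abs_of_nonneg h0, abs_of_nonneg (pow_nonneg h0 3)] using this
    · simpa using (Asymptotics.isLittleO_pow_id (𝕜 := ℝ) (n := 2) (by norm_num))
  · rw [max_eq_right hs.le]
    have : HasDerivAt (fun s : ℝ => s ^ 3) (3 * s ^ 2) s := by
      simpa using hasDerivAt_pow 3 s
    refine this.congr_of_eventuallyEq ?_
    filter_upwards [Ioi_mem_nhds hs] with y hy
    rw [max_eq_right (le_of_lt hy)]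

/-- The positive part of `1 - ‖z‖ ^ 2`; its powers serve as averaging weights. -/
noncomputable def paraboloid (z : EuclideanSpace ℝ (Fin N)) : ℝ := max 0 (1 - ‖z‖ ^ 2)

local notation "𝔮" => paraboloid

theorem paraboloid_nonneg (z : EuclideanSpace ℝ (Fin N)) : 0 ≤ 𝔮 z := le_max_left _ _

theorem paraboloid_le_one (z : EuclideanSpace ℝ (Fin N)) : 𝔮 z ≤ 1 :=
  max_le zero_le_one (by nlinarith [sq_nonneg ‖z‖])

theorem paraboloid_eq_zero {z : EuclideanSpace ℝ (Fin N)} (hz : 1 ≤ ‖z‖) : 𝔮 z = 0 :=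
  max_eq_left (by nlinarith)

@[fun_prop]
theorem continuous_paraboloid : Continuous (paraboloid (N := N)) := by
  unfold paraboloid; fun_prop

theorem hasCompactSupport_mul_paraboloid_pow (g : EuclideanSpace ℝ (Fin N) → ℝ) {k : ℕ}
    (hk : k ≠ 0) : HasCompactSupport (fun z => g z * 𝔮 z ^ k) := by
  refine HasCompactSupport.intro (isCompact_closedBall (0 : EuclideanSpace ℝ (Fin N)) 1) ?_
  intro z hz
  have : 1 ≤ ‖z‖ := by
    simp only [mem_closedBall, dist_zero_right, not_le] at hz
    exact hz.le
  simp [paraboloid_eq_zero this, hk]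

theorem integrable_mul_paraboloid_pow {g : EuclideanSpace ℝ (Fin N) → ℝ} (hg : Continuous g)
    {k : ℕ} (hk : k ≠ 0) : Integrable (fun z => g z * 𝔮 z ^ k) :=
  (hg.mul (continuous_paraboloid.pow k)).integrable_of_hasCompactSupport
    (hasCompactSupport_mul_paraboloid_pow g hk)

theorem hasFDerivAt_paraboloid_pow_three (z : EuclideanSpace ℝ (Fin N)) :
    HasFDerivAt (fun z : EuclideanSpace ℝ (Fin N) => 𝔮 z ^ 3)
      ((-6 * 𝔮 z ^ 2) • innerSL ℝ z) z := by
  have h1 : HasFDerivAt (fun z : EuclideanSpace ℝ (Fin N) => 1 - ‖z‖ ^ 2)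
      (-(2 • innerSL ℝ z)) z :=
    (hasStrictFDerivAt_norm_sq z).hasFDerivAt.const_sub 1
  have h2 := (hasDerivAt_max_zero_pow_three (1 - ‖z‖ ^ 2)).comp_hasFDerivAt z h1
  refine h2.congr_fderiv ?_
  ext v
  simp [paraboloid]
  ring

theorem integral_paraboloid_pow_pos (k : ℕ) (hk : k ≠ 0) :
    0 < ∫ z : EuclideanSpace ℝ (Fin N), 𝔮 z ^ k := by
  have hc : Continuous (fun z : EuclideanSpace ℝ (Fin N) => 𝔮 z ^ k) := by fun_prop
  refine hc.integral_pos_of_hasCompactSupport_nonneg_nonzero ?_ ?_ (x := 0) ?_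
  · simpa using hasCompactSupport_mul_paraboloid_pow (N := N) (fun _ => 1) hk
  · intro z; exact pow_nonneg (paraboloid_nonneg z) k
  · simp [paraboloid]

section Smooth

variable {f : EuclideanSpace ℝ (Fin N) → ℝ}

theorem contDiff_fderiv_apply (hf : ContDiff ℝ 2 f) (v : EuclideanSpace ℝ (Fin N)) :
    ContDiff ℝ 1 (fun y => fderiv ℝ f y v) :=
  (hf.fderiv_right (m := 1) (by norm_num)).clm_apply contDiff_const

theorem continuous_lap (hf : ContDiff ℝ 2 f) : Continuous (lap f) := by
  unfold lap
  refine continuous_finsetSum _ fun i _ => ?_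
  exact ((contDiff_fderiv_apply hf _).continuous_fderiv (by norm_num)).clm_apply
    continuous_const

theorem integral_fderiv_radial (hf : ContDiff ℝ 2 f) (x : EuclideanSpace ℝ (Fin N)) (t : ℝ) :
    ∫ z, fderiv ℝ f (x + t • z) z * 𝔮 z ^ 2 =
      t / 6 * ∫ z, lap f (x + t • z) * 𝔮 z ^ 3 := by
  have hD : ∀ v, ContDiff ℝ 1 (fun y => fderiv ℝ f y v) := contDiff_fderiv_apply hf
  have hcD : ∀ v, Continuous (fun z => fderiv ℝ f (x + t • z) v) := fun v =>
    (hD v).continuous.comp (by fun_prop)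
  have hcDD : ∀ v w, Continuous (fun z => fderiv ℝ (fun y => fderiv ℝ f y v) (x + t • z) w) :=
    fun v w => (((hD v).continuous_fderiv (by norm_num)).clm_apply continuous_const).comp
      (g := fun y => fderiv ℝ (fun y => fderiv ℝ f y v) y w) (by fun_prop)
  have hz : ∀ i, Continuous (fun z : EuclideanSpace ℝ (Fin N) => z i) := fun i => by fun_prop
  have key : ∀ i : Fin N,
      ∫ z, z i * fderiv ℝ f (x + t • z) (EuclideanSpace.single i 1) * 𝔮 z ^ 2 =
      t / 6 * ∫ z, fderiv ℝ (fun y => fderiv ℝ f y (EuclideanSpace.single i 1)) (x + t • z)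
        (EuclideanSpace.single i 1) * 𝔮 z ^ 3 := by
    intro i
    set e : EuclideanSpace ℝ (Fin N) := EuclideanSpace.single i 1 with he
    have hg : ∀ z, HasFDerivAt (fun z => fderiv ℝ f (x + t • z) e)
        (t • fderiv ℝ (fun y => fderiv ℝ f y e) (x + t • z)) z := by
      intro z
      have h1 : HasFDerivAt (fun z : EuclideanSpace ℝ (Fin N) => x + t • z)
          (t • ContinuousLinearMap.id ℝ _) z :=
        ((hasFDerivAt_id z).const_smul t).const_add x
      have h2 := (((hD e).differentiable (by norm_num)) (x + t • z)).hasFDerivAt.comp z h1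
      refine h2.congr_fderiv ?_
      ext v
      simp
    have hq : ∀ z : EuclideanSpace ℝ (Fin N),
        fderiv ℝ (fun z => 𝔮 z ^ 3) z e = -6 * (z i * 𝔮 z ^ 2) := by
      intro z
      rw [(hasFDerivAt_paraboloid_pow_three z).fderiv]
      simp [he, EuclideanSpace.inner_single_right]
      ring
    have ibp := integral_mul_fderiv_eq_neg_fderiv_mul_of_integrable (μ := volume)
      (f := fun z => fderiv ℝ f (x + t • z) e) (g := fun z => 𝔮 z ^ 3) (v := e) ?_ ?_ ?_
      (fun z _ => (hg z).differentiableAt)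
      (fun z _ => (hasFDerivAt_paraboloid_pow_three z).differentiableAt)
    · have e1 : ∀ z, fderiv ℝ f (x + t • z) e * fderiv ℝ (fun z => 𝔮 z ^ 3) z e =
          -6 * (z i * fderiv ℝ f (x + t • z) e * 𝔮 z ^ 2) := by
        intro z; rw [hq]; ring
      have e2 : ∀ z, fderiv ℝ (fun z => fderiv ℝ f (x + t • z) e) z e * 𝔮 z ^ 3 =
          t * (fderiv ℝ (fun y => fderiv ℝ f y e) (x + t • z) e * 𝔮 z ^ 3) := by
        intro z; rw [(hg z).fderiv]; simp; ring
      simp_rw [e1, e2, integral_const_mul] at ibp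
      linarith
    · simp_rw [fun z => (hg z).fderiv]
      refine integrable_mul_paraboloid_pow ?_ (by norm_num)
      exact (hcDD e e).const_smul t
    · simp_rw [hq]
      have := integrable_mul_paraboloid_pow (k := 2)
        (((hcD e).mul (hz i)).const_mul (-6)) (by norm_num)
      refine this.congr (ae_of_all _ fun z => ?_)
      simp only [Pi.mul_apply]; ring
    · exact integrable_mul_paraboloid_pow (hcD e) (by norm_num)
  have expand : ∀ z : EuclideanSpace ℝ (Fin N), fderiv ℝ f (x + t • z) z =
      ∑ i, z i * fderiv ℝ f (x + t • z) (EuclideanSpace.single i 1) := by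
    intro z
    have := congrArg (fderiv ℝ f (x + t • z)) ((EuclideanSpace.basisFun (Fin N) ℝ).sum_repr z)
    rw [map_sum] at this
    simpa using this.symm
  simp_rw [expand, Finset.sum_mul]
  have hint : ∀ i : Fin N, Integrable
      fun z => z i * fderiv ℝ f (x + t • z) (EuclideanSpace.single i 1) * 𝔮 z ^ 2 := fun i =>
    integrable_mul_paraboloid_pow ((hz i).mul (hcD _)) (by norm_num)
  rw [integral_finsetSum _ fun i _ => hint i]
  simp_rw [key, lap, Finset.sum_mul]
  rw [integral_finsetSum _ fun i _ => integrable_mul_paraboloid_pow (hcDD _ _) (by norm_num),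
    Finset.mul_sum]

theorem hasDerivAt_weightedMean (hf : ContDiff ℝ 2 f) (x : EuclideanSpace ℝ (Fin N)) (t : ℝ) :
    HasDerivAt (fun t : ℝ => ∫ z, f (x + t • z) * 𝔮 z ^ 2)
      (t / 6 * ∫ z, lap f (x + t • z) * 𝔮 z ^ 3) t := by
  rw [← integral_fderiv_radial hf]
  have hF' : Continuous (fun p : ℝ × EuclideanSpace ℝ (Fin N) =>
      fderiv ℝ f (x + p.1 • p.2) p.2 * 𝔮 p.2 ^ 2) := by
    have : Continuous (fderiv ℝ f) := hf.continuous_fderiv (by norm_num)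
    fun_prop
  obtain ⟨C, hC⟩ := ((isCompact_closedBall t 1).prod
    (isCompact_closedBall (0 : EuclideanSpace ℝ (Fin N)) 1)).exists_bound_of_continuousOn
    hF'.continuousOn
  have hfc := hf.continuous
  refine (hasDerivAt_integral_of_dominated_loc_of_deriv_le
    (bound := (closedBall (0 : EuclideanSpace ℝ (Fin N)) 1).indicator fun _ => C)
    (F' := fun t z => fderiv ℝ f (x + t • z) z * 𝔮 z ^ 2)
    (closedBall_mem_nhds t one_pos) ?_ ?_ ?_ ?_ ?_ ?_).2
  · exact Eventually.of_forall fun s => by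
      have : Continuous fun z => f (x + s • z) * 𝔮 z ^ 2 := by fun_prop
      exact this.aestronglyMeasurable
  · exact integrable_mul_paraboloid_pow (by fun_prop) (by norm_num)
  · have : Continuous fun z => fderiv ℝ f (x + t • z) z * 𝔮 z ^ 2 :=
      hF'.comp (continuous_const.prodMk continuous_id)
    exact this.aestronglyMeasurable
  · refine ae_of_all _ fun z s hs => ?_
    by_cases hz : z ∈ closedBall (0 : EuclideanSpace ℝ (Fin N)) 1
    · rw [indicator_of_mem hz]
      exact hC (s, z) ⟨hs, hz⟩
    · rw [indicator_of_notMem hz]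
      have : 1 ≤ ‖z‖ := by
        simp only [mem_closedBall, dist_zero_right, not_le] at hz
        exact hz.le
      simp [paraboloid_eq_zero this]
  · exact (integrable_indicator_iff measurableSet_closedBall).2
      (integrableOn_const (isCompact_closedBall _ _).measure_lt_top.ne)
  · refine ae_of_all _ fun z s _ => ?_
    have h1 : HasDerivAt (fun s : ℝ => x + s • z) z s := by
      simpa using ((hasDerivAt_id s).smul_const z).const_add x
    have h2 : HasFDerivAt f (fderiv ℝ f (x + s • z)) (x + s • z) :=
      (hf.differentiable (by norm_num) _).hasFDerivAt
    exact (h2.comp_hasDerivAt s h1).mul_const _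

theorem integral_mul_paraboloid_mono {g k : EuclideanSpace ℝ (Fin N) → ℝ} (hg : Continuous g)
    (hk : Continuous k) {m n : ℕ} (hm : m ≠ 0) (hn : n ≠ 0)
    (h : ∀ z, ‖z‖ < 1 → g z * 𝔮 z ^ m ≤ k z * 𝔮 z ^ n) :
    ∫ z, g z * 𝔮 z ^ m ≤ ∫ z, k z * 𝔮 z ^ n := by
  refine integral_mono (integrable_mul_paraboloid_pow hg hm)
    (integrable_mul_paraboloid_pow hk hn) fun z => ?_
  rcases lt_or_ge ‖z‖ 1 with hz | hz
  · exact h z hz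
  · simp [paraboloid_eq_zero hz, hm, hn]

theorem add_smul_mem_ball {x z : EuclideanSpace ℝ (Fin N)} {r t : ℝ} (ht : 0 ≤ t) (htr : t ≤ r)
    (hr : 0 < r) (hz : ‖z‖ < 1) : x + t • z ∈ ball x r := by
  rw [mem_ball, dist_eq_norm, add_sub_cancel_left, norm_smul, Real.norm_of_nonneg ht]
  nlinarith [norm_nonneg z]

/-- Mean value inequality for subsolutions of `Δ f + K f = 0`. -/
theorem le_weightedMean_of_neg_mul_le_lap (hf : ContDiff ℝ 2 f) {x : EuclideanSpace ℝ (Fin N)}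
    {r K : ℝ} (hr : 0 < r) (hK : 0 ≤ K) (hf0 : ∀ y ∈ ball x r, 0 ≤ f y)
    (hlap : ∀ y ∈ ball x r, -K * f y ≤ lap f y) :
    f x * ∫ z : EuclideanSpace ℝ (Fin N), 𝔮 z ^ 2 ≤
      Real.exp (K / 12 * r ^ 2) * ∫ z, f (x + r • z) * 𝔮 z ^ 2 := by
  have hd : ∀ t, HasDerivAt
      (fun t : ℝ => Real.exp (K / 12 * t ^ 2) * ∫ z, f (x + t • z) * 𝔮 z ^ 2)
      (Real.exp (K / 12 * t ^ 2) * (K / 12 * (2 * t)) * (∫ z, f (x + t • z) * 𝔮 z ^ 2) +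
        Real.exp (K / 12 * t ^ 2) * (t / 6 * ∫ z, lap f (x + t • z) * 𝔮 z ^ 3)) t := fun t => by
    have h1 : HasDerivAt (fun t : ℝ => K / 12 * t ^ 2) (K / 12 * (2 * t)) t := by
      simpa using (hasDerivAt_pow 2 t).const_mul (K / 12)
    exact h1.exp.mul (hasDerivAt_weightedMean hf x t)
  have hfc := hf.continuous
  have hlc := continuous_lap hf
  have hmono := monotoneOn_of_deriv_nonneg (convex_Icc 0 r)
    (fun t _ => (hd t).continuousAt.continuousWithinAt)
    (fun t _ => (hd t).differentiableAt.differentiableWithinAt) fun t ht => by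
      rw [interior_Icc] at ht
      rw [(hd t).deriv]
      have key : ∫ z, (-K * f (x + t • z)) * 𝔮 z ^ 2 ≤ ∫ z, lap f (x + t • z) * 𝔮 z ^ 3 := by
        refine integral_mul_paraboloid_mono (by fun_prop) (by fun_prop) (by norm_num)
          (by norm_num) fun z hz => ?_
        have hy := add_smul_mem_ball (x := x) ht.1.le ht.2.le hr hz
        have h1 := hf0 _ hy
        have h2 := hlap _ hy
        have hq0 := paraboloid_nonneg z
        have hq1 := paraboloid_le_one z
        have hq3 : 𝔮 z ^ 3 ≤ 𝔮 z ^ 2 := pow_le_pow_of_le_one hq0 hq1 (by norm_num)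
        calc (-K * f (x + t • z)) * 𝔮 z ^ 2 ≤ (-K * f (x + t • z)) * 𝔮 z ^ 3 :=
              mul_le_mul_of_nonpos_left hq3 (by nlinarith)
          _ ≤ _ := mul_le_mul_of_nonneg_right h2 (by positivity)
      simp_rw [mul_assoc, integral_const_mul] at key
      have he := Real.exp_pos (K / 12 * t ^ 2)
      have ht0 := ht.1
      have : 0 ≤ Real.exp (K / 12 * t ^ 2) * (t / 6) *
          ((∫ z, lap f (x + t • z) * 𝔮 z ^ 3) - -K * ∫ z, f (x + t • z) * 𝔮 z ^ 2) :=
        mul_nonneg (by positivity) (by linarith)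
      linarith
  have := hmono (left_mem_Icc.2 hr.le) (right_mem_Icc.2 hr.le) hr.le
  simpa [integral_const_mul] using this

/-- Mean value inequality for supersolutions of `Δ f = K f`. -/
theorem weightedMean_le_of_lap_le_mul (hf : ContDiff ℝ 2 f) {x : EuclideanSpace ℝ (Fin N)}
    {r K : ℝ} (hr : 0 < r) (hK : 0 ≤ K) (hf0 : ∀ y ∈ ball x r, 0 ≤ f y)
    (hlap : ∀ y ∈ ball x r, lap f y ≤ K * f y) :
    Real.exp (-K / 12 * r ^ 2) * ∫ z, f (x + r • z) * 𝔮 z ^ 2 ≤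
      f x * ∫ z : EuclideanSpace ℝ (Fin N), 𝔮 z ^ 2 := by
  have hd : ∀ t, HasDerivAt
      (fun t : ℝ => Real.exp (-K / 12 * t ^ 2) * ∫ z, f (x + t • z) * 𝔮 z ^ 2)
      (Real.exp (-K / 12 * t ^ 2) * (-K / 12 * (2 * t)) * (∫ z, f (x + t • z) * 𝔮 z ^ 2) +
        Real.exp (-K / 12 * t ^ 2) * (t / 6 * ∫ z, lap f (x + t • z) * 𝔮 z ^ 3)) t := fun t => by
    have h1 : HasDerivAt (fun t : ℝ => -K / 12 * t ^ 2) (-K / 12 * (2 * t)) t := by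
      simpa using (hasDerivAt_pow 2 t).const_mul (-K / 12)
    exact h1.exp.mul (hasDerivAt_weightedMean hf x t)
  have hfc := hf.continuous
  have hlc := continuous_lap hf
  have hanti := antitoneOn_of_deriv_nonpos (convex_Icc 0 r)
    (fun t _ => (hd t).continuousAt.continuousWithinAt)
    (fun t _ => (hd t).differentiableAt.differentiableWithinAt) fun t ht => by
      rw [interior_Icc] at ht
      rw [(hd t).deriv]
      have key : ∫ z, lap f (x + t • z) * 𝔮 z ^ 3 ≤ ∫ z, (K * f (x + t • z)) * 𝔮 z ^ 2 := by
        refine integral_mul_paraboloid_mono (by fun_prop) (by fun_prop) (by norm_num)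
          (by norm_num) fun z hz => ?_
        have hy := add_smul_mem_ball (x := x) ht.1.le ht.2.le hr hz
        have h1 := hf0 _ hy
        have h2 := hlap _ hy
        have hq0 := paraboloid_nonneg z
        have hq1 := paraboloid_le_one z
        have hq3 : 𝔮 z ^ 3 ≤ 𝔮 z ^ 2 := pow_le_pow_of_le_one hq0 hq1 (by norm_num)
        calc lap f (x + t • z) * 𝔮 z ^ 3 ≤ (K * f (x + t • z)) * 𝔮 z ^ 3 :=
              mul_le_mul_of_nonneg_right h2 (by positivity)
          _ ≤ _ := mul_le_mul_of_nonneg_left hq3 (by positivity)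
      simp_rw [mul_assoc, integral_const_mul] at key
      have he := Real.exp_pos (-K / 12 * t ^ 2)
      have ht0 := ht.1
      have : 0 ≤ Real.exp (-K / 12 * t ^ 2) * (t / 6) *
          ((K * ∫ z, f (x + t • z) * 𝔮 z ^ 2) - ∫ z, lap f (x + t • z) * 𝔮 z ^ 3) :=
        mul_nonneg (by positivity) (by linarith)
      linarith
  have := hanti (left_mem_Icc.2 hr.le) (right_mem_Icc.2 hr.le) hr.le
  simpa [integral_const_mul] using this

/-- Lower bound at the center for a nonnegative function with `-Δ f ≥ B`. -/
theorem le_apply_center_of_lap_le_neg (hf : ContDiff ℝ 2 f) {x : EuclideanSpace ℝ (Fin N)}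
    {r B : ℝ} (hr : 0 < r) (hf0 : ∀ y ∈ ball x r, 0 ≤ f y)
    (hlap : ∀ y ∈ ball x r, lap f y ≤ -B) :
    B / 12 * r ^ 2 * ∫ z : EuclideanSpace ℝ (Fin N), 𝔮 z ^ 3 ≤
      f x * ∫ z : EuclideanSpace ℝ (Fin N), 𝔮 z ^ 2 := by
  set J := ∫ z : EuclideanSpace ℝ (Fin N), 𝔮 z ^ 3 with hJ
  have hd : ∀ t, HasDerivAt
      (fun t : ℝ => (∫ z, f (x + t • z) * 𝔮 z ^ 2) + B / 12 * J * t ^ 2)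
      ((t / 6 * ∫ z, lap f (x + t • z) * 𝔮 z ^ 3) + B / 12 * J * (2 * t)) t := fun t => by
    have h1 : HasDerivAt (fun t : ℝ => B / 12 * J * t ^ 2) (B / 12 * J * (2 * t)) t := by
      simpa using (hasDerivAt_pow 2 t).const_mul (B / 12 * J)
    exact (hasDerivAt_weightedMean hf x t).add h1
  have hfc := hf.continuous
  have hlc := continuous_lap hf
  have hanti := antitoneOn_of_deriv_nonpos (convex_Icc 0 r)
    (fun t _ => (hd t).continuousAt.continuousWithinAt)
    (fun t _ => (hd t).differentiableAt.differentiableWithinAt) fun t ht => by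
      rw [interior_Icc] at ht
      rw [(hd t).deriv]
      have key : ∫ z, lap f (x + t • z) * 𝔮 z ^ 3 ≤
          ∫ z : EuclideanSpace ℝ (Fin N), -B * 𝔮 z ^ 3 := by
        refine integral_mul_paraboloid_mono (by fun_prop) (by fun_prop) (by norm_num)
          (by norm_num) fun z hz => ?_
        exact mul_le_mul_of_nonneg_right
          (hlap _ (add_smul_mem_ball ht.1.le ht.2.le hr hz)) (pow_nonneg (paraboloid_nonneg z) 3)
      rw [integral_const_mul, ← hJ] at key
      have ht0 := ht.1
      have : 0 ≤ t / 6 * (-B * J - ∫ z, lap f (x + t • z) * 𝔮 z ^ 3) :=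
        mul_nonneg (by positivity) (by linarith)
      linarith
  have h1 := hanti (left_mem_Icc.2 hr.le) (right_mem_Icc.2 hr.le) hr.le
  have h2 : ∫ z : EuclideanSpace ℝ (Fin N), (0 : ℝ) * 𝔮 z ^ 2 ≤ ∫ z, f (x + r • z) * 𝔮 z ^ 2 := by
    refine integral_mul_paraboloid_mono (by fun_prop) (by fun_prop) (by norm_num)
      (by norm_num) fun z hz => ?_
    exact mul_le_mul_of_nonneg_right
      (hf0 _ (add_smul_mem_ball hr.le le_rfl hr hz)) (pow_nonneg (paraboloid_nonneg z) 2)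
  simp [integral_const_mul] at h1 h2
  linarith

theorem weightedMean_eq (x : EuclideanSpace ℝ (Fin N)) {r : ℝ} (hr : 0 < r) :
    ∫ z, f (x + r • z) * 𝔮 z ^ 2 = (r ^ N)⁻¹ * ∫ y, f y * 𝔮 (r⁻¹ • (y - x)) ^ 2 := by
  have h1 : ∀ z : EuclideanSpace ℝ (Fin N), f (x + r • z) * 𝔮 z ^ 2 =
      (fun w => f (x + w) * 𝔮 (r⁻¹ • w) ^ 2) (r • z) := by
    intro z
    simp [smul_smul, inv_mul_cancel₀ hr.ne']
  simp_rw [h1]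
  rw [Measure.integral_comp_smul_of_nonneg volume
    (fun w => f (x + w) * 𝔮 (r⁻¹ • w) ^ 2) r (hR := hr.le)]
  rw [← integral_add_left_eq_self (fun y => f y * 𝔮 (r⁻¹ • (y - x)) ^ 2) x]
  simp

theorem weightedMean_le (hf : Continuous f) {x : EuclideanSpace ℝ (Fin N)} {r : ℝ} (hr : 0 < r)
    (hf0 : ∀ y ∈ ball x r, 0 ≤ f y) :
    ∫ z, f (x + r • z) * 𝔮 z ^ 2 ≤ (r ^ N)⁻¹ * ∫ y in ball x r, f y := by
  rw [weightedMean_eq x hr, ← integral_indicator measurableSet_ball]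
  refine mul_le_mul_of_nonneg_left (integral_mono_of_nonneg ?_ ?_ ?_) (by positivity)
  · refine ae_of_all _ fun y => ?_
    by_cases hy : y ∈ ball x r
    · exact mul_nonneg (hf0 y hy) (by positivity)
    · have : 1 ≤ ‖r⁻¹ • (y - x)‖ := by
        rw [norm_smul, Real.norm_of_nonneg (by positivity), ← dist_eq_norm]
        rw [mem_ball, not_lt] at hy
        rw [inv_mul_eq_div, one_le_div hr]; exact hy
      simp [paraboloid_eq_zero this]
  · rw [integrable_indicator_iff measurableSet_ball]
    exact (hf.continuousOn.integrableOn_compact (isCompact_closedBall x r)).mono_set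
      ball_subset_closedBall
  · refine ae_of_all _ fun y => ?_
    by_cases hy : y ∈ ball x r
    · rw [indicator_of_mem hy]
      exact mul_le_of_le_one_right (hf0 y hy)
        (pow_le_one₀ (paraboloid_nonneg _) (paraboloid_le_one _))
    · have : 1 ≤ ‖r⁻¹ • (y - x)‖ := by
        rw [norm_smul, Real.norm_of_nonneg (by positivity), ← dist_eq_norm]
        rw [mem_ball, not_lt] at hy
        rw [inv_mul_eq_div, one_le_div hr]; exact hy
      simp [paraboloid_eq_zero this, indicator_of_notMem hy]

theorem setIntegral_le_weightedMean (hf : Continuous f) {x : EuclideanSpace ℝ (Fin N)} {r θ : ℝ}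
    (hr : 0 < r) (hθ : θ ∈ Ioo (0 : ℝ) 1) {S : Set (EuclideanSpace ℝ (Fin N))}
    (hS : MeasurableSet S) (hSx : S ⊆ closedBall x (θ * r)) (hf0 : ∀ y ∈ ball x r, 0 ≤ f y) :
    (1 - θ ^ 2) ^ 2 * (r ^ N)⁻¹ * ∫ y in S, f y ≤ ∫ z, f (x + r • z) * 𝔮 z ^ 2 := by
  obtain ⟨hθ0, hθ1⟩ := hθ
  have hpos : 0 ≤ 1 - θ ^ 2 := by nlinarith
  rw [weightedMean_eq x hr, mul_comm ((1 - θ ^ 2) ^ 2), mul_assoc, ← integral_const_mul,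
    ← integral_indicator hS]
  refine mul_le_mul_of_nonneg_left (integral_mono_of_nonneg ?_ ?_ ?_) (by positivity)
  · refine ae_of_all _ fun y => ?_
    by_cases hy : y ∈ S
    · rw [indicator_of_mem hy]
      refine mul_nonneg (by positivity) (hf0 y ?_)
      exact closedBall_subset_ball (by nlinarith) (hSx hy)
    · simp [indicator_of_notMem hy]
  · have hcs : HasCompactSupport (fun y => f y * 𝔮 (r⁻¹ • (y - x)) ^ 2) := by
      refine HasCompactSupport.intro (isCompact_closedBall x r) fun y hy => ?_
      have : 1 ≤ ‖r⁻¹ • (y - x)‖ := by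
        rw [norm_smul, Real.norm_of_nonneg (by positivity), ← dist_eq_norm]
        rw [mem_closedBall, not_le] at hy
        rw [inv_mul_eq_div, one_le_div hr]; exact hy.le
      simp [paraboloid_eq_zero this]
    have hc : Continuous (fun y => f y * 𝔮 (r⁻¹ • (y - x)) ^ 2) := by fun_prop
    exact hc.integrable_of_hasCompactSupport hcs
  · refine ae_of_all _ fun y => ?_
    by_cases hy : y ∈ S
    · rw [indicator_of_mem hy]
      have hyr : y ∈ ball x r := closedBall_subset_ball (by nlinarith) (hSx hy)
      have hn : ‖r⁻¹ • (y - x)‖ ≤ θ := by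
        rw [norm_smul, Real.norm_of_nonneg (by positivity), ← dist_eq_norm, inv_mul_eq_div,
          div_le_iff₀ hr]
        exact hSx hy
      have hq : 1 - θ ^ 2 ≤ 𝔮 (r⁻¹ • (y - x)) :=
        le_trans (by gcongr) (le_max_right _ _)
      rw [mul_comm]
      exact mul_le_mul_of_nonneg_left (by gcongr) (hf0 y hyr)
    · rw [indicator_of_notMem hy]
      by_cases hyr : y ∈ ball x r
      · exact mul_nonneg (hf0 y hyr) (by positivity)
      · have : 1 ≤ ‖r⁻¹ • (y - x)‖ := by
          rw [norm_smul, Real.norm_of_nonneg (by positivity), ← dist_eq_norm]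
          rw [mem_ball, not_lt] at hyr
          rw [inv_mul_eq_div, one_le_div hr]; exact hyr
        simp [paraboloid_eq_zero this]

theorem lap_exp_mul_add (hf : ContDiff ℝ 2 f) (a b : ℝ) (x : EuclideanSpace ℝ (Fin N)) :
    lap (fun y => Real.exp (a * f y) + b) x =
      Real.exp (a * f x) * (a * lap f x + a ^ 2 * ‖gradient f x‖ ^ 2) := by
  have hdf : ∀ y, HasFDerivAt (fun y => Real.exp (a * f y) + b)
      (Real.exp (a * f y) • a • fderiv ℝ f y) y := fun y =>
    ((hf.differentiable (by norm_num) y).hasFDerivAt.const_mul a).exp.add_const b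
  have hgrad : ‖gradient f x‖ ^ 2 =
      ∑ i : Fin N, fderiv ℝ f x (EuclideanSpace.single i 1) ^ 2 := by
    rw [EuclideanSpace.norm_sq_eq]
    refine Finset.sum_congr rfl fun i _ => ?_
    have : inner ℝ (gradient f x) (EuclideanSpace.single i (1 : ℝ)) =
        fderiv ℝ f x (EuclideanSpace.single i 1) := by
      simp [gradient]
    rw [← this, EuclideanSpace.inner_single_right]
    simp
  have hi : ∀ i : Fin N, fderiv ℝ (fun y => fderiv ℝ (fun y => Real.exp (a * f y) + b) y
      (EuclideanSpace.single i 1)) x (EuclideanSpace.single i 1) =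
      Real.exp (a * f x) * (a * fderiv ℝ (fun y => fderiv ℝ f y (EuclideanSpace.single i 1)) x
        (EuclideanSpace.single i 1) + a ^ 2 * fderiv ℝ f x (EuclideanSpace.single i 1) ^ 2) := by
    intro i
    set e : EuclideanSpace ℝ (Fin N) := EuclideanSpace.single i 1
    have h1 : (fun y => fderiv ℝ (fun y => Real.exp (a * f y) + b) y e) =
        fun y => Real.exp (a * f y) * (a * fderiv ℝ f y e) := by
      funext y; rw [(hdf y).fderiv]; simp
    have h2 := ((contDiff_fderiv_apply hf e).differentiable (by norm_num) x).hasFDerivAt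
    have h3 := ((hf.differentiable (by norm_num) x).hasFDerivAt.const_mul a).exp.mul
      (h2.const_mul a)
    rw [h1]
    refine (congrArg (fun L => L e) h3.fderiv).trans ?_
    simp
    ring
  simp_rw [lap, hi, hgrad, mul_add, Finset.mul_sum, Finset.sum_add_distrib]

end Smooth

theorem exists_contDiff_eqOn_ball {u : EuclideanSpace ℝ (Fin N) → ℝ}
    {c : EuclideanSpace ℝ (Fin N)} {r ρ : ℝ} (hr : 0 < r) (hrρ : r < ρ)
    (hu : ContDiffOn ℝ 2 u (ball c ρ)) :
    ∃ v : EuclideanSpace ℝ (Fin N) → ℝ, ContDiff ℝ 2 v ∧ EqOn v u (ball c r) := by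
  let χ : ContDiffBump c := ⟨r, (r + ρ) / 2, hr, by linarith⟩
  refine ⟨fun y => χ y * u y, contDiff_iff_contDiffAt.2 fun y => ?_, fun y hy => ?_⟩
  · by_cases hy : y ∈ ball c ρ
    · exact χ.contDiff.contDiffAt.mul (hu.contDiffAt (isOpen_ball.mem_nhds hy))
    · have hy' : y ∈ (closedBall c ((r + ρ) / 2))ᶜ := by
        simp only [mem_ball, not_lt] at hy
        simp only [mem_compl_iff, mem_closedBall, not_le]
        linarith
      refine (contDiffAt_const (c := (0 : ℝ))).congr_of_eventuallyEq ?_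
      filter_upwards [isClosed_closedBall.isOpen_compl.mem_nhds hy'] with z hz
      have : χ z = 0 := by
        apply χ.zero_of_le_dist
        simp only [mem_compl_iff, mem_closedBall, not_le] at hz
        exact hz.le
      simp [this]
  · have : χ y = 1 := χ.one_of_mem_closedBall (ball_subset_closedBall hy)
    simp [this]

theorem lap_congr {u v : EuclideanSpace ℝ (Fin N) → ℝ} {x : EuclideanSpace ℝ (Fin N)}
    (h : u =ᶠ[𝓝 x] v) : lap u x = lap v x := by
  unfold lap
  refine Finset.sum_congr rfl fun i _ => ?_
  have : (fun y => fderiv ℝ u y (EuclideanSpace.single i 1)) =ᶠ[𝓝 x]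
      fun y => fderiv ℝ v y (EuclideanSpace.single i 1) := by
    filter_upwards [h.fderiv (𝕜 := ℝ)] with y hy
    rw [hy]
  rw [this.fderiv_eq]

theorem exists_mul_setIntegral_le (xbar : EuclideanSpace ℝ (Fin N)) {R K : ℝ} (hR : 0 < R)
    (hK : 0 ≤ K) :
    ∃ c : ℝ, 0 < c ∧ ∀ W : EuclideanSpace ℝ (Fin N) → ℝ, ContDiff ℝ 2 W →
      (∀ y ∈ ball xbar (15 / 4 * R), 0 ≤ W y) →
      (∀ y ∈ ball xbar (15 / 4 * R), lap W y ≤ K * W y) →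
      ∀ x ∈ ball xbar R, ∀ S : Set (EuclideanSpace ℝ (Fin N)), MeasurableSet S →
        S ⊆ ball xbar (3 / 2 * R) → c * ∫ y in S, W y ≤ W x := by
  set J := ∫ z : EuclideanSpace ℝ (Fin N), 𝔮 z ^ 2 with hJ
  have hJ0 : 0 < J := integral_paraboloid_pow_pos 2 (by norm_num)
  set r := 11 / 4 * R with hr
  have hr0 : 0 < r := by positivity
  set E := Real.exp (-K / 12 * r ^ 2) with hE
  have hE0 : 0 < E := Real.exp_pos _
  refine ⟨E * ((1 - (10 / 11 : ℝ) ^ 2) ^ 2 * (r ^ N)⁻¹) / J, by positivity, ?_⟩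
  intro W hW hW0 hlap x hx S hS hSb
  have hsub : ball x r ⊆ ball xbar (15 / 4 * R) := by
    refine ball_subset_ball' ?_
    have := mem_ball.1 hx
    linarith
  have hSx : S ⊆ closedBall x (10 / 11 * r) := by
    intro y hy
    have h1 := mem_ball.1 (hSb hy)
    have h2 := mem_ball.1 hx
    have h3 := dist_triangle_right y x xbar
    rw [mem_closedBall]
    linarith
  have h1 := setIntegral_le_weightedMean hW.continuous hr0 (θ := 10 / 11)
    ⟨by norm_num, by norm_num⟩ hS hSx fun y hy => hW0 y (hsub hy)
  have h2 := weightedMean_le_of_lap_le_mul hW hr0 hK (fun y hy => hW0 y (hsub hy))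
    fun y hy => hlap y (hsub hy)
  rw [div_mul_eq_mul_div, div_le_iff₀ hJ0, mul_assoc]
  exact (mul_le_mul_of_nonneg_left h1 hE0.le).trans h2

/-- A positive supersolution cannot satisfy `-Δ W ≥ A W` on a small ball if `A` is large. -/
theorem exists_not_forall_lap_le_neg_mul (xbar y₀ : EuclideanSpace ℝ (Fin N)) {R K s : ℝ}
    (hR : 0 < R) (hK : 0 ≤ K) (hs : 0 < s) (hy₀ : ball y₀ s ⊆ ball xbar R) :
    ∃ A : ℝ, 0 < A ∧ ∀ W : EuclideanSpace ℝ (Fin N) → ℝ, ContDiff ℝ 2 W →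
      (∀ y ∈ ball xbar (15 / 4 * R), 1 ≤ W y) →
      (∀ y ∈ ball xbar (15 / 4 * R), lap W y ≤ K * W y) →
      ¬ ∀ y ∈ ball y₀ s, lap W y ≤ -(A * W y) := by
  obtain ⟨c, hc, hcW⟩ := exists_mul_setIntegral_le xbar hR hK
  set J := ∫ z : EuclideanSpace ℝ (Fin N), 𝔮 z ^ 2 with hJ
  have hJ0 : 0 < J := integral_paraboloid_pow_pos 2 (by norm_num)
  set L := ∫ z : EuclideanSpace ℝ (Fin N), 𝔮 z ^ 3 with hL
  have hL0 : 0 < L := integral_paraboloid_pow_pos 3 (by norm_num)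
  set S := ball y₀ (s / 2) with hS
  set V := volume.real S with hV
  have hV0 : 0 < V := by
    rw [hV, measureReal_def]
    exact ENNReal.toReal_pos (measure_ball_pos volume y₀ (by positivity)).ne'
      measure_ball_lt_top.ne
  set k := 1 / 12 * (s / 2) ^ 2 * L / J with hk
  have hk0 : 0 < k := by positivity
  refine ⟨2 / (c * k * V), by positivity, fun W hW hW1 hlap hneg => ?_⟩
  set A := 2 / (c * k * V) with hA
  have hA0 : 0 < A := by positivity
  have hsub : ball xbar R ⊆ ball xbar (15 / 4 * R) := ball_subset_ball (by linarith)
  set m := sInf (W '' ball xbar R) with hm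
  have hne : (W '' ball xbar R).Nonempty := ⟨_, mem_image_of_mem W (mem_ball_self hR)⟩
  have hm1 : 1 ≤ m := le_csInf hne (by rintro _ ⟨y, hy, rfl⟩; exact hW1 y (hsub hy))
  have hbdd : BddBelow (W '' ball xbar R) :=
    ⟨1, by rintro _ ⟨y, hy, rfl⟩; exact hW1 y (hsub hy)⟩
  have hmW : ∀ y ∈ ball xbar R, m ≤ W y := fun y hy => csInf_le hbdd (mem_image_of_mem W hy)
  have hSs : ∀ z ∈ S, ball z (s / 2) ⊆ ball y₀ s := fun z hz =>
    ball_subset_ball' (by have := mem_ball.1 hz; linarith)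
  have hlow : ∀ z ∈ S, A * m * k ≤ W z := by
    intro z hz
    have h1 := le_apply_center_of_lap_le_neg hW (x := z) (r := s / 2) (B := A * m)
      (by positivity) (fun y hy => by linarith [hW1 y (hsub (hy₀ (hSs z hz hy)))])
      fun y hy => by
        have h2 := hneg y (hSs z hz hy)
        have h3 := hmW y (hy₀ (hSs z hz hy))
        have := mul_le_mul_of_nonneg_left h3 hA0.le
        linarith
    rw [← hL, ← hJ, ← div_le_iff₀ hJ0] at h1
    refine le_trans (le_of_eq ?_) h1
    rw [hk]; ring
  have hSR : S ⊆ ball xbar R := fun z hz => hy₀ (hSs z hz (mem_ball_self (by positivity)))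
  have hint : A * m * k * V ≤ ∫ y in S, W y := by
    have hI : IntegrableOn W S := (hW.continuous.continuousOn.integrableOn_compact
      (isCompact_closedBall y₀ (s / 2))).mono_set ball_subset_closedBall
    have := setIntegral_mono_on (integrableOn_const (C := A * m * k) measure_ball_lt_top.ne) hI
      measurableSet_ball hlow
    rw [setIntegral_const, smul_eq_mul] at this
    linarith
  have hall : 2 * m ≤ m := by
    refine le_csInf hne ?_
    rintro _ ⟨x, hx, rfl⟩
    refine le_trans ?_ (hcW W hW (fun y hy => by linarith [hW1 y hy]) hlap x hx S
      measurableSet_ball (hSR.trans (ball_subset_ball (by linarith))))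
    refine le_trans (le_of_eq ?_) (mul_le_mul_of_nonneg_left hint hc.le)
    rw [hA]; field_simp
  linarith

theorem exists_bound_of_exp_le_pow {κ C a b g : ℝ} (hκ : 0 < κ) (ha : 0 ≤ a)
    (hb : 0 ≤ b) (hg : 0 ≤ g) (n : ℕ) :
    ∃ U : ℝ, 0 ≤ U ∧ ∀ s : ℝ, 0 ≤ s → Real.exp (κ * s) ≤ C * (a * (s + g) + b) ^ n → s ≤ U := by
  set D := |C| * (a + a * g + b) ^ n with hD
  have hlo := (isLittleO_pow_exp_pos_mul_atTop (k := n) hκ).def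
    (c := 1 / (2 * (D + 1))) (by positivity)
  obtain ⟨U, hU⟩ := eventually_atTop.1 hlo
  refine ⟨max U 1, by positivity, fun s hs hexp => ?_⟩
  by_contra! hlt
  have hs1 : 1 < s := (le_max_right _ _).trans_lt hlt
  have h1 := hU s ((le_max_left _ _).trans hlt.le)
  rw [Real.norm_of_nonneg (by positivity), Real.norm_of_nonneg (Real.exp_pos _).le] at h1
  have h2 : C * (a * (s + g) + b) ^ n ≤ D * s ^ n := by
    have h3 : a * (s + g) + b ≤ (a + a * g + b) * s := by
      nlinarith [mul_nonneg (mul_nonneg ha hg) (sub_nonneg.2 hs1.le),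
        mul_nonneg hb (sub_nonneg.2 hs1.le)]
    calc C * (a * (s + g) + b) ^ n ≤ |C| * ((a + a * g + b) * s) ^ n := by
          gcongr
          exact le_abs_self C
      _ = D * s ^ n := by rw [hD, mul_pow]; ring
  have hD0 : 0 ≤ D := by positivity
  have he := Real.exp_pos (κ * s)
  have h4 : D * s ^ n ≤ D * (1 / (2 * (D + 1)) * Real.exp (κ * s)) :=
    mul_le_mul_of_nonneg_left h1 hD0
  have h5 : D * (1 / (2 * (D + 1))) < 1 := by
    rw [mul_one_div, div_lt_one (by positivity)]; linarith
  have h6 : D * (1 / (2 * (D + 1))) * Real.exp (κ * s) < 1 * Real.exp (κ * s) :=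
    mul_lt_mul_of_pos_right h5 he
  linarith

/-- Local maximum principle with a logarithmically growing potential: an exponential moment
bounds `u` from above on a smaller ball. -/
theorem exists_bound_of_setIntegral_exp_le (hN : N ≠ 0) (xbar : EuclideanSpace ℝ (Fin N))
    {R κ ν a b C : ℝ} (hR : 0 < R) (hκ : 0 < κ) (hκν : κ ≤ ν) (ha : 0 ≤ a) (hb : 1 ≤ b)
    (hC : 0 ≤ C) :
    ∃ M : ℝ, ∀ u : EuclideanSpace ℝ (Fin N) → ℝ, ContDiff ℝ 2 u →
      (∀ y ∈ ball xbar (3 / 2 * R), -((a * max 0 (u y) + b) * Real.exp (ν * u y)) ≤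
        lap (fun y => Real.exp (ν * u y)) y) →
      ∫ y in ball xbar (3 / 2 * R), Real.exp (κ * u y) ≤ C →
      ∀ x ∈ ball xbar R, u x ≤ M := by
  set J := ∫ z : EuclideanSpace ℝ (Fin N), 𝔮 z ^ 2 with hJ
  have hJ0 : 0 < J := integral_paraboloid_pow_pos 2 (by norm_num)
  set g := Real.log (2 ^ N) / κ with hg
  have hg0 : 0 ≤ g := div_nonneg (Real.log_nonneg (one_le_pow₀ (by norm_num))) hκ.le
  set C₃ := Real.exp 1 * Real.exp ((ν - κ) * g) * C / J with hC₃
  have hC₃0 : 0 ≤ C₃ := by positivity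
  obtain ⟨U, hU0, hU⟩ := exists_bound_of_exp_le_pow (C := C₃) hκ ha (zero_le_one.trans hb) hg0 N
  set Q := max C₃ (Real.exp (κ * U) * R ^ N) with hQ
  have hQ0 : 0 < Q := lt_max_of_lt_right (by positivity)
  refine ⟨Real.log (2 ^ N * Q / (R / 2) ^ N) / κ, fun u hu hlap hint x hx => ?_⟩
  have huc := hu.continuous
  set d : EuclideanSpace ℝ (Fin N) → ℝ := fun y => 3 / 2 * R - dist y xbar with hd
  have hqc : Continuous fun y => Real.exp (κ * u y) * d y ^ N := by fun_prop
  obtain ⟨p, hp, hmax⟩ := (isCompact_closedBall xbar (3 / 2 * R)).exists_isMaxOn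
    ⟨xbar, mem_closedBall_self (by positivity)⟩ hqc.continuousOn
  have hdp : 0 < d p := by
    have h0 : 0 ≤ d p := sub_nonneg.2 hp
    rcases h0.lt_or_eq with h | h
    · exact h
    · have := hmax (mem_closedBall_self (x := xbar) (ε := 3 / 2 * R) (by positivity))
      simp only [mem_ofPred_eq, ← h, zero_pow hN, mul_zero] at this
      have hpos : 0 < Real.exp (κ * u xbar) * d xbar ^ N := by
        have : 0 < d xbar := by simp [hd]; positivity
        positivity
      linarith
  set ρ := d p / 2 with hρ
  have hρ0 : 0 < ρ := by positivity
  have hρd : d p = 2 * ρ := by rw [hρ]; ring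
  have hsub : ball p ρ ⊆ ball xbar (3 / 2 * R) := by
    refine ball_subset_ball' ?_
    have : 3 / 2 * R - dist p xbar = 2 * ρ := hρd
    linarith
  have hup : ∀ y ∈ ball p ρ, u y ≤ u p + g := by
    intro y hy
    have h1 : ρ ≤ d y := by
      have h2 := dist_triangle y p xbar
      have h3 := mem_ball.1 hy
      have : 3 / 2 * R - dist p xbar = 2 * ρ := hρd
      simp only [hd]; linarith
    have h2 : Real.exp (κ * u y) * d y ^ N ≤ Real.exp (κ * u p) * d p ^ N :=
      hmax (ball_subset_closedBall (hsub hy))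
    have h3 : Real.exp (κ * u y) * ρ ^ N ≤ Real.exp (κ * u p) * 2 ^ N * ρ ^ N := by
      calc Real.exp (κ * u y) * ρ ^ N ≤ Real.exp (κ * u y) * d y ^ N := by gcongr
        _ ≤ _ := h2
        _ = _ := by rw [hρd, mul_pow]; ring
    have h4 := le_of_mul_le_mul_right h3 (by positivity)
    have h5 : Real.exp (κ * u p) * 2 ^ N = Real.exp (κ * (u p + g)) := by
      rw [mul_add, Real.exp_add, hg, mul_div_cancel₀ _ hκ.ne', Real.exp_log (by positivity)]
    rw [h5, Real.exp_le_exp] at h4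
    exact le_of_mul_le_mul_left h4 hκ
  set K := a * (max 0 (u p) + g) + b with hK
  have hm0 : 0 ≤ max 0 (u p) := le_max_left _ _
  have hK1 : 1 ≤ K := by
    have : 0 ≤ a * (max 0 (u p) + g) := by positivity
    linarith
  set r := min ρ (1 / K) with hr
  have hr0 : 0 < r := lt_min hρ0 (by positivity)
  have hrρ : ball p r ⊆ ball p ρ := ball_subset_ball (min_le_left _ _)
  have hvC : ContDiff ℝ 2 fun y => Real.exp (ν * u y) :=
    (contDiff_const.mul hu).exp
  have h1 := le_weightedMean_of_neg_mul_le_lap hvC (x := p) hr0 (zero_le_one.trans hK1)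
    (fun y _ => (Real.exp_pos _).le) fun y hy => by
      refine le_trans ?_ (hlap y (hsub (hrρ hy)))
      rw [neg_mul, neg_le_neg_iff]
      refine mul_le_mul_of_nonneg_right ?_ (Real.exp_pos _).le
      have h2 : max 0 (u y) ≤ max 0 (u p) + g := by
        refine max_le (by positivity) ((hup y (hrρ hy)).trans ?_)
        gcongr
        exact le_max_right _ _
      rw [hK]
      gcongr
  have h2 := weightedMean_le hvC.continuous (x := p) hr0 fun y _ => (Real.exp_pos _).le
  have hKr : K / 12 * r ^ 2 ≤ 1 := by
    have h3 : r ≤ 1 / K := min_le_right _ _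
    have h4 : K * r ≤ 1 := by
      rw [le_div_iff₀ (by positivity)] at h3; linarith
    have h5 : r ≤ 1 := h3.trans (by rw [div_le_one (by positivity)]; exact hK1)
    nlinarith
  have hκI : IntegrableOn (fun y => Real.exp (κ * u y)) (ball xbar (3 / 2 * R)) := by
    have : Continuous fun y => Real.exp (κ * u y) := by fun_prop
    exact (this.continuousOn.integrableOn_compact
      (isCompact_closedBall xbar (3 / 2 * R))).mono_set ball_subset_closedBall
  have hνI : IntegrableOn (fun y => Real.exp (ν * u y)) (ball p r) :=
    (hvC.continuous.continuousOn.integrableOn_compact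
      (isCompact_closedBall p r)).mono_set ball_subset_closedBall
  have h3 : ∫ y in ball p r, Real.exp (ν * u y) ≤ Real.exp ((ν - κ) * (u p + g)) * C := by
    calc ∫ y in ball p r, Real.exp (ν * u y)
        ≤ ∫ y in ball p r, Real.exp ((ν - κ) * (u p + g)) * Real.exp (κ * u y) := by
          refine setIntegral_mono_on hνI ((hκI.mono_set (hrρ.trans hsub)).const_mul _)
            measurableSet_ball fun y hy => ?_
          rw [← Real.exp_add, Real.exp_le_exp]
          have := mul_le_mul_of_nonneg_left (hup y (hrρ hy)) (sub_nonneg.2 hκν)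
          linarith
      _ = Real.exp ((ν - κ) * (u p + g)) * ∫ y in ball p r, Real.exp (κ * u y) :=
          integral_const_mul _ _
      _ ≤ Real.exp ((ν - κ) * (u p + g)) * C := by
          refine mul_le_mul_of_nonneg_left (le_trans ?_ hint) (Real.exp_pos _).le
          exact setIntegral_mono_set hκI (ae_of_all _ fun y => (Real.exp_pos _).le)
            (hrρ.trans hsub).eventuallyLE
  have h4 : Real.exp (κ * u p) * r ^ N ≤ C₃ := by
    have h5 : Real.exp (ν * u p) * J ≤
        Real.exp 1 * ((r ^ N)⁻¹ * (Real.exp ((ν - κ) * (u p + g)) * C)) :=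
      h1.trans (mul_le_mul (Real.exp_le_exp.2 hKr)
        (h2.trans (mul_le_mul_of_nonneg_left h3 (by positivity)))
        (integral_nonneg fun z => mul_nonneg (Real.exp_pos _).le (by positivity))
        (Real.exp_pos _).le)
    have e1 : Real.exp (ν * u p) = Real.exp ((ν - κ) * u p) * Real.exp (κ * u p) := by
      rw [← Real.exp_add]; ring_nf
    have e2 : Real.exp ((ν - κ) * (u p + g)) =
        Real.exp ((ν - κ) * u p) * Real.exp ((ν - κ) * g) := by
      rw [← Real.exp_add]; ring_nf
    rw [e1, e2] at h5
    have hE := Real.exp_pos ((ν - κ) * u p)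
    have hrN : 0 < r ^ N := by positivity
    rw [hC₃, le_div_iff₀ hJ0]
    refine le_of_mul_le_mul_left (a := Real.exp ((ν - κ) * u p)) ?_ hE
    have h6 := mul_le_mul_of_nonneg_right h5 hrN.le
    calc Real.exp ((ν - κ) * u p) * (Real.exp (κ * u p) * r ^ N * J)
        = Real.exp ((ν - κ) * u p) * Real.exp (κ * u p) * J * r ^ N := by ring
      _ ≤ _ := h6
      _ = _ := by field_simp
  have h5 : Real.exp (κ * u p) * ρ ^ N ≤ Q := by
    rcases le_total ρ (1 / K) with h | h
    · rw [hr, min_eq_left h] at h4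
      exact h4.trans (le_max_left _ _)
    · rw [hr, min_eq_right h, one_div, inv_pow, ← div_eq_mul_inv,
        div_le_iff₀ (by positivity)] at h4
      have hpU : u p ≤ U := by
        rcases le_total (u p) 0 with h0 | h0
        · exact h0.trans hU0
        · refine hU _ h0 ?_
          rwa [hK, max_eq_right h0] at h4
      have hρR : ρ ≤ R := by
        have : 3 / 2 * R - dist p xbar = 2 * ρ := hρd
        have := dist_nonneg (x := p) (y := xbar)
        linarith
      refine le_trans ?_ (le_max_right _ _)
      gcongr
  have h6 : Real.exp (κ * u x) * (R / 2) ^ N ≤ 2 ^ N * Q := by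
    have hxd : R / 2 ≤ d x := by
      have := mem_ball.1 hx
      simp only [hd]; linarith
    calc Real.exp (κ * u x) * (R / 2) ^ N ≤ Real.exp (κ * u x) * d x ^ N := by gcongr
      _ ≤ Real.exp (κ * u p) * d p ^ N :=
          hmax (ball_subset_closedBall (ball_subset_ball (by linarith) hx))
      _ = 2 ^ N * (Real.exp (κ * u p) * ρ ^ N) := by rw [hρd, mul_pow]; ring
      _ ≤ _ := by gcongr
  rw [le_div_iff₀ hκ, mul_comm, Real.le_log_iff_exp_le (by positivity),
    le_div_iff₀ (by positivity)]
  exact h6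

end LocalBound

/-- Interior local a priori bound (Lemma 4.3): on `B_{4R}(xbar)` where `c₋ ≡ 0` and
`μ ≥ μ₁ > 0`, solutions of `-Δu = λ c₊ u + μ |∇u|² + h` are uniformly bounded above
on `B_R(xbar)`, uniformly for `λ ∈ [Λ₁, Λ₂]`. -/
theorem stmt_2 {N : ℕ} (hN : 2 ≤ N) (xbar : EuclideanSpace ℝ (Fin N)) (R : ℝ) (hR : 0 < R)
    (cp h μ : EuclideanSpace ℝ (Fin N) → ℝ) (μ₁ : ℝ) (hμ₁ : 0 < μ₁)
    (hcpc : ContinuousOn cp (closedBall xbar (4 * R)))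
    (hhc : ContinuousOn h (closedBall xbar (4 * R)))
    (hμc : ContinuousOn μ (closedBall xbar (4 * R)))
    (hcp0 : ∀ x ∈ ball xbar (4 * R), 0 ≤ cp x)
    (hcpne : ∃ x ∈ ball xbar R, cp x ≠ 0)
    (hμ : ∀ x ∈ ball xbar (4 * R), μ₁ ≤ μ x) :
    ∀ Λ₁ Λ₂ : ℝ, 0 < Λ₁ → Λ₁ < Λ₂ →
      ∃ M : ℝ, 0 < M ∧ ∀ lam ∈ Icc Λ₁ Λ₂,
        ∀ u : EuclideanSpace ℝ (Fin N) → ℝ,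
          ContDiffOn ℝ 2 u (ball xbar (4 * R)) →
          (∃ C : ℝ, ∀ x ∈ ball xbar (4 * R), |u x| ≤ C) →
          (∀ x ∈ ball xbar (4 * R),
            -lap u x = lam * cp x * u x + μ x * ‖gradient u x‖ ^ 2 + h x) →
          ∀ x ∈ ball xbar R, u x ≤ M := by
  intro Λ₁ Λ₂ hΛ₁ hΛ
  have hN0 : N ≠ 0 := by omega
  have hcomp := isCompact_closedBall xbar (4 * R)
  have hballs : ball xbar (15 / 4 * R) ⊆ ball xbar (4 * R) := ball_subset_ball (by linarith)
  obtain ⟨C₀, hC₀⟩ := hcomp.exists_bound_of_continuousOn hcpc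
  obtain ⟨H, hH⟩ := hcomp.exists_bound_of_continuousOn hhc
  obtain ⟨μ₂, hμ₂⟩ := hcomp.exists_bound_of_continuousOn hμc
  have hcenter : xbar ∈ ball xbar (4 * R) := mem_ball_self (by positivity)
  have hC₀0 : 0 ≤ C₀ := (norm_nonneg _).trans (hC₀ _ (ball_subset_closedBall hcenter))
  have hH0 : 0 ≤ H := (norm_nonneg _).trans (hH _ (ball_subset_closedBall hcenter))
  have hμμ : ∀ x ∈ ball xbar (4 * R), μ x ≤ μ₂ := fun x hx =>
    (le_abs_self _).trans (hμ₂ x (ball_subset_closedBall hx))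
  have hμ12 : μ₁ ≤ μ₂ := (hμ _ hcenter).trans (hμμ _ hcenter)
  have hμ₂0 : 0 < μ₂ := hμ₁.trans_le hμ12
  have hΛ₂ : 0 < Λ₂ := hΛ₁.trans hΛ
  obtain ⟨y₀, hy₀, hcy₀⟩ := hcpne
  have hR4 : ball xbar R ⊆ ball xbar (4 * R) := ball_subset_ball (by linarith)
  have hcpos : 0 < cp y₀ := lt_of_le_of_ne (hcp0 y₀ (hR4 hy₀)) hcy₀.symm
  set δ := cp y₀ / 2 with hδ
  have hδ0 : 0 < δ := by positivity
  obtain ⟨s, hs, hsR, hsδ⟩ : ∃ s : ℝ, 0 < s ∧ ball y₀ s ⊆ ball xbar R ∧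
      ∀ y ∈ ball y₀ s, δ ≤ cp y := by
    have hcat : ContinuousAt cp y₀ := hcpc.continuousAt
      (Filter.mem_of_superset (isOpen_ball.mem_nhds (hR4 hy₀)) ball_subset_closedBall)
    have h1 := hcat.eventually (lt_mem_nhds (half_lt_self hcpos))
    obtain ⟨s, hs, hsub⟩ := Metric.eventually_nhds_iff_ball.1
      (h1.and (isOpen_ball.mem_nhds hy₀))
    exact ⟨s, hs, fun y hy => (hsub y hy).2, fun y hy => (hsub y hy).1.le⟩
  set K := Λ₂ * C₀ + μ₁ * H with hK
  have hK0 : 0 ≤ K := by positivity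
  obtain ⟨A, hA, hAW⟩ :=
    LocalBound.exists_not_forall_lap_le_neg_mul xbar y₀ hR hK0 hs hsR
  obtain ⟨c, hc, hcW⟩ := LocalBound.exists_mul_setIntegral_le xbar hR hK0
  set l := (2 * A / μ₁ + H) / (Λ₁ * δ) with hl
  have hl0 : 0 ≤ l := by positivity
  obtain ⟨M, hM⟩ := LocalBound.exists_bound_of_setIntegral_exp_le hN0 xbar (κ := μ₁) (ν := μ₂)
    (a := μ₂ * (Λ₂ * C₀)) (b := μ₂ * H + 1) (C := (Real.exp (μ₁ * l) + 1) / c) hR hμ₁ hμ12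
    (by positivity) (by have := mul_nonneg hμ₂0.le hH0; linarith) (by positivity)
  refine ⟨max M 1, by positivity, fun lam hlam u hu _ hpde => ?_⟩
  obtain ⟨v, hv, hvu⟩ := LocalBound.exists_contDiff_eqOn_ball (by positivity)
    (show 15 / 4 * R < 4 * R by linarith) hu
  have hlam0 : 0 < lam := hΛ₁.trans_le hlam.1
  have hlapv : ∀ x ∈ ball xbar (15 / 4 * R),
      lap v x = -(lam * cp x * v x + μ x * ‖gradient v x‖ ^ 2 + h x) := by
    intro x hx
    have he : v =ᶠ[nhds x] u := hvu.eventuallyEq_of_mem (isOpen_ball.mem_nhds hx)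
    have hg : gradient v x = gradient u x := by
      unfold gradient; rw [he.fderiv_eq]
    rw [LocalBound.lap_congr he, hg, hvu hx, ← hpde x (hballs hx), neg_neg]
  set W : EuclideanSpace ℝ (Fin N) → ℝ := fun y => Real.exp (μ₁ * v y) + 1 with hW
  have hWC : ContDiff ℝ 2 W := (contDiff_const.mul hv).exp.add contDiff_const
  have hW1 : ∀ y, 1 ≤ W y := fun y => by
    have := Real.exp_pos (μ₁ * v y)
    simp only [hW]; linarith
  have hlapW : ∀ y ∈ ball xbar (15 / 4 * R),
      lap W y ≤ μ₁ * Real.exp (μ₁ * v y) * (-(lam * cp y * v y) + H) := by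
    intro y hy
    have h1 : -H ≤ h y := (abs_le.1 (hH y (ball_subset_closedBall (hballs hy)))).1
    have h2 : μ₁ * ‖gradient v y‖ ^ 2 ≤ μ y * ‖gradient v y‖ ^ 2 := by
      gcongr
      exact hμ y (hballs hy)
    rw [hW, LocalBound.lap_exp_mul_add hv, hlapv y hy]
    have h3 : 0 < μ₁ * Real.exp (μ₁ * v y) := by positivity
    calc _ = μ₁ * Real.exp (μ₁ * v y) * (-(lam * cp y * v y) +
          (μ₁ * ‖gradient v y‖ ^ 2 - μ y * ‖gradient v y‖ ^ 2) - h y) := by ring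
      _ ≤ _ := mul_le_mul_of_nonneg_left (by linarith) h3.le
  have hsuper : ∀ y ∈ ball xbar (15 / 4 * R), lap W y ≤ K * W y := by
    intro y hy
    refine (hlapW y hy).trans ?_
    have hE := Real.exp_pos (μ₁ * v y)
    have h1 : -(μ₁ * v y) * Real.exp (μ₁ * v y) ≤ 1 := by
      have h2 := Real.add_one_le_exp (-(μ₁ * v y))
      calc -(μ₁ * v y) * Real.exp (μ₁ * v y)
          ≤ Real.exp (-(μ₁ * v y)) * Real.exp (μ₁ * v y) := by gcongr; linarith
        _ = 1 := by rw [← Real.exp_add]; simp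
    have hc0 := hcp0 y (hballs hy)
    have hc1 : cp y ≤ C₀ := (le_abs_self _).trans (hC₀ y (ball_subset_closedBall (hballs hy)))
    have h3 : lam * cp y ≤ Λ₂ * C₀ := mul_le_mul hlam.2 hc1 hc0 hΛ₂.le
    have h4 : lam * cp y * (-(μ₁ * v y) * Real.exp (μ₁ * v y)) ≤ lam * cp y * 1 :=
      mul_le_mul_of_nonneg_left h1 (by positivity)
    have h5 : 0 ≤ Λ₂ * C₀ * Real.exp (μ₁ * v y) := by positivity
    have h6 : 0 ≤ μ₁ * H := by positivity
    simp only [hK, hW]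
    linarith
  obtain ⟨x₀, hx₀, hvx₀⟩ : ∃ x ∈ ball y₀ s, v x ≤ l := by
    by_contra! hlt
    refine hAW W hWC (fun y _ => hW1 y) hsuper fun y hy => ?_
    have hyD : y ∈ ball xbar (15 / 4 * R) := ball_subset_ball (by linarith) (hsR hy)
    refine (hlapW y hyD).trans ?_
    have hvl := hlt y hy
    have h1 : Λ₁ * δ * l ≤ lam * cp y * v y :=
      mul_le_mul (mul_le_mul hlam.1 (hsδ y hy) hδ0.le hlam0.le) hvl.le hl0
        (mul_nonneg hlam0.le (hcp0 y (hballs hyD)))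
    have h2 : Λ₁ * δ * l = 2 * A / μ₁ + H := by rw [hl]; field_simp
    have h3 : 1 ≤ Real.exp (μ₁ * v y) :=
      Real.one_le_exp (mul_nonneg hμ₁.le (hl0.trans hvl.le))
    calc μ₁ * Real.exp (μ₁ * v y) * (-(lam * cp y * v y) + H)
        ≤ μ₁ * Real.exp (μ₁ * v y) * (-(2 * A / μ₁)) :=
          mul_le_mul_of_nonneg_left (by linarith) (by positivity)
      _ = -(A * (Real.exp (μ₁ * v y) + Real.exp (μ₁ * v y))) := by field_simp; ring
      _ ≤ -(A * W y) := by
          rw [neg_le_neg_iff]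
          exact mul_le_mul_of_nonneg_left (by simp only [hW]; linarith) hA.le
  have hbound : ∫ y in ball xbar (3 / 2 * R), Real.exp (μ₁ * v y) ≤
      (Real.exp (μ₁ * l) + 1) / c := by
    have hWi : IntegrableOn W (ball xbar (3 / 2 * R)) :=
      (hWC.continuous.continuousOn.integrableOn_compact
        (isCompact_closedBall xbar (3 / 2 * R))).mono_set ball_subset_closedBall
    have h1 : ∫ y in ball xbar (3 / 2 * R), Real.exp (μ₁ * v y) ≤
        ∫ y in ball xbar (3 / 2 * R), W y :=
      integral_mono_of_nonneg (ae_of_all _ fun y => (Real.exp_pos _).le) hWi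
        (ae_of_all _ fun y => by simp [hW])
    have h2 := hcW W hWC (fun y _ => zero_le_one.trans (hW1 y)) hsuper x₀ (hsR hx₀) _
      measurableSet_ball subset_rfl
    have h3 : W x₀ ≤ Real.exp (μ₁ * l) + 1 := by
      simp only [hW]
      gcongr
    rw [le_div_iff₀ hc]
    have := mul_le_mul_of_nonneg_left h1 hc.le
    linarith
  have hsub : ∀ y ∈ ball xbar (3 / 2 * R),
      -((μ₂ * (Λ₂ * C₀) * max 0 (v y) + (μ₂ * H + 1)) * Real.exp (μ₂ * v y)) ≤
        lap (fun y => Real.exp (μ₂ * v y)) y := by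
    intro y hy
    have hyD : y ∈ ball xbar (15 / 4 * R) := ball_subset_ball (by linarith) hy
    have h1 : h y ≤ H := (abs_le.1 (hH y (ball_subset_closedBall (hballs hyD)))).2
    have h2 : μ y * ‖gradient v y‖ ^ 2 ≤ μ₂ * ‖gradient v y‖ ^ 2 := by
      gcongr
      exact hμμ y (hballs hyD)
    have hc0 := hcp0 y (hballs hyD)
    have hc1 : cp y ≤ C₀ := (le_abs_self _).trans (hC₀ y (ball_subset_closedBall (hballs hyD)))
    have h3 : lam * cp y * v y ≤ Λ₂ * C₀ * max 0 (v y) := by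
      calc lam * cp y * v y ≤ lam * cp y * max 0 (v y) :=
            mul_le_mul_of_nonneg_left (le_max_right _ _) (by positivity)
        _ ≤ _ := mul_le_mul_of_nonneg_right (mul_le_mul hlam.2 hc1 hc0 hΛ₂.le) (le_max_left _ _)
    have hE := Real.exp_pos (μ₂ * v y)
    have hlap := LocalBound.lap_exp_mul_add hv μ₂ 0 y
    simp only [add_zero] at hlap
    rw [hlap, hlapv y hyD]
    have h4 : 0 ≤ μ₂ * Real.exp (μ₂ * v y) * ((Λ₂ * C₀ * max 0 (v y) - lam * cp y * v y) +
        (μ₂ * ‖gradient v y‖ ^ 2 - μ y * ‖gradient v y‖ ^ 2) + (H - h y)) :=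
      mul_nonneg (by positivity) (by linarith)
    linarith
  intro x hx
  rw [← hvu (ball_subset_ball (by linarith) hx)]
  exact (hM v hv hsub hbound x hx).trans (le_max_left _ _)
end
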